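/- arXiv:0812.0688 — 2 statements merged into one kernel-verified Lean document; each statement's English description precedes it below -/
import Mathlib

section
/- For any two finite-dimensional representations M, N of a Dynkin quiver Q over an algebraically closed field, the set ℰ(M, N) of points of the representation variety Rep(dim M + dim N) that are extensions of M by N is an irreducible subvariety; consequently it contains a unique dense open GL(b)-orbit. -/
/-!
Statement 4: for a Dynkin quiver `Q` over an algebraically closed field, the set `ℰ(M, N)` of
points of the representation variety `Rep (dim M + dim N)` that are extensions of `M` by `N`
is irreducible; consequently it contains a unique dense open `GL(b)`-orbit.

A quiver on vertices `Fin nv` is given by source and target maps `s t : Fin ne → Fin nv`;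
"Dynkin" is encoded by positive definiteness of the Tits form.  The representation variety
`Rep b` is the affine space `∏_{e} Hom(k^{b(s e)}, k^{b(t e)})`, carrying the Zariski topology
(induced from the prime spectrum of the polynomial ring via evaluation); orbits of
`GL(b) = ∏ᵢ GL(b i)` acting by conjugation are exactly the isomorphism classes.
-/

/-- The Zariski topology on the affine space `σ → K`, induced from `Spec K[Xₛ : s ∈ σ]`. -/
noncomputable def zariskiTopology (σ K : Type*) [Field K] : TopologicalSpace (σ → K) :=
  TopologicalSpace.induced
    (fun x => (⟨RingHom.ker (MvPolynomial.eval x), RingHom.ker_isPrime _⟩ :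
      PrimeSpectrum (MvPolynomial σ K))) inferInstance

variable {nv ne : ℕ}

/-- A point of the representation variety of the quiver `(s, t)` with dimension vector `b`:
a matrix entry for each arrow `e` and each pair of coordinates. -/
def RepPt (s t : Fin ne → Fin nv) (b : Fin nv → ℕ) (K : Type*) : Type _ :=
  ((e : Fin ne) × (Fin (b (t e)) × Fin (b (s e)))) → K

noncomputable instance (s t : Fin ne → Fin nv) (b : Fin nv → ℕ) (K : Type*) [Field K] :
    TopologicalSpace (RepPt s t b K) :=
  zariskiTopology _ K

/-- The matrix of a representation point at an arrow `e`. -/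
def repMat {s t : Fin ne → Fin nv} {b : Fin nv → ℕ} {K : Type*} (ρ : RepPt s t b K)
    (e : Fin ne) : Matrix (Fin (b (t e))) (Fin (b (s e))) K :=
  Matrix.of fun p q => ρ ⟨e, (p, q)⟩

/-- `φ` is a homomorphism of representations `ρ → ρ'`. -/
def IsRepHom {s t : Fin ne → Fin nv} {b c : Fin nv → ℕ} {K : Type*} [Field K]
    (ρ : RepPt s t b K) (ρ' : RepPt s t c K)
    (φ : ∀ i, Matrix (Fin (c i)) (Fin (b i)) K) : Prop :=
  ∀ e, φ (t e) * repMat ρ e = repMat ρ' e * φ (s e)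

/-- `φ` is an isomorphism of representations `ρ → ρ'`. -/
def IsRepIso {s t : Fin ne → Fin nv} {b c : Fin nv → ℕ} {K : Type*} [Field K]
    (ρ : RepPt s t b K) (ρ' : RepPt s t c K)
    (φ : ∀ i, Matrix (Fin (c i)) (Fin (b i)) K) : Prop :=
  IsRepHom ρ ρ' φ ∧ ∀ i, Function.Bijective (φ i).mulVecLin

/-- The isomorphism class (= `GL(b)`-orbit) of a representation point. -/
def isoClass {s t : Fin ne → Fin nv} {b : Fin nv → ℕ} {K : Type*} [Field K]
    (ρ : RepPt s t b K) : Set (RepPt s t b K) :=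
  {ρ' | ∃ φ, IsRepIso ρ ρ' φ}

/-- `X` is an extension of `M` by `N`: there is a short exact sequence `0 → N → X → M → 0`. -/
def IsExtensionOf {s t : Fin ne → Fin nv} {a b c : Fin nv → ℕ} {K : Type*} [Field K]
    (X : RepPt s t b K) (M : RepPt s t a K) (N : RepPt s t c K) : Prop :=
  ∃ (ι : ∀ i, Matrix (Fin (b i)) (Fin (c i)) K) (π : ∀ i, Matrix (Fin (a i)) (Fin (b i)) K),
    IsRepHom N X ι ∧ IsRepHom X M π ∧
    (∀ i, Function.Injective (ι i).mulVecLin) ∧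
    (∀ i, Function.Surjective (π i).mulVecLin) ∧
    (∀ i, LinearMap.range (ι i).mulVecLin = LinearMap.ker (π i).mulVecLin)

/-- `ℰ(M, N) ⊆ Rep (dim M + dim N)`: the set of extensions of `M` by `N`. -/
def extSet {s t : Fin ne → Fin nv} {a c : Fin nv → ℕ} {K : Type*} [Field K]
    (M : RepPt s t a K) (N : RepPt s t c K) : Set (RepPt s t (fun i => a i + c i) K) :=
  {X | IsExtensionOf X M N}

/-- The quiver `(s, t)` is Dynkin: its Tits form is positive definite. -/
def IsDynkinQuiver (s t : Fin ne → Fin nv) : Prop :=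
  ∀ d : Fin nv → ℤ, d ≠ 0 → 0 < ∑ i, d i ^ 2 - ∑ e, d (s e) * d (t e)


universe u
section Ringel

/-- A family of submodules stable under the maps of an (abstract) representation. -/
def QStable {K : Type u} [Field K] {s t : Fin ne → Fin nv} {V : Fin nv → Type u}
    [∀ i, AddCommGroup (V i)] [∀ i, Module K (V i)]
    (f : ∀ e, V (s e) →ₗ[K] V (t e)) (U : ∀ i, Submodule K (V i)) : Prop :=
  ∀ e, ∀ x ∈ U (s e), f e x ∈ U (t e)

/-- No nontrivial direct sum decompositions (the zero representation is allowed). -/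
def QIndec {K : Type u} [Field K] {s t : Fin ne → Fin nv} {V : Fin nv → Type u}
    [∀ i, AddCommGroup (V i)] [∀ i, Module K (V i)]
    (f : ∀ e, V (s e) →ₗ[K] V (t e)) : Prop :=
  ∀ U U' : ∀ i, Submodule K (V i), QStable f U → QStable f U' → (∀ i, IsCompl (U i) (U' i)) →
    (∀ i, U i = ⊥) ∨ (∀ i, U' i = ⊥)

/-- Endomorphisms of a representation. -/
def QEndo {K : Type u} [Field K] {s t : Fin ne → Fin nv} {V : Fin nv → Type u}
    [∀ i, AddCommGroup (V i)] [∀ i, Module K (V i)]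
    (f : ∀ e, V (s e) →ₗ[K] V (t e)) (a : ∀ i, V i →ₗ[K] V i) : Prop :=
  ∀ e x, a (t e) (f e x) = f e (a (s e) x)

/-- Vanishing of the self-extensions. -/
def QRigid {K : Type u} [Field K] {s t : Fin ne → Fin nv} {V : Fin nv → Type u}
    [∀ i, AddCommGroup (V i)] [∀ i, Module K (V i)]
    (f : ∀ e, V (s e) →ₗ[K] V (t e)) : Prop :=
  ∀ δ : ∀ e, V (s e) →ₗ[K] V (t e), ∃ θ : ∀ i, V i →ₗ[K] V i,
    ∀ e x, θ (t e) (f e x) - f e (θ (s e) x) = δ e x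

variable {K : Type u} [Field K] {s t : Fin ne → Fin nv} {V : Fin nv → Type u}
    [∀ i, AddCommGroup (V i)] [∀ i, Module K (V i)] [∀ i, FiniteDimensional K (V i)]
    (f : ∀ e, V (s e) →ₗ[K] V (t e))

/-- The map whose kernel is `End` and whose cokernel is `Ext¹`. -/
def qPhi : (∀ i, V i →ₗ[K] V i) →ₗ[K] (∀ e, V (s e) →ₗ[K] V (t e)) where
  toFun θ := fun e => θ (t e) ∘ₗ f e - f e ∘ₗ θ (s e)
  map_add' a b := by
    funext e; ext x; simp; abel
  map_smul' c a := by
    funext e; ext x; simp [smul_sub]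

lemma qrigid_of_scalar (hQ : IsDynkinQuiver s t)
    (h : ∀ a, QEndo f a → ∃ l : K, ∀ i x, a i x = l • x) : QRigid f := by
  have hker : LinearMap.ker (qPhi f) ≤ Submodule.span K {fun i => (LinearMap.id : V i →ₗ[K] V i)} := by
    intro a ha
    have : QEndo f a := by
      intro e x
      have := congrArg (fun g => g e x) (LinearMap.mem_ker.1 ha)
      simpa [qPhi, sub_eq_zero] using this
    obtain ⟨l, hl⟩ := h a this
    rw [Submodule.mem_span_singleton]
    refine ⟨l, ?_⟩
    funext i; ext x; simp [hl]
  have hk1 : Module.finrank K (LinearMap.ker (qPhi f)) ≤ 1 :=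
    (Submodule.finrank_mono hker).trans
      (by simpa using finrank_span_le_card (R := K) {fun i => (LinearMap.id : V i →ₗ[K] V i)})
  have hrn := LinearMap.finrank_range_add_finrank_ker (qPhi f)
  have hd1 : Module.finrank K (∀ i, V i →ₗ[K] V i) = ∑ i, Module.finrank K (V i) ^ 2 := by
    rw [Module.finrank_pi_fintype]
    simp [Module.finrank_linearMap, sq]
  have hd2 : Module.finrank K (∀ e, V (s e) →ₗ[K] V (t e))
      = ∑ e, Module.finrank K (V (s e)) * Module.finrank K (V (t e)) := by
    rw [Module.finrank_pi_fintype]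
    simp [Module.finrank_linearMap]
  have hsurj : LinearMap.range (qPhi f) = ⊤ := by
    apply Submodule.eq_top_of_finrank_eq
    apply le_antisymm (Submodule.finrank_le _)
    by_cases hd : (fun i => (Module.finrank K (V i) : ℤ)) = 0
    · rw [hd2]
      have : ∀ i, Module.finrank K (V i) = 0 := fun i => by
        have := congrFun hd i
        simpa using this
      simp [this]
    · have := hQ _ hd
      have h1 : ((∑ i, Module.finrank K (V i) ^ 2 : ℕ) : ℤ) >
        ((∑ e, Module.finrank K (V (s e)) * Module.finrank K (V (t e)) : ℕ) : ℤ) := by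
        push_cast; linarith
      rw [← hd1, ← hd2] at h1
      omega
  intro δ
  obtain ⟨θ, hθ⟩ := LinearMap.range_eq_top.1 hsurj δ
  refine ⟨θ, fun e x => ?_⟩
  rw [← hθ]; rfl

lemma qfitting [IsAlgClosed K] (hI : QIndec f) (a : ∀ i, V i →ₗ[K] V i) (ha : QEndo f a) :
    ∃ (l : K) (N : ℕ), ∀ i, (a i - l • LinearMap.id) ^ N = 0 := by
  by_cases hz : ∀ i, Subsingleton (V i)
  · refine ⟨0, 0, fun i => ?_⟩
    have := hz i
    ext x; exact Subsingleton.elim _ _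
  push Not at hz
  obtain ⟨i0, hi0⟩ := hz
  obtain ⟨l, hl⟩ := Module.End.exists_eigenvalue (a i0)
  set b : ∀ i, Module.End K (V i) := fun i => a i - l • LinearMap.id with hb
  have hbf : ∀ n e x, (b (t e) ^ n) (f e x) = f e ((b (s e) ^ n) x) := by
    intro n
    induction n with
    | zero => intro e x; simp
    | succ n ih =>
      intro e x
      rw [pow_succ, pow_succ, Module.End.mul_apply, Module.End.mul_apply, ← ih]
      congr 1
      simp [hb, ha e x]
  have hev : ∀ᶠ n in Filter.atTop, ∀ i, IsCompl (LinearMap.ker (b i ^ n)) (LinearMap.range (b i ^ n)) := by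
    rw [Filter.eventually_all]
    intro i
    exact LinearMap.eventually_isCompl_ker_pow_range_pow (b i)
  obtain ⟨N, hN, hN1⟩ := (hev.and (Filter.eventually_ge_atTop 1)).exists
  refine ⟨l, N, fun i => ?_⟩
  have hs1 : QStable f (fun i => LinearMap.ker (b i ^ N)) := by
    intro e x hx
    simp only [LinearMap.mem_ker] at hx ⊢
    rw [hbf, hx, map_zero]
  have hs2 : QStable f (fun i => LinearMap.range (b i ^ N)) := by
    rintro e x ⟨y, rfl⟩
    exact ⟨f e y, hbf _ _ _⟩
  rcases hI _ _ hs1 hs2 hN with h | h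
  · exfalso
    obtain ⟨v, hv⟩ := hl.exists_hasEigenvector
    have h0 : b i0 v = 0 := by
      have := hv.apply_eq_smul
      simp [hb, this]
    have : v ∈ LinearMap.ker (b i0 ^ N) := by
      obtain ⟨m, rfl⟩ : ∃ m, N = m + 1 := ⟨N - 1, by omega⟩
      rw [LinearMap.mem_ker, pow_succ, Module.End.mul_apply, h0, map_zero]
    rw [h i0] at this
    exact hv.2 (by simpa using this)
  · exact LinearMap.range_eq_bot.1 (h i)

lemma qexists_sq_zero [IsAlgClosed K] (hI : QIndec f) (a : ∀ i, V i →ₗ[K] V i) (ha : QEndo f a)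
    (hns : ¬ ∃ l : K, ∀ i x, a i x = l • x) :
    ∃ c : ∀ i, V i →ₗ[K] V i, QEndo f c ∧ (∃ i, c i ≠ 0) ∧ ∀ i x, c i (c i x) = 0 := by
  classical
  obtain ⟨l, hN⟩ := qfitting f hI a ha
  set b : ∀ i, Module.End K (V i) := fun i => a i - l • LinearMap.id with hb
  have hbf : ∀ n e x, (b (t e) ^ n) (f e x) = f e ((b (s e) ^ n) x) := by
    intro n
    induction n with
    | zero => intro e x; simp
    | succ n ih =>
      intro e x
      rw [pow_succ, pow_succ, Module.End.mul_apply, Module.End.mul_apply, ← ih]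
      congr 1
      simp [hb, ha e x]
  have hN' : ∃ N : ℕ, ∀ i, b i ^ N = 0 := hN
  have hspec := Nat.find_spec hN'
  have hmin := fun m => @Nat.find_min _ _ hN' m
  set N := Nat.find hN' with hNdef
  have hne : ¬ ∀ i, b i = 0 := by
    intro h
    apply hns
    refine ⟨l, fun i x => ?_⟩
    have := congrArg (fun g => g x) (h i)
    simpa [hb, sub_eq_zero] using this
  have h2 : 2 ≤ N := by
    by_contra hlt
    have : N = 0 ∨ N = 1 := by omega
    apply hne
    rcases this with h | h
    · rw [h] at hspec
      intro i
      have := hspec i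
      rw [pow_zero] at this
      rw [← mul_one (b i), this, mul_zero]
    · rw [h] at hspec
      intro i; simpa using hspec i
  refine ⟨fun i => b i ^ (N - 1), fun e x => hbf _ _ _, ?_, fun i x => ?_⟩
  · have := hmin (N - 1) (by omega)
    push Not at this
    exact this
  · rw [← Module.End.mul_apply, ← pow_add, show N - 1 + (N - 1) = N + (N - 2) by omega, pow_add,
      hspec i, zero_mul]; rfl

lemma exists_factor {A B C : Type u} [AddCommGroup A] [Module K A] [AddCommGroup B] [Module K B]
    [AddCommGroup C] [Module K C] (g : A →ₗ[K] B) (d : A →ₗ[K] C)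
    (h : ∀ x, g x = 0 → d x = 0) : ∃ ε : B →ₗ[K] C, ∀ x, ε (g x) = d x := by
  obtain ⟨σ, hσ⟩ := g.rangeRestrict.exists_rightInverse_of_surjective g.range_rangeRestrict
  obtain ⟨ε, hε⟩ := LinearMap.exists_extend (d ∘ₗ σ)
  refine ⟨ε, fun x => ?_⟩
  have h1 := congrArg (fun q => q (g.rangeRestrict x)) hε
  have h2 := congrArg (fun q => (q (g.rangeRestrict x) : B)) hσ
  simp at h1 h2
  rw [h1, ← sub_eq_zero, ← map_sub]
  apply h
  rw [map_sub, sub_eq_zero]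
  exact h2

/-- Existence of a square zero endomorphism contradicts indecomposability, given rigidity of
smaller indecomposables. -/
lemma qringel_step (hI : QIndec f)
    (ih : ∀ (W : ∀ i, Submodule K (V i)) (hW : QStable f W),
      ∑ i, Module.finrank K (W i) < ∑ i, Module.finrank K (V i) →
      QIndec (V := fun i => W i) (s := s) (t := t) (fun e => (f e).restrict (hW e)) →
      QRigid (V := fun i => W i) (s := s) (t := t) (fun e => (f e).restrict (hW e)))
    (hc : ∃ c : ∀ i, V i →ₗ[K] V i, QEndo f c ∧ (∃ i, c i ≠ 0) ∧ ∀ i x, c i (c i x) = 0) :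
    False := by
  classical
  -- choose `c` of minimal rank
  obtain ⟨c, ⟨hcE, hc0, hc2⟩, hcmin⟩ := exists_minimalFor_of_wellFoundedLT
    (fun c : ∀ i, V i →ₗ[K] V i => QEndo f c ∧ (∃ i, c i ≠ 0) ∧ ∀ i x, c i (c i x) = 0)
    (fun c => ∑ i, Module.finrank K (LinearMap.range (c i))) hc
  let P : (∀ i, Submodule K (V i) × Submodule K (V i)) → Prop := fun W =>
    QStable f (fun i => (W i).1) ∧ QStable f (fun i => (W i).2) ∧
    (∀ i, Disjoint (W i).1 (W i).2) ∧ (∀ i, (W i).1 ⊔ (W i).2 = LinearMap.ker (c i)) ∧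
    ∃ i, ¬ LinearMap.range (c i) ≤ (W i).2
  have hP : ∃ W, P W := by
    refine ⟨fun i => (LinearMap.ker (c i), ⊥), ?_, ?_, ?_, ?_, ?_⟩
    · intro e x hx
      simp only [LinearMap.mem_ker] at hx ⊢
      rw [hcE, hx, map_zero]
    · intro e x hx
      simp only [Submodule.mem_bot] at hx ⊢
      rw [hx, map_zero]
    · intro i; exact disjoint_bot_right
    · intro i; simp
    · obtain ⟨i, hi⟩ := hc0
      refine ⟨i, ?_⟩
      simpa [LinearMap.range_eq_bot] using hi
  obtain ⟨WW, hPW, hWmin⟩ := exists_minimalFor_of_wellFoundedLT P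
    (fun W => ∑ i, Module.finrank K (W i).1) hP
  obtain ⟨W, W', rfl⟩ : ∃ W W' : ∀ i, Submodule K (V i), WW = fun i => (W i, W' i) :=
    ⟨fun i => (WW i).1, fun i => (WW i).2, rfl⟩
  obtain ⟨hW, hW', hdis, hsup, hnr⟩ := hPW
  simp only at hW hW' hdis hsup hnr hWmin
  have hWle : ∀ i, W i ≤ LinearMap.ker (c i) := fun i => (hsup i) ▸ le_sup_left
  have hWle' : ∀ i, W' i ≤ LinearMap.ker (c i) := fun i => (hsup i) ▸ le_sup_right
  -- W is not zero
  have hW0 : ¬ ∀ i, W i = ⊥ := by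
    intro h
    obtain ⟨i, hi⟩ := hnr
    apply hi
    have := hsup i
    rw [h i, bot_sup_eq] at this
    rw [this]
    rintro _ ⟨y, rfl⟩
    exact hc2 i y
  -- the rank of W is smaller
  have hWlt : ∑ i, Module.finrank K (W i) < ∑ i, Module.finrank K (V i) := by
    obtain ⟨i, hi⟩ := hc0
    refine Finset.sum_lt_sum (fun i _ => Submodule.finrank_le _) ⟨i, Finset.mem_univ _, ?_⟩
    apply Submodule.finrank_lt
    intro htop
    apply hi
    rw [← LinearMap.ker_eq_top, eq_top_iff, ← htop]
    exact hWle i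
  -- W is indecomposable
  have hWI : QIndec (V := fun i => W i) (s := s) (t := t) (fun e => (f e).restrict (hW e)) := by
    intro U U' hU hU' hUU
    let X : ∀ i, Submodule K (V i) := fun i => (U i).map (W i).subtype
    let X' : ∀ i, Submodule K (V i) := fun i => (U' i).map (W i).subtype
    have hX : QStable f X := by
      rintro e _ ⟨y, hy, rfl⟩
      exact ⟨_, hU e y hy, rfl⟩
    have hX' : QStable f X' := by
      rintro e _ ⟨y, hy, rfl⟩
      exact ⟨_, hU' e y hy, rfl⟩
    have hXX : ∀ i, X i ⊔ X' i = W i := by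
      intro i
      rw [← Submodule.map_sup, (hUU i).sup_eq_top, Submodule.map_top, Submodule.range_subtype]
    have hXd : ∀ i, Disjoint (X i) (X' i) := by
      intro i
      rw [disjoint_iff, ← Submodule.map_inf _ (Submodule.subtype_injective _),
        (hUU i).inf_eq_bot, Submodule.map_bot]
    have key : ∀ A B : ∀ i, Submodule K (V i), QStable f A → QStable f B →
        (∀ i, A i ⊔ B i = W i) → (∀ i, Disjoint (A i) (B i)) → ¬ (∀ i, B i = ⊥) →
        ∀ i, LinearMap.range (c i) ≤ B i ⊔ W' i := by
      intro A B hA hB hAB hABd hB0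
      by_contra hcon
      push Not at hcon
      have hPA : P (fun i => (A i, B i ⊔ W' i)) := by
        refine ⟨hA, ?_, ?_, ?_, hcon⟩
        · intro e x hx
          obtain ⟨y, hy, z, hz, rfl⟩ := Submodule.mem_sup.1 hx
          rw [map_add]
          exact Submodule.add_mem_sup (hB e y hy) (hW' e z hz)
        · intro i
          exact (hABd i).disjoint_sup_right_of_disjoint_sup_left ((hAB i).symm ▸ hdis i)
        · intro i
          show A i ⊔ (B i ⊔ W' i) = _
          rw [← sup_assoc, hAB, hsup]
      have hlt : ∑ i, Module.finrank K (A i) < ∑ i, Module.finrank K (W i) := by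
        push Not at hB0
        obtain ⟨i, hi⟩ := hB0
        refine Finset.sum_lt_sum (fun i _ => Submodule.finrank_mono ((hAB i) ▸ le_sup_left))
          ⟨i, Finset.mem_univ _, ?_⟩
        apply Submodule.finrank_lt_finrank_of_lt
        rw [← hAB i]
        apply lt_of_le_of_ne le_sup_left
        intro heq
        apply hi
        have h1 : B i ≤ A i := heq ▸ le_sup_right
        exact (hABd i).eq_bot_of_ge h1
      have := hWmin hPA hlt.le
      exact absurd hlt (not_lt.2 this)
    by_contra hcon
    push Not at hcon
    obtain ⟨⟨i1, hi1⟩, i2, hi2⟩ := hcon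
    have hb : ∀ (i : Fin nv) (U : Submodule K (W i)), U.map (W i).subtype = ⊥ → U = ⊥ := by
      intro i U h
      exact Submodule.map_injective_of_injective (Submodule.subtype_injective (W i))
        (h.trans (Submodule.map_bot _).symm)
    have k1 := key X X' hX hX' hXX hXd (fun h => hi2 (hb _ _ (h i2)))
    have k2 := key X' X hX' hX (fun i => by rw [sup_comm, hXX]) (fun i => (hXd i).symm)
      (fun h => hi1 (hb _ _ (h i1)))
    obtain ⟨i, hi⟩ := hnr
    apply hi
    intro x hx
    obtain ⟨y, hy, z, hz, h1⟩ := Submodule.mem_sup.1 (k1 i hx)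
    obtain ⟨y', hy', z', hz', h2⟩ := Submodule.mem_sup.1 (k2 i hx)
    have hyW : y ∈ W i := (hXX i) ▸ Submodule.mem_sup_right hy
    have hyW' : y' ∈ W i := (hXX i) ▸ Submodule.mem_sup_left hy'
    have h3 : y - y' = z' - z := by
      rw [sub_eq_sub_iff_add_eq_add, h1, add_comm, h2]
    have h4 : y - y' = 0 := by
      apply (Submodule.disjoint_def.1 (hdis i)) _ (Submodule.sub_mem _ hyW hyW')
      rw [h3]; exact Submodule.sub_mem _ hz' hz
    have h5 : y = y' := sub_eq_zero.1 h4
    have h6 : y = 0 := (Submodule.disjoint_def.1 (hXd i)) _ (h5 ▸ hy') hy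
    rw [← h1, h6, zero_add]; exact hz
  have hWR := ih W hW hWlt hWI
  -- the projections
  choose W'' hW'' hcompl using fun i => (hdis i).symm.exists_isCompl
  have hcompl : ∀ i, IsCompl (W i) (W'' i) := fun i => (hcompl i).symm
  let r : ∀ i, V i →ₗ[K] W i := fun i => (W i).projectionOnto (W'' i) (hcompl i)
  have hrW : ∀ i (x : W i), r i x = x := fun i x => Submodule.projectionOnto_apply_left _ _
  have hrW' : ∀ i, ∀ x ∈ W' i, r i x = 0 := fun i x hx =>
    (Submodule.projectionOnto_apply_eq_zero_iff _).2 (hW'' i hx)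
  have hrf : ∀ e x, c (s e) x = 0 → (r (t e) (f e x) : V (t e)) = f e (r (s e) x) := by
    intro e x hx
    have : x ∈ W (s e) ⊔ W' (s e) := by rw [hsup]; exact hx
    obtain ⟨y, hy, z, hz, rfl⟩ := Submodule.mem_sup.1 this
    have e1 := hrW _ ⟨y, hy⟩
    have e2 := hrW _ ⟨f e y, hW e y hy⟩
    simp only at e1 e2
    simp only [map_add, hrW' _ z hz, hrW' _ _ (hW' e z hz), e1, e2]
    simp
  let g : ∀ i, V i →ₗ[K] W i := fun i => r i ∘ₗ c i
  have hgf : ∀ e x, (g (t e) (f e x) : V (t e)) = f e (g (s e) x) := by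
    intro e x
    simp only [g, LinearMap.comp_apply]
    rw [hcE, hrf _ _ (hc2 _ _)]
  -- the kernel of g is that of c
  have hgc : ∀ i x, g i x = 0 → c i x = 0 := by
    let G : ∀ i, V i →ₗ[K] V i := fun i => (W i).subtype ∘ₗ g i
    have hG : QEndo f G ∧ (∃ i, G i ≠ 0) ∧ ∀ i x, G i (G i x) = 0 := by
      refine ⟨hgf, ?_, ?_⟩
      · obtain ⟨i, hi⟩ := hnr
        refine ⟨i, fun h0 => hi ?_⟩
        rintro _ ⟨x, rfl⟩
        have h1 : r i (c i x) = 0 := by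
          have := congrArg (fun q => q x) h0
          simpa [G, g] using this
        have : c i x ∈ W i ⊔ W' i := by rw [hsup]; exact hc2 _ _
        obtain ⟨y, hy, z, hz, h⟩ := Submodule.mem_sup.1 this
        have e1 := hrW _ ⟨y, hy⟩
        rw [← h, map_add, hrW' _ z hz, add_zero] at h1
        simp only at e1
        rw [e1] at h1
        have h1 : y = 0 := congrArg Subtype.val h1
        rw [← h, h1, zero_add]; exact hz
      · intro i x
        have : c i (g i x : V i) = 0 := hWle i (g i x).2
        simp [G, g] at this ⊢
        rw [this, map_zero]
    have hle : ∀ i, Module.finrank K (LinearMap.range (G i)) ≤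
        Module.finrank K (LinearMap.range (c i)) := by
      intro i
      have : G i = ((W i).subtype ∘ₗ r i) ∘ₗ c i := rfl
      rw [this, LinearMap.range_comp]
      exact Submodule.finrank_map_le _ _
    have hge := hcmin hG (Finset.sum_le_sum fun i _ => hle i)
    have heq : ∀ i, Module.finrank K (LinearMap.range (G i)) =
        Module.finrank K (LinearMap.range (c i)) := by
      intro i
      have := (Finset.sum_eq_sum_iff_of_le (fun i _ => hle i)).1
        (le_antisymm (Finset.sum_le_sum fun i _ => hle i) hge)
      exact this i (Finset.mem_univ _)
    intro i x hx
    have hk : LinearMap.ker (c i) = LinearMap.ker (G i) := by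
      apply Submodule.eq_of_le_of_finrank_eq
      · intro y hy
        simp [G, g, LinearMap.mem_ker.1 hy]
      · have h1 := LinearMap.finrank_range_add_finrank_ker (c i)
        have h2 := LinearMap.finrank_range_add_finrank_ker (G i)
        have := heq i
        omega
    have : x ∈ LinearMap.ker (G i) := by simp [G, hx]
    rw [← hk] at this
    exact this
  -- correct the projection to a homomorphism
  have hfac : ∀ e, ∃ ε : W (s e) →ₗ[K] W (t e), ∀ x, ε (g (s e) x) =
      (r (t e) ∘ₗ f e - (f e).restrict (hW e) ∘ₗ r (s e)) x := by
    intro e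
    apply exists_factor
    intro x hx
    have := hrf e x (hgc _ _ hx)
    apply Subtype.ext
    simp [this]
  choose ε hε using hfac
  obtain ⟨θ, hθ⟩ := hWR ε
  let ρ : ∀ i, V i →ₗ[K] W i := fun i => r i - θ i ∘ₗ g i
  have hρf : ∀ e x, (ρ (t e) (f e x) : V (t e)) = f e (ρ (s e) x) := by
    intro e x
    have h1 := hθ e (g (s e) x)
    rw [hε] at h1
    have h2 : g (t e) (f e x) = (f e).restrict (hW e) (g (s e) x) := Subtype.ext (hgf e x)
    have h3 := congrArg Subtype.val h1
    simp only [ρ, LinearMap.sub_apply, LinearMap.comp_apply, h2]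
    simp only [LinearMap.sub_apply, LinearMap.comp_apply, Submodule.coe_sub,
      LinearMap.coe_restrict_apply] at h3
    rw [Submodule.coe_sub, Submodule.coe_sub, map_sub, sub_eq_sub_iff_sub_eq_sub, ← h3]
  have hρW : ∀ i (x : W i), ρ i x = x := by
    intro i x
    have : c i x = 0 := hWle i x.2
    simp [ρ, g, this, hrW]
  have hfin := hI W (fun i => LinearMap.ker (ρ i)) hW (by
    intro e x hx
    have := hρf e x
    rw [LinearMap.mem_ker.1 hx] at this
    rw [LinearMap.mem_ker]
    apply Subtype.ext
    simpa using this) (fun i => LinearMap.isCompl_of_proj (hρW i))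
  rcases hfin with h | h
  · exact hW0 h
  · apply absurd hWlt
    apply not_lt.2
    refine Finset.sum_le_sum fun i _ => ?_
    exact LinearMap.finrank_le_finrank_of_injective (LinearMap.ker_eq_bot.1 (h i))

end Ringel

lemma qringel {K : Type u} [Field K] [IsAlgClosed K] {s t : Fin ne → Fin nv}
    (hQ : IsDynkinQuiver s t) (n : ℕ) : ∀ (V : Fin nv → Type u)
    [∀ i, AddCommGroup (V i)] [∀ i, Module K (V i)] [∀ i, FiniteDimensional K (V i)]
    (f : ∀ e, V (s e) →ₗ[K] V (t e)), ∑ i, Module.finrank K (V i) = n → QIndec f → QRigid f := by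
  induction n using Nat.strong_induction_on with
  | _ n ih =>
    intro V _ _ _ f hn hI
    by_cases h : ∀ a, QEndo f a → ∃ l : K, ∀ i x, a i x = l • x
    · exact qrigid_of_scalar f hQ h
    · exfalso
      push Not at h
      obtain ⟨a, ha, hns⟩ := h
      refine qringel_step f hI ?_ (qexists_sq_zero f hI a ha (by push Not; exact hns))
      intro W hW hlt hWI
      exact ih _ (hn ▸ hlt) (fun i => W i) _ rfl hWI
section Zariski

variable {K : Type u} [Field K] {τ σ : Type*}

/-- The algebra of polynomial functions on affine space. -/
noncomputable def PolyFun (τ : Type*) (K : Type u) [Field K] : Subalgebra K ((τ → K) → K) :=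
  (MvPolynomial.aeval (fun (i : τ) (x : τ → K) => x i)).range

lemma mem_polyFun {f : (τ → K) → K} :
    f ∈ PolyFun τ K ↔ ∃ P : MvPolynomial τ K, ∀ x, MvPolynomial.eval x P = f x := by
  have key : ∀ (P : MvPolynomial τ K) x,
      (MvPolynomial.aeval (fun (i : τ) (x : τ → K) => x i) P) x = MvPolynomial.eval x P := by
    intro P x
    induction P using MvPolynomial.induction_on with
    | C a => simp
    | add p q hp hq => simp [hp, hq]
    | mul_X p i hp => simp [hp]
  constructor
  · rintro ⟨P, rfl⟩
    exact ⟨P, fun x => (key P x).symm⟩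
  · rintro ⟨P, hP⟩
    exact ⟨P, by funext x; rw [← hP x]; exact key P x⟩

lemma polyFun_coord (i : τ) : (fun x : τ → K => x i) ∈ PolyFun τ K :=
  mem_polyFun.2 ⟨MvPolynomial.X i, fun x => by simp⟩

lemma polyFun_const (a : K) : (fun _ : τ → K => a) ∈ PolyFun τ K :=
  mem_polyFun.2 ⟨MvPolynomial.C a, fun x => by simp⟩

lemma polyFun_add {f g : (τ → K) → K} (hf : f ∈ PolyFun τ K) (hg : g ∈ PolyFun τ K) :
    (fun x => f x + g x) ∈ PolyFun τ K := (PolyFun τ K).add_mem hf hg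

lemma polyFun_sub {f g : (τ → K) → K} (hf : f ∈ PolyFun τ K) (hg : g ∈ PolyFun τ K) :
    (fun x => f x - g x) ∈ PolyFun τ K := (PolyFun τ K).sub_mem hf hg

lemma polyFun_mul {f g : (τ → K) → K} (hf : f ∈ PolyFun τ K) (hg : g ∈ PolyFun τ K) :
    (fun x => f x * g x) ∈ PolyFun τ K := (PolyFun τ K).mul_mem hf hg

lemma polyFun_pow {f : (τ → K) → K} (hf : f ∈ PolyFun τ K) (n : ℕ) :
    (fun x => f x ^ n) ∈ PolyFun τ K := (PolyFun τ K).pow_mem hf n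

lemma polyFun_sum {ι : Type*} (S : Finset ι) {f : ι → (τ → K) → K} (hf : ∀ i, f i ∈ PolyFun τ K) :
    (fun x => ∑ i ∈ S, f i x) ∈ PolyFun τ K := by
  have := (PolyFun τ K).sum_mem (t := S) (f := f) (fun i _ => hf i)
  convert this using 1
  funext x; simp

lemma polyFun_prod {ι : Type*} (S : Finset ι) {f : ι → (τ → K) → K} (hf : ∀ i, f i ∈ PolyFun τ K) :
    (fun x => ∏ i ∈ S, f i x) ∈ PolyFun τ K := by
  have := (PolyFun τ K).prod_mem (t := S) (f := f) (fun i _ => hf i)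
  convert this using 1
  funext x; simp

lemma polyFun_mulMat {l m n : Type*} [Fintype m] {A : (τ → K) → Matrix l m K}
    {B : (τ → K) → Matrix m n K} (hA : ∀ i j, (fun x => A x i j) ∈ PolyFun τ K)
    (hB : ∀ i j, (fun x => B x i j) ∈ PolyFun τ K) (i : l) (j : n) :
    (fun x => (A x * B x) i j) ∈ PolyFun τ K := by
  simp only [Matrix.mul_apply]
  exact polyFun_sum _ fun k => polyFun_mul (hA i k) (hB k j)

lemma polyFun_det {n : Type*} [Fintype n] [DecidableEq n] {A : (τ → K) → Matrix n n K}
    (hA : ∀ i j, (fun x => A x i j) ∈ PolyFun τ K) :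
    (fun x => (A x).det) ∈ PolyFun τ K := by
  simp only [Matrix.det_apply']
  exact polyFun_sum _ fun k => polyFun_mul (polyFun_const _) (polyFun_prod _ fun i => hA _ _)

lemma polyFun_adj {n : Type*} [Fintype n] [DecidableEq n] {A : (τ → K) → Matrix n n K}
    (hA : ∀ i j, (fun x => A x i j) ∈ PolyFun τ K) (i j : n) :
    (fun x => (A x).adjugate i j) ∈ PolyFun τ K := by
  simp only [Matrix.adjugate_apply]
  apply polyFun_det
  intro k l
  simp only [Matrix.updateRow_apply]
  split_ifs
  · exact polyFun_const _
  · exact hA _ _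

/-- Polynomial functions can be composed. -/
lemma polyFun_comp {f : (σ → K) → K} (hf : f ∈ PolyFun σ K) {F : (τ → K) → (σ → K)}
    (hF : ∀ j, (fun x => F x j) ∈ PolyFun τ K) : (fun x => f (F x)) ∈ PolyFun τ K := by
  obtain ⟨P, hP⟩ := mem_polyFun.1 hf
  simp only [← hP]
  induction P using MvPolynomial.induction_on generalizing f with
  | C a => simpa using polyFun_const a
  | add p q hp hq =>
    simp only [map_add]
    exact polyFun_add (hp (f := fun x => MvPolynomial.eval x p) (mem_polyFun.2 ⟨p, fun _ => rfl⟩)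
      (fun _ => rfl)) (hq (f := fun x => MvPolynomial.eval x q) (mem_polyFun.2 ⟨q, fun _ => rfl⟩)
      (fun _ => rfl))
  | mul_X p i hp =>
    simp only [map_mul, MvPolynomial.eval_X]
    exact polyFun_mul (hp (f := fun x => MvPolynomial.eval x p) (mem_polyFun.2 ⟨p, fun _ => rfl⟩)
      (fun _ => rfl)) (hF i)

lemma zariski_isOpen {f : (τ → K) → K} (hf : f ∈ PolyFun τ K) :
    @IsOpen _ (zariskiTopology τ K) {x | f x ≠ 0} := by
  obtain ⟨P, hP⟩ := mem_polyFun.1 hf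
  unfold zariskiTopology
  rw [isOpen_induced_iff]
  refine ⟨_, PrimeSpectrum.isOpen_basicOpen (a := P), ?_⟩
  ext x
  simp [PrimeSpectrum.mem_basicOpen, RingHom.mem_ker, hP]

lemma zariski_basis {U : Set (τ → K)} (hU : @IsOpen _ (zariskiTopology τ K) U) {x : τ → K}
    (hx : x ∈ U) : ∃ f ∈ PolyFun τ K, f x ≠ 0 ∧ ∀ y, f y ≠ 0 → y ∈ U := by
  unfold zariskiTopology at hU
  rw [isOpen_induced_iff] at hU
  obtain ⟨O, hO, rfl⟩ := hU
  obtain ⟨_, ⟨P, rfl⟩, hxP, hPO⟩ :=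
    PrimeSpectrum.isTopologicalBasis_basic_opens.exists_subset_of_mem_open hx hO
  refine ⟨fun y => MvPolynomial.eval y P, mem_polyFun.2 ⟨P, fun _ => rfl⟩, ?_, fun y hy => hPO ?_⟩
  · simpa [PrimeSpectrum.mem_basicOpen, RingHom.mem_ker] using hxP
  · simpa [PrimeSpectrum.mem_basicOpen, RingHom.mem_ker] using hy

/-- Nonzero polynomial functions have a nonzero product. -/
lemma polyFun_mul_ne [Infinite K] {f g : (τ → K) → K} (hf : f ∈ PolyFun τ K)
    (hg : g ∈ PolyFun τ K) (hf0 : ∃ x, f x ≠ 0) (hg0 : ∃ x, g x ≠ 0) :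
    ∃ x, f x * g x ≠ 0 := by
  obtain ⟨P, hP⟩ := mem_polyFun.1 hf
  obtain ⟨Q, hQ⟩ := mem_polyFun.1 hg
  by_contra hcon
  push Not at hcon
  have : P * Q = 0 := by
    apply MvPolynomial.funext
    intro x
    simp [hP, hQ, hcon]
  rcases mul_eq_zero.1 this with h | h
  · obtain ⟨x, hx⟩ := hf0
    apply hx; rw [← hP, h, map_zero]
  · obtain ⟨x, hx⟩ := hg0
    apply hx; rw [← hQ, h, map_zero]

/-- Pull back of a polynomial function under a rational map. -/
lemma polyFun_clear {d : (τ → K) → K} (hd : d ∈ PolyFun τ K) {F : (τ → K) → (σ → K)}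
    (hF : ∀ j, ∃ (N : ℕ), ∃ g ∈ PolyFun τ K, ∀ x, d x ≠ 0 → g x = d x ^ N * F x j)
    {f : (σ → K) → K} (hf : f ∈ PolyFun σ K) :
    ∃ (N : ℕ), ∃ g ∈ PolyFun τ K, ∀ x, d x ≠ 0 → g x = d x ^ N * f (F x) := by
  obtain ⟨P, hP⟩ := mem_polyFun.1 hf
  simp only [← hP]
  clear hP hf
  induction P using MvPolynomial.induction_on with
  | C a => exact ⟨0, _, polyFun_const a, fun x _ => by simp⟩
  | add p q hp hq =>
    obtain ⟨N, g, hg, h1⟩ := hp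
    obtain ⟨M, g', hg', h2⟩ := hq
    refine ⟨N + M, _, polyFun_add (polyFun_mul (polyFun_pow hd M) hg)
      (polyFun_mul (polyFun_pow hd N) hg'), fun x hx => ?_⟩
    simp only [h1 x hx, h2 x hx, map_add]; ring
  | mul_X p i hp =>
    obtain ⟨N, g, hg, h1⟩ := hp
    obtain ⟨M, g', hg', h2⟩ := hF i
    refine ⟨N + M, _, polyFun_mul hg hg', fun x hx => ?_⟩
    simp only [h1 x hx, h2 x hx, map_mul, MvPolynomial.eval_X]; ring

/-- Images of principal open sets under rational maps are irreducible. -/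
lemma zariski_irreducible [Infinite K] {d : (τ → K) → K} (hd : d ∈ PolyFun τ K)
    (hd0 : ∃ x, d x ≠ 0) {F : (τ → K) → (σ → K)}
    (hF : ∀ j, ∃ (N : ℕ), ∃ g ∈ PolyFun τ K, ∀ x, d x ≠ 0 → g x = d x ^ N * F x j) :
    @IsIrreducible _ (zariskiTopology σ K) (F '' {x | d x ≠ 0}) := by
  let _ := zariskiTopology σ K
  refine ⟨Set.Nonempty.image F hd0, ?_⟩
  rintro U U' hU hU' ⟨_, ⟨x, hx, rfl⟩, hxU⟩ ⟨_, ⟨y, hy, rfl⟩, hyU⟩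
  obtain ⟨f, hf, hfx, hfU⟩ := zariski_basis hU hxU
  obtain ⟨f', hf', hfy, hfU'⟩ := zariski_basis hU' hyU
  obtain ⟨N, g, hg, hgf⟩ := polyFun_clear hd hF hf
  obtain ⟨N', g', hg', hgf'⟩ := polyFun_clear hd hF hf'
  have h1 : ∃ z, g z ≠ 0 := ⟨x, by rw [hgf x hx]; exact mul_ne_zero (pow_ne_zero _ hx) hfx⟩
  have h2 : ∃ z, g' z ≠ 0 := ⟨y, by rw [hgf' y hy]; exact mul_ne_zero (pow_ne_zero _ hy) hfy⟩
  obtain ⟨z, hz⟩ := polyFun_mul_ne hd (polyFun_mul hg hg') hd0 (polyFun_mul_ne hg hg' h1 h2)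
  have hz1 := left_ne_zero_of_mul hz
  have hz2 := left_ne_zero_of_mul (right_ne_zero_of_mul hz)
  have hz3 := right_ne_zero_of_mul (right_ne_zero_of_mul hz)
  rw [hgf z hz1] at hz2
  rw [hgf' z hz1] at hz3
  exact ⟨F z, ⟨z, hz1, rfl⟩, hfU _ (right_ne_zero_of_mul hz2), hfU' _ (right_ne_zero_of_mul hz3)⟩

/-- The abstract form of the local triviality of kernels of constant rank families. -/
lemma kernel_family {m n : Type*} [Fintype m] [Fintype n] [DecidableEq m] [DecidableEq n]
    {A : (τ → K) → Matrix m n K}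
    (hA : ∀ i j, (fun x => A x i j) ∈ PolyFun τ K) (x₀ : τ → K) :
    ∃ B : (τ → K) → Matrix n n K, (∀ i j, (fun x => B x i j) ∈ PolyFun τ K) ∧ B x₀ = 1 ∧
      ∀ x v, (A x).mulVec v = 0 → (A x₀).mulVec ((B x).mulVec v) = 0 := by
  obtain ⟨C, hC⟩ : ∃ C : Matrix n m K, A x₀ * C * A x₀ = A x₀ := by
    let a := Matrix.toLin' (A x₀)
    obtain ⟨σ, hσ⟩ := a.rangeRestrict.exists_rightInverse_of_surjective a.range_rangeRestrict
    obtain ⟨ε, hε⟩ := LinearMap.exists_extend σ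
    refine ⟨LinearMap.toMatrix' ε, ?_⟩
    apply Matrix.toLin'.injective
    rw [Matrix.toLin'_mul, Matrix.toLin'_mul, Matrix.toLin'_toMatrix']
    apply LinearMap.ext
    intro x
    have h1 := congrArg (fun q => q (a.rangeRestrict x)) hε
    have h2 := congrArg (fun q => (q (a.rangeRestrict x) : m → K)) hσ
    simp at h1 h2
    have h3 : ε (a x) = σ (a.rangeRestrict x) := h1
    show a (ε (a x)) = a x
    rw [h3]
    exact h2
  refine ⟨fun x => C * A x + (1 - C * A x₀), ?_, by simp, ?_⟩
  · intro i j
    simp only [Matrix.add_apply]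
    exact polyFun_add (polyFun_mulMat (A := fun _ => C) (fun _ _ => polyFun_const _) hA i j) (polyFun_const _)
  · intro x v hv
    rw [Matrix.mulVec_mulVec, Matrix.mul_add, Matrix.add_mulVec, Matrix.mul_sub, ← Matrix.mul_assoc,
      ← Matrix.mul_assoc, hC, ← Matrix.mulVec_mulVec, hv]
    simp

lemma kernel_dim_open {m n : Type*} [Fintype m] [Fintype n] [DecidableEq m] [DecidableEq n]
    {A : (τ → K) → Matrix m n K}
    (hA : ∀ i j, (fun x => A x i j) ∈ PolyFun τ K) (h : ℕ) :
    @IsOpen _ (zariskiTopology τ K) {x | Module.finrank K (LinearMap.ker (A x).mulVecLin) < h} := by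
  let _ := zariskiTopology τ K
  rw [isOpen_iff_forall_mem_open]
  intro x₀ hx₀
  obtain ⟨B, hB, hB1, hBA⟩ := kernel_family hA x₀
  refine ⟨_, ?_, zariski_isOpen (polyFun_det hB), by simp [hB1]⟩
  intro x hx
  rw [Set.mem_ofPred_eq] at hx₀ ⊢
  refine lt_of_le_of_lt ?_ hx₀
  have hinj : Function.Injective (B x).mulVec :=
    Matrix.mulVec_injective_of_isUnit ((Matrix.isUnit_iff_isUnit_det _).2 (isUnit_iff_ne_zero.2 hx))
  let ψ : LinearMap.ker (A x).mulVecLin →ₗ[K] LinearMap.ker (A x₀).mulVecLin :=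
    (B x).mulVecLin.restrict (fun v hv => hBA x v hv)
  apply LinearMap.finrank_le_finrank_of_injective (f := ψ)
  intro v w hvw
  exact Subtype.ext (hinj (congrArg Subtype.val hvw))

lemma kernel_local {m n : Type*} [Fintype m] [Fintype n] [DecidableEq m] [DecidableEq n]
    {A : (τ → K) → Matrix m n K}
    (hA : ∀ i j, (fun x => A x i j) ∈ PolyFun τ K) (x₀ : τ → K) {v₀ : n → K}
    (hv₀ : (A x₀).mulVec v₀ = 0) {p : (n → K) → K} (hp : p ∈ PolyFun n K) (hp0 : p v₀ ≠ 0) :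
    ∃ U, @IsOpen _ (zariskiTopology τ K) U ∧ x₀ ∈ U ∧ ∀ x ∈ U,
      Module.finrank K (LinearMap.ker (A x₀).mulVecLin) ≤
        Module.finrank K (LinearMap.ker (A x).mulVecLin) →
      ∃ v, (A x).mulVec v = 0 ∧ p v ≠ 0 := by
  let _ := zariskiTopology τ K
  obtain ⟨B, hB, hB1, hBA⟩ := kernel_family hA x₀
  have hq : (fun x => p ((B x).adjugate.mulVec v₀)) ∈ PolyFun τ K := by
    apply polyFun_comp hp (F := fun x => (B x).adjugate.mulVec v₀)
    intro j
    simp only [Matrix.mulVec, dotProduct]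
    exact polyFun_sum _ fun k => polyFun_mul (polyFun_adj hB _ _) (polyFun_const _)
  refine ⟨_, (zariski_isOpen (polyFun_det hB)).inter (zariski_isOpen hq), ?_, ?_⟩
  · simp [hB1, hp0]
  · rintro x ⟨hx, hx2⟩ hle
    have hinj : Function.Injective (B x).mulVec :=
      Matrix.mulVec_injective_of_isUnit ((Matrix.isUnit_iff_isUnit_det _).2 (isUnit_iff_ne_zero.2 hx))
    let ψ : LinearMap.ker (A x).mulVecLin →ₗ[K] LinearMap.ker (A x₀).mulVecLin :=
      (B x).mulVecLin.restrict (fun v hv => hBA x v hv)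
    have hψ : Function.Injective ψ := by
      intro v w hvw
      exact Subtype.ext (hinj (congrArg Subtype.val hvw))
    have hs : Function.Surjective ψ :=
      (LinearMap.injective_iff_surjective_of_finrank_eq_finrank
        (le_antisymm (LinearMap.finrank_le_finrank_of_injective hψ) hle)).1 hψ
    obtain ⟨⟨v, hv⟩, hv2⟩ := hs ⟨(B x).det • v₀, by simp [Matrix.mulVec_smul, hv₀]⟩
    refine ⟨v, hv, ?_⟩
    have h3 : (B x).mulVec v = (B x).det • v₀ := congrArg Subtype.val hv2
    have h4 : v = (B x).adjugate.mulVec v₀ := by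
      apply hinj
      rw [h3, Matrix.mulVec_mulVec, Matrix.mul_adjugate, Matrix.smul_mulVec, Matrix.one_mulVec]
    rw [h4]; exact hx2

end Zariski
section Orbits

variable {K : Type u} [Field K] {s t : Fin ne → Fin nv} {b : Fin nv → ℕ}

lemma bijective_iff_det {n : ℕ} (A : Matrix (Fin n) (Fin n) K) :
    Function.Bijective A.mulVecLin ↔ A.det ≠ 0 := by
  rw [← isUnit_iff_ne_zero, ← Matrix.isUnit_iff_isUnit_det]
  constructor
  · intro h
    exact Matrix.mulVec_injective_iff_isUnit.1 h.1
  · intro h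
    exact ⟨Matrix.mulVec_injective_iff_isUnit.2 h, Matrix.mulVec_surjective_iff_isUnit.2 h⟩

lemma isoClass_refl (X : RepPt s t b K) : X ∈ isoClass X :=
  ⟨fun _ => 1, fun e => by simp, fun i => by rw [bijective_iff_det]; simp⟩

lemma isoClass_symm {X Y : RepPt s t b K} (h : Y ∈ isoClass X) : X ∈ isoClass Y := by
  obtain ⟨φ, h1, h2⟩ := h
  have hd : ∀ i, IsUnit (φ i).det := fun i => isUnit_iff_ne_zero.2 ((bijective_iff_det _).1 (h2 i))
  refine ⟨fun i => (φ i)⁻¹, fun e => ?_, fun i => ?_⟩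
  · have h3 := h1 e
    calc (φ (t e))⁻¹ * repMat Y e
        = (φ (t e))⁻¹ * (repMat Y e * φ (s e)) * (φ (s e))⁻¹ := by
          rw [Matrix.mul_assoc, Matrix.mul_assoc, Matrix.mul_nonsing_inv _ (hd _), Matrix.mul_one]
      _ = repMat X e * (φ (s e))⁻¹ := by
          rw [← h3, ← Matrix.mul_assoc, Matrix.nonsing_inv_mul _ (hd _), Matrix.one_mul]
  · rw [bijective_iff_det, ← isUnit_iff_ne_zero]
    exact Matrix.isUnit_nonsing_inv_det _ (hd i)

lemma isoClass_trans {X Y Z : RepPt s t b K} (h : Y ∈ isoClass X) (h' : Z ∈ isoClass Y) :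
    Z ∈ isoClass X := by
  obtain ⟨φ, h1, h2⟩ := h
  obtain ⟨ψ, h3, h4⟩ := h'
  refine ⟨fun i => ψ i * φ i, fun e => ?_, fun i => ?_⟩
  · rw [Matrix.mul_assoc, h1, ← Matrix.mul_assoc, h3, Matrix.mul_assoc]
  · rw [bijective_iff_det, Matrix.det_mul]
    exact mul_ne_zero ((bijective_iff_det _).1 (h4 i)) ((bijective_iff_det _).1 (h2 i))

lemma isoClass_eq {X Y : RepPt s t b K} (h : Y ∈ isoClass X) : isoClass Y = isoClass X :=
  Set.ext fun _ => ⟨fun h' => isoClass_trans h h', fun h' => isoClass_trans (isoClass_symm h) h'⟩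

/-- View a vector as a family of square matrices. -/
def toMats (v : ((i : Fin nv) × (Fin (b i) × Fin (b i))) → K) (i : Fin nv) :
    Matrix (Fin (b i)) (Fin (b i)) K := Matrix.of fun p q => v ⟨i, (p, q)⟩

/-- The linear map whose kernel is `Hom(X, Y)`. -/
def homLin (X Y : RepPt s t b K) : (((i : Fin nv) × (Fin (b i) × Fin (b i))) → K) →ₗ[K]
    (((e : Fin ne) × (Fin (b (t e)) × Fin (b (s e)))) → K) where
  toFun v := fun j => (toMats v (t j.1) * repMat X j.1 - repMat Y j.1 * toMats v (s j.1)) j.2.1 j.2.2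
  map_add' v w := by
    funext j
    simp [Matrix.mul_apply, toMats, add_mul, mul_add, Finset.sum_add_distrib]
    ring
  map_smul' a v := by
    funext j
    simp [Matrix.mul_apply, toMats, mul_sub, Finset.mul_sum]
    congr 1 <;> refine Finset.sum_congr rfl fun _ _ => by ring

lemma homLin_eq_zero {X Y : RepPt s t b K} {v} : homLin X Y v = 0 ↔ IsRepHom X Y (toMats v) := by
  constructor
  · intro h e
    ext p q
    have := congrFun h ⟨e, (p, q)⟩
    simpa [homLin, sub_eq_zero] using this
  · intro h
    funext j
    simp [homLin, h j.1]

lemma toMats_surj (φ : ∀ i, Matrix (Fin (b i)) (Fin (b i)) K) : ∃ v, toMats v = φ :=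
  ⟨fun j => φ j.1 j.2.1 j.2.2, rfl⟩

/-- Dimension of the space of homomorphisms. -/
noncomputable def homDim (X Y : RepPt s t b K) : ℕ := Module.finrank K (LinearMap.ker (homLin X Y))

lemma homMat_poly (X : RepPt s t b K) (i j) :
    (fun Y : ((e : Fin ne) × (Fin (b (t e)) × Fin (b (s e)))) → K =>
      LinearMap.toMatrix' (homLin X Y) i j) ∈ PolyFun _ K := by
  simp only [LinearMap.toMatrix'_apply, homLin, LinearMap.coe_mk, AddHom.coe_mk, Matrix.sub_apply]
  refine polyFun_sub (polyFun_const _) ?_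
  simp only [Matrix.mul_apply, repMat, Matrix.of_apply]
  exact polyFun_sum _ fun k => polyFun_mul (polyFun_coord _) (polyFun_const _)

lemma homMat_ker (X Y : RepPt s t b K) :
    LinearMap.ker (LinearMap.toMatrix' (homLin X Y)).mulVecLin = LinearMap.ker (homLin X Y) := by
  rw [← Matrix.toLin'_apply', Matrix.toLin'_toMatrix']

lemma homDim_closed (X : RepPt s t b K) (h : ℕ) : IsClosed {Y | h ≤ homDim X Y} := by
  rw [← isOpen_compl_iff]
  have : IsOpen {Y : RepPt s t b K | Module.finrank K
      (LinearMap.ker (LinearMap.toMatrix' (homLin X Y)).mulVecLin) < h} :=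
    kernel_dim_open (homMat_poly X) h
  convert this using 1
  ext Y
  rw [Set.mem_ofPred_eq, homMat_ker]
  simp [homDim]

lemma homDim_le_of_iso {X Y Y' : RepPt s t b K} (h : Y' ∈ isoClass Y) :
    homDim X Y ≤ homDim X Y' := by
  obtain ⟨φ, h1, h2⟩ := h
  let L : (((i : Fin nv) × (Fin (b i) × Fin (b i))) → K) →ₗ[K]
      (((i : Fin nv) × (Fin (b i) × Fin (b i))) → K) :=
    { toFun := fun v j => (φ j.1 * toMats v j.1) j.2.1 j.2.2
      map_add' := fun v w => by
        funext j
        simp [Matrix.mul_apply, toMats, mul_add, Finset.sum_add_distrib]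
      map_smul' := fun a v => by
        funext j
        simp [Matrix.mul_apply, toMats, Finset.mul_sum]
        refine Finset.sum_congr rfl fun _ _ => by ring }
  have hL : ∀ v i, toMats (L v) i = φ i * toMats v i := fun v i => rfl
  have hLk : ∀ v ∈ LinearMap.ker (homLin X Y), L v ∈ LinearMap.ker (homLin X Y') := by
    intro v hv
    rw [LinearMap.mem_ker, homLin_eq_zero] at hv ⊢
    intro e
    rw [hL, hL, Matrix.mul_assoc, hv e, ← Matrix.mul_assoc, h1, Matrix.mul_assoc]
  apply LinearMap.finrank_le_finrank_of_injective (f := L.restrict hLk)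
  intro v w hvw
  have h3 : L v = L w := congrArg Subtype.val hvw
  apply Subtype.ext
  funext ⟨i, p, q⟩
  have h4 : φ i * toMats v i = φ i * toMats w i := by rw [← hL, ← hL, h3]
  have hd : IsUnit (φ i).det := isUnit_iff_ne_zero.2 ((bijective_iff_det _).1 (h2 i))
  have h5 : toMats v.1 i = toMats w.1 i := by
    have := congrArg (fun q => (φ i)⁻¹ * q) h4
    simpa [← Matrix.mul_assoc, Matrix.nonsing_inv_mul _ hd] using this
  exact congrFun (congrFun h5 p) q

lemma orbit_local {X Y₀ : RepPt s t b K} (hY : Y₀ ∈ isoClass X) :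
    ∃ U : Set (RepPt s t b K), IsOpen U ∧ Y₀ ∈ U ∧
      ∀ Y ∈ U, homDim X X ≤ homDim X Y → Y ∈ isoClass X := by
  have hle := homDim_le_of_iso (X := X) (isoClass_symm hY)
  obtain ⟨φ, h1, h2⟩ := hY
  obtain ⟨v₀, rfl⟩ := toMats_surj φ
  have hp : (fun v : (((i : Fin nv) × (Fin (b i) × Fin (b i))) → K) => ∏ i, (toMats v i).det)
      ∈ PolyFun _ K := by
    apply polyFun_prod _ (f := fun i v => (toMats v i).det)
    intro i
    apply polyFun_det
    intro p q
    exact polyFun_coord _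
  obtain ⟨U, hU, hYU, h⟩ := kernel_local (homMat_poly X) Y₀ (v₀ := v₀)
    (by rw [LinearMap.toMatrix'_mulVec]; exact homLin_eq_zero.2 h1) hp
    (Finset.prod_ne_zero_iff.2 fun i _ => (bijective_iff_det _).1 (h2 i))
  refine ⟨U, hU, hYU, fun Y hYU' hXY => ?_⟩
  have h3 := h Y hYU'
  rw [homMat_ker, homMat_ker] at h3
  obtain ⟨v, hv, hpv⟩ := h3 (hle.trans hXY)
  rw [LinearMap.toMatrix'_mulVec] at hv
  exact ⟨toMats v, homLin_eq_zero.1 hv,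
    fun i => (bijective_iff_det _).2 (Finset.prod_ne_zero_iff.1 hpv i (Finset.mem_univ _))⟩

/-- An orbit is the intersection of a closed and an open set. -/
lemma orbit_locallyClosed (X : RepPt s t b K) :
    ∃ Z U : Set (RepPt s t b K), IsClosed Z ∧ IsOpen U ∧ isoClass X = Z ∩ U ∧
      Z = {Y | homDim X X ≤ homDim X Y} := by
  choose U hU hYU h using fun Y₀ : isoClass X => orbit_local Y₀.2
  refine ⟨_, ⋃ Y₀, U Y₀, homDim_closed X (homDim X X), isOpen_iUnion hU, ?_, rfl⟩
  ext Y
  constructor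
  · intro hY
    exact ⟨homDim_le_of_iso hY, Set.mem_iUnion.2 ⟨⟨Y, hY⟩, hYU _⟩⟩
  · rintro ⟨h1, h2⟩
    obtain ⟨Y₀, h3⟩ := Set.mem_iUnion.1 h2
    exact h Y₀ Y h3 h1

/-- Rigid representations have open orbits. -/
lemma orbit_open_of_rigid (X : RepPt s t b K)
    (hX : QRigid (V := fun i => Fin (b i) → K) (s := s) (t := t)
      (fun e => Matrix.toLin' (repMat X e))) : IsOpen (isoClass X) := by
  obtain ⟨Z, U, -, hU, h, hZ⟩ := orbit_locallyClosed X
  have hs : Function.Surjective (homLin X X) := by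
    intro w
    obtain ⟨θ, hθ⟩ := hX (fun e => Matrix.toLin' (Matrix.of fun p q => w ⟨e, (p, q)⟩))
    obtain ⟨v, hv⟩ := toMats_surj (fun i => LinearMap.toMatrix' (θ i))
    refine ⟨v, ?_⟩
    funext ⟨e, p, q⟩
    have h1 : toMats v (t e) * repMat X e - repMat X e * toMats v (s e)
        = Matrix.of fun p q => w ⟨e, (p, q)⟩ := by
      apply Matrix.toLin'.injective
      apply LinearMap.ext
      intro x
      rw [← hθ e x, hv]
      simp
    exact congrFun (congrFun h1 p) q
  have hZ' : Z = Set.univ := by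
    rw [hZ, Set.eq_univ_iff_forall]
    intro Y
    have h1 := LinearMap.finrank_range_add_finrank_ker (homLin X X)
    have h2 := LinearMap.finrank_range_add_finrank_ker (homLin X Y)
    rw [LinearMap.range_eq_top.2 hs, finrank_top] at h1
    have h3 := Submodule.finrank_le (LinearMap.range (homLin X Y))
    simp only [Set.mem_ofPred_eq, homDim]
    omega
  rw [h, hZ', Set.univ_inter]
  exact hU

/-- Two nonempty open sets meet. -/
lemma repPt_open_inter [Infinite K] {U U' : Set (RepPt s t b K)} (hU : IsOpen U) (hU' : IsOpen U')
    (h : U.Nonempty) (h' : U'.Nonempty) : (U ∩ U').Nonempty := by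
  obtain ⟨x, hx⟩ := h
  obtain ⟨y, hy⟩ := h'
  obtain ⟨f, hf, hfx, hfU⟩ := zariski_basis hU hx
  obtain ⟨g, hg, hgy, hgU⟩ := zariski_basis hU' hy
  obtain ⟨z, hz⟩ := polyFun_mul_ne hf hg ⟨x, hfx⟩ ⟨y, hgy⟩
  exact ⟨z, hfU _ (left_ne_zero_of_mul hz), hgU _ (right_ne_zero_of_mul hz)⟩

end Orbits
section Finiteness

/-- Isomorphism of abstract representations. -/
def QIso {K : Type u} [Field K] {s t : Fin ne → Fin nv} {V W : Fin nv → Type u}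
    [∀ i, AddCommGroup (V i)] [∀ i, Module K (V i)] [∀ i, AddCommGroup (W i)] [∀ i, Module K (W i)]
    (f : ∀ e, V (s e) →ₗ[K] V (t e)) (g : ∀ e, W (s e) →ₗ[K] W (t e)) : Prop :=
  ∃ φ : ∀ i, V i ≃ₗ[K] W i, ∀ e x, φ (t e) (f e x) = g e (φ (s e) x)

/-- The abstract representation of a point of the representation variety. -/
noncomputable def toQ {K : Type u} [Field K] {s t : Fin ne → Fin nv} {b : Fin nv → ℕ}
    (X : RepPt s t b K) (e : Fin ne) : (Fin (b (s e)) → K) →ₗ[K] (Fin (b (t e)) → K) :=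
  Matrix.toLin' (repMat X e)

variable {K : Type u} [Field K] {s t : Fin ne → Fin nv} {b : Fin nv → ℕ} {V W T : Fin nv → Type u}
    [∀ i, AddCommGroup (V i)] [∀ i, Module K (V i)] [∀ i, AddCommGroup (W i)] [∀ i, Module K (W i)]
    [∀ i, AddCommGroup (T i)] [∀ i, Module K (T i)]
    {f : ∀ e, V (s e) →ₗ[K] V (t e)} {g : ∀ e, W (s e) →ₗ[K] W (t e)}
    {h : ∀ e, T (s e) →ₗ[K] T (t e)}

lemma QIso.symm (hfg : QIso f g) : QIso g f := by
  obtain ⟨φ, hφ⟩ := hfg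
  refine ⟨fun i => (φ i).symm, fun e x => ?_⟩
  rw [LinearEquiv.symm_apply_eq, hφ, LinearEquiv.apply_symm_apply]

lemma QIso.trans (hfg : QIso f g) (hgh : QIso g h) : QIso f h := by
  obtain ⟨φ, hφ⟩ := hfg
  obtain ⟨ψ, hψ⟩ := hgh
  refine ⟨fun i => (φ i).trans (ψ i), fun e x => ?_⟩
  simp [hφ, hψ]

lemma exists_qIso_repPt [∀ i, FiniteDimensional K (V i)] (f : ∀ e, V (s e) →ₗ[K] V (t e))
    (hb : ∀ i, Module.finrank K (V i) = b i) :
    ∃ X : RepPt s t b K, QIso (W := fun i => Fin (b i) → K) f (toQ X) := by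
  let φ : ∀ i, V i ≃ₗ[K] (Fin (b i) → K) := fun i => LinearEquiv.ofFinrankEq _ _ (by simp [hb])
  refine ⟨fun j => LinearMap.toMatrix' ((φ (t j.1)).toLinearMap ∘ₗ f j.1 ∘ₗ
    (φ (s j.1)).symm.toLinearMap) j.2.1 j.2.2, φ, fun e x => ?_⟩
  have : repMat (s := s) (t := t) (b := b) (fun j => LinearMap.toMatrix' ((φ (t j.1)).toLinearMap ∘ₗ f j.1 ∘ₗ
    (φ (s j.1)).symm.toLinearMap) j.2.1 j.2.2) e = LinearMap.toMatrix'
      ((φ (t e)).toLinearMap ∘ₗ f e ∘ₗ (φ (s e)).symm.toLinearMap) := rfl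
  show φ (t e) (f e x) = Matrix.toLin' (repMat _ e) (φ (s e) x)
  rw [this, Matrix.toLin'_toMatrix']
  simp

lemma isoClass_of_qIso {X Y : RepPt s t b K}
    (hXY : QIso (V := fun i => Fin (b i) → K) (W := fun i => Fin (b i) → K) (toQ X) (toQ Y)) :
    Y ∈ isoClass X := by
  obtain ⟨φ, hφ⟩ := hXY
  refine ⟨fun i => LinearMap.toMatrix' (φ i).toLinearMap, fun e => ?_, fun i => ?_⟩
  · apply Matrix.toLin'.injective
    apply LinearMap.ext
    intro x
    have := hφ e x
    simpa [toQ, Matrix.toLin'_mul] using this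
  · rw [← Matrix.toLin'_apply', Matrix.toLin'_toMatrix']
    exact (φ i).bijective

lemma qIso_of_decomp {U U' : ∀ i, Submodule K (V i)} {R R' : ∀ i, Submodule K (W i)}
    (hU : QStable f U) (hU' : QStable f U') (hR : QStable g R) (hR' : QStable g R')
    (hUU : ∀ i, IsCompl (U i) (U' i)) (hRR : ∀ i, IsCompl (R i) (R' i))
    (h1 : QIso (V := fun i => U i) (W := fun i => R i) (s := s) (t := t)
      (fun e => (f e).restrict (hU e)) (fun e => (g e).restrict (hR e)))
    (h2 : QIso (V := fun i => U' i) (W := fun i => R' i) (s := s) (t := t)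
      (fun e => (f e).restrict (hU' e)) (fun e => (g e).restrict (hR' e))) : QIso f g := by
  obtain ⟨φ, hφ⟩ := h1
  obtain ⟨ψ, hψ⟩ := h2
  let ω : ∀ i, V i ≃ₗ[K] W i := fun i =>
    ((Submodule.prodEquivOfIsCompl _ _ (hUU i)).symm.trans ((φ i).prodCongr (ψ i))).trans
      (Submodule.prodEquivOfIsCompl _ _ (hRR i))
  have hω : ∀ i (x : U i) (y : U' i), ω i (x + y) = φ i x + ψ i y := by
    intro i x y
    have : (Submodule.prodEquivOfIsCompl _ _ (hUU i)).symm (x + y) = (x, y) := by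
      rw [LinearEquiv.symm_apply_eq]; simp
    simp only [ω, LinearEquiv.trans_apply, this]
    simp
  refine ⟨ω, fun e x => ?_⟩
  obtain ⟨⟨y, z⟩, rfl⟩ := (Submodule.prodEquivOfIsCompl _ _ (hUU (s e))).surjective x
  have h3 := congrArg Subtype.val (hφ e y)
  have h4 := congrArg Subtype.val (hψ e z)
  simp only [LinearMap.coe_restrict_apply] at h3 h4
  show ω (t e) (f e ((y : V (s e)) + z)) = g e (ω (s e) ((y : V (s e)) + z))
  rw [hω, map_add (g e), ← h3, ← h4, map_add (f e)]
  exact hω (t e) ((f e).restrict (hU e) y) ((f e).restrict (hU' e) z)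

lemma finite_reps_of_rel {β : Type*} {D : Set β} (hD : D.Finite) (R : RepPt s t b K → β → Prop)
    (hR : ∀ X Y d, R X d → R Y d → Y ∈ isoClass X) :
    ∃ S : Set (RepPt s t b K), S.Finite ∧ ∀ X, (∃ d ∈ D, R X d) → ∃ Y ∈ S, X ∈ isoClass Y := by
  have hF : ∀ d, ∃ X₀, (∃ X, R X d) → R X₀ d := by
    intro d
    by_cases hd : ∃ X, R X d
    · obtain ⟨X, hX⟩ := hd
      exact ⟨X, fun _ => hX⟩
    · exact ⟨fun _ => 0, fun h => absurd h hd⟩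
  choose F hF using hF
  refine ⟨F '' D, hD.image _, ?_⟩
  rintro X ⟨d, hd, hX⟩
  exact ⟨_, ⟨d, hd, rfl⟩, hR _ _ d (hF d ⟨X, hX⟩) hX⟩

/-- A Dynkin quiver has finitely many isomorphism classes in each dimension vector. -/
theorem finite_orbits [IsAlgClosed K] (hQ : IsDynkinQuiver s t) (n : ℕ) :
    ∀ b : Fin nv → ℕ, ∑ i, b i = n →
      ∃ S : Set (RepPt s t b K), S.Finite ∧ ∀ X, ∃ Y ∈ S, X ∈ isoClass Y := by
  induction n using Nat.strong_induction_on with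
  | _ n ih =>
    intro b hb
    have hinf : Infinite K := IsAlgClosed.instInfinite
    have ih' : ∀ b' : Fin nv → ℕ, ∃ S : Set (RepPt s t b' K), S.Finite ∧
        (∑ i, b' i < n → ∀ X, ∃ Y ∈ S, X ∈ isoClass Y) := by
      intro b'
      by_cases hlt : ∑ i, b' i < n
      · obtain ⟨S, hS, h⟩ := ih _ hlt b' rfl
        exact ⟨S, hS, fun _ => h⟩
      · exact ⟨∅, Set.finite_empty, fun h => absurd h hlt⟩
    choose S hSf hS using ih'
    -- indecomposables
    obtain ⟨S₁, hS₁f, hS₁⟩ := finite_reps_of_rel (s := s) (t := t) (b := b) (K := K)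
      (Set.finite_univ (α := Unit))
      (fun X _ => QIndec (V := fun i => Fin (b i) → K) (toQ X)) (by
        intro X Y _ hX hY
        have h1 := orbit_open_of_rigid X (qringel hQ _ _ _ rfl hX)
        have h2 := orbit_open_of_rigid Y (qringel hQ _ _ _ rfl hY)
        obtain ⟨Z, hZ1, hZ2⟩ := repPt_open_inter h1 h2 ⟨X, isoClass_refl X⟩ ⟨Y, isoClass_refl Y⟩
        exact isoClass_trans hZ1 (isoClass_symm hZ2))
    -- decomposables
    let D : Set ((p : (Fin nv → ℕ) × (Fin nv → ℕ)) × (RepPt s t p.1 K × RepPt s t p.2 K)) :=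
      ⋃ p ∈ Set.Icc (0 : Fin nv → ℕ) b ×ˢ Set.Icc (0 : Fin nv → ℕ) b,
        (fun q => ⟨p, q⟩) '' (S p.1 ×ˢ S p.2)
    have hD : D.Finite := by
      refine Set.Finite.biUnion ((Set.finite_Icc _ _).prod (Set.finite_Icc _ _)) fun p _ => ?_
      exact ((hSf _).prod (hSf _)).image _
    obtain ⟨S₂, hS₂f, hS₂⟩ := finite_reps_of_rel (s := s) (t := t) (b := b) (K := K) hD
      (fun X d => ∃ (U U' : ∀ i, Submodule K (Fin (b i) → K))
        (hU : QStable (V := fun i => Fin (b i) → K) (toQ X) U)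
        (hU' : QStable (V := fun i => Fin (b i) → K) (toQ X) U'), (∀ i, IsCompl (U i) (U' i)) ∧
        QIso (V := fun i => U i) (W := fun i => Fin (d.1.1 i) → K) (s := s) (t := t)
          (fun e => (toQ X e).restrict (hU e)) (toQ d.2.1) ∧
        QIso (V := fun i => U' i) (W := fun i => Fin (d.1.2 i) → K) (s := s) (t := t)
          (fun e => (toQ X e).restrict (hU' e)) (toQ d.2.2)) (by
        rintro X Y d ⟨U, U', hU, hU', hc, h1, h2⟩ ⟨T, T', hT, hT', hc', h3, h4⟩
        apply isoClass_of_qIso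
        exact qIso_of_decomp hU hU' hT hT' hc hc' (h1.trans h3.symm) (h2.trans h4.symm))
    refine ⟨S₁ ∪ S₂, hS₁f.union hS₂f, fun X => ?_⟩
    by_cases hX : QIndec (V := fun i => Fin (b i) → K) (toQ X)
    · obtain ⟨Y, hY, h⟩ := hS₁ X ⟨(), Set.mem_univ _, hX⟩
      exact ⟨Y, Or.inl hY, h⟩
    · have hX' := hX
      unfold QIndec at hX'
      push Not at hX'
      obtain ⟨U, U', hU, hU', hc, ⟨i1, hi1⟩, ⟨i2, hi2⟩⟩ := hX'
      have hsum : ∀ i, Module.finrank K (U i) + Module.finrank K (U' i) = b i := by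
        intro i
        rw [Submodule.finrank_add_eq_of_isCompl (hc i)]
        simp
      have hlt1 : ∑ i, Module.finrank K (U i) < n := by
        rw [← hb]
        refine Finset.sum_lt_sum (fun i _ => by have := hsum i; omega) ⟨i2, Finset.mem_univ _, ?_⟩
        have := hsum i2
        have : Module.finrank K (U' i2) ≠ 0 := fun h0 => hi2 (Submodule.finrank_eq_zero.1 h0)
        omega
      have hlt2 : ∑ i, Module.finrank K (U' i) < n := by
        rw [← hb]
        refine Finset.sum_lt_sum (fun i _ => by have := hsum i; omega) ⟨i1, Finset.mem_univ _, ?_⟩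
        have := hsum i1
        have : Module.finrank K (U i1) ≠ 0 := fun h0 => hi1 (Submodule.finrank_eq_zero.1 h0)
        omega
      have iso_toQ : ∀ {b' : Fin nv → ℕ} {A B : RepPt s t b' K}, A ∈ isoClass B →
          QIso (V := fun i => Fin (b' i) → K) (W := fun i => Fin (b' i) → K) (toQ A) (toQ B) := by
        rintro b' A B ⟨φ, h1, h2⟩
        apply QIso.symm
        refine ⟨fun i => LinearEquiv.ofBijective (φ i).mulVecLin (h2 i), fun e x => ?_⟩
        have := congrArg (fun M => M.mulVec x) (h1 e)
        simpa [toQ, ← Matrix.mulVec_mulVec] using this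
      obtain ⟨Y1, hY1⟩ := exists_qIso_repPt (V := fun i => U i) (s := s) (t := t)
        (fun e => (toQ X e).restrict (hU e)) (fun i => rfl)
      obtain ⟨Y2, hY2⟩ := exists_qIso_repPt (V := fun i => U' i) (s := s) (t := t)
        (fun e => (toQ X e).restrict (hU' e)) (fun i => rfl)
      obtain ⟨Z1, hZ1, h1⟩ := hS _ hlt1 Y1
      obtain ⟨Z2, hZ2, h2⟩ := hS _ hlt2 Y2
      obtain ⟨Y, hY, h⟩ := hS₂ X ⟨⟨(fun i => Module.finrank K (U i), fun i => Module.finrank K (U' i)),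
        (Z1, Z2)⟩, by
          simp only [D, Set.mem_iUnion]
          refine ⟨(fun i => Module.finrank K (U i), fun i => Module.finrank K (U' i)),
            ⟨⟨fun i => Nat.zero_le _, fun i => ?_⟩, ⟨fun i => Nat.zero_le _, fun i => ?_⟩⟩,
            (Z1, Z2), ⟨hZ1, hZ2⟩, rfl⟩
          · have := hsum i
            show Module.finrank K (U i) ≤ b i
            omega
          · have := hsum i
            show Module.finrank K (U' i) ≤ b i
            omega,
        U, U', hU, hU', hc, hY1.trans (iso_toQ h1), hY2.trans (iso_toQ h2)⟩
      exact ⟨Y, Or.inr hY, h⟩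

end Finiteness
section Extensions

variable {K : Type u} [Field K]

lemma exists_split_matrices (K : Type u) [Field K] (a c : ℕ) :
    ∃ (Ja : Matrix (Fin (a + c)) (Fin a) K) (Jc : Matrix (Fin (a + c)) (Fin c) K)
      (Pa : Matrix (Fin a) (Fin (a + c)) K) (Pc : Matrix (Fin c) (Fin (a + c)) K),
      Pa * Ja = 1 ∧ Pc * Jc = 1 ∧ Pa * Jc = 0 ∧ Pc * Ja = 0 ∧ Ja * Pa + Jc * Pc = 1 := by
  refine ⟨(1 : Matrix (Fin (a + c)) (Fin (a + c)) K).submatrix id (Fin.castAdd c),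
    (1 : Matrix (Fin (a + c)) (Fin (a + c)) K).submatrix id (Fin.natAdd a),
    (1 : Matrix (Fin (a + c)) (Fin (a + c)) K).submatrix (Fin.castAdd c) id,
    (1 : Matrix (Fin (a + c)) (Fin (a + c)) K).submatrix (Fin.natAdd a) id, ?_, ?_, ?_, ?_, ?_⟩
  · ext i j; simp [Matrix.mul_apply, Matrix.one_apply]
  · ext i j; simp [Matrix.mul_apply, Matrix.one_apply]
  · ext i j
    have hne : Fin.castAdd c i ≠ Fin.natAdd a j := by
      intro h
      have := congrArg Fin.val h
      simp at this
      omega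
    simp [Matrix.mul_apply, Matrix.one_apply, hne, hne.symm]
  · ext i j
    have hne : Fin.castAdd c j ≠ Fin.natAdd a i := by
      intro h
      have := congrArg Fin.val h
      simp at this
      omega
    simp [Matrix.mul_apply, Matrix.one_apply, hne, hne.symm]
  · ext i j
    have : (1 : Matrix (Fin (a + c)) (Fin (a + c)) K) i j
      = ∑ k, (1 : Matrix (Fin (a + c)) (Fin (a + c)) K) i k *
          (1 : Matrix (Fin (a + c)) (Fin (a + c)) K) k j := by
      rw [← Matrix.mul_apply, Matrix.one_mul]
    rw [this, Fin.sum_univ_add]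
    simp only [Matrix.add_apply, Matrix.mul_apply, Matrix.submatrix_apply]
    rfl

variable {s t : Fin ne → Fin nv} {a c : Fin nv → ℕ}

lemma extSet_param
    (Ja : ∀ i, Matrix (Fin (a i + c i)) (Fin (a i)) K)
    (Jc : ∀ i, Matrix (Fin (a i + c i)) (Fin (c i)) K)
    (Pa : ∀ i, Matrix (Fin (a i)) (Fin (a i + c i)) K)
    (Pc : ∀ i, Matrix (Fin (c i)) (Fin (a i + c i)) K)
    (h1 : ∀ i, Pa i * Ja i = 1) (h2 : ∀ i, Pc i * Jc i = 1) (h3 : ∀ i, Pa i * Jc i = 0)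
    (h4 : ∀ i, Pc i * Ja i = 0) (h5 : ∀ i, Ja i * Pa i + Jc i * Pc i = 1)
    (M : RepPt s t a K) (N : RepPt s t c K) (X : RepPt s t (fun i => a i + c i) K) :
    X ∈ extSet M N ↔ ∃ (h : ∀ i, Matrix (Fin (a i + c i)) (Fin (a i + c i)) K)
      (z : ∀ e, Matrix (Fin (c (t e))) (Fin (a (s e))) K), (∀ i, (h i).det ≠ 0) ∧
      ∀ e, h (t e) * repMat X e = (Ja (t e) * repMat M e * Pa (s e) + Jc (t e) * z e * Pa (s e)
        + Jc (t e) * repMat N e * Pc (s e)) * h (s e) := by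
  constructor
  · rintro ⟨ι, π, hι, hπ, hinj, hsur, hex⟩
    have hl : ∀ i, ∃ l : Matrix (Fin (c i)) (Fin (a i + c i)) K, l * ι i = 1 := by
      intro i
      obtain ⟨l, hl⟩ := LinearMap.exists_leftInverse_of_injective (ι i).mulVecLin
        (LinearMap.ker_eq_bot.2 (hinj i))
      refine ⟨LinearMap.toMatrix' l, ?_⟩
      apply Matrix.toLin'.injective
      rw [Matrix.toLin'_mul, Matrix.toLin'_toMatrix', Matrix.toLin'_apply', hl, Matrix.toLin'_one]
    choose l hl using hl
    have hπι : ∀ i, π i * ι i = 0 := by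
      intro i
      apply Matrix.toLin'.injective
      apply LinearMap.ext
      intro x
      have : (ι i).mulVecLin x ∈ LinearMap.ker (π i).mulVecLin := by
        rw [← hex i]; exact ⟨x, rfl⟩
      rw [LinearMap.mem_ker] at this
      simpa using this
    let h : ∀ i, Matrix (Fin (a i + c i)) (Fin (a i + c i)) K := fun i => Ja i * π i + Jc i * l i
    have hPa : ∀ i, Pa i * h i = π i := by
      intro i
      simp only [h]
      rw [Matrix.mul_add, ← Matrix.mul_assoc, ← Matrix.mul_assoc, h1, h3, Matrix.one_mul,
        Matrix.zero_mul, add_zero]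
    have hPc : ∀ i, Pc i * h i = l i := by
      intro i
      simp only [h]
      rw [Matrix.mul_add, ← Matrix.mul_assoc, ← Matrix.mul_assoc, h2, h4, Matrix.one_mul,
        Matrix.zero_mul, zero_add]
    have hι' : ∀ i, h i * ι i = Jc i := by
      intro i
      simp only [h]
      rw [Matrix.add_mul, Matrix.mul_assoc, Matrix.mul_assoc, hl, hπι, Matrix.mul_one,
        Matrix.mul_zero, zero_add]
    have hdet : ∀ i, (h i).det ≠ 0 := by
      intro i
      rw [← isUnit_iff_ne_zero, ← Matrix.isUnit_iff_isUnit_det, ← Matrix.mulVec_injective_iff_isUnit]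
      have hk : LinearMap.ker (h i).mulVecLin = ⊥ := by
        rw [LinearMap.ker_eq_bot']
        intro v hv
        rw [Matrix.mulVecLin_apply] at hv
        have hv1 : (π i).mulVec v = 0 := by
          rw [← hPa, ← Matrix.mulVec_mulVec, hv, Matrix.mulVec_zero]
        have hv2 : (l i).mulVec v = 0 := by
          rw [← hPc, ← Matrix.mulVec_mulVec, hv, Matrix.mulVec_zero]
        have hv3 : v ∈ LinearMap.ker (π i).mulVecLin := hv1
        rw [← hex i] at hv3
        obtain ⟨w, rfl⟩ := hv3
        rw [Matrix.mulVecLin_apply, Matrix.mulVec_mulVec, hl, Matrix.one_mulVec] at hv2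
        rw [hv2, map_zero]
      exact LinearMap.ker_eq_bot.1 hk
    have hu : ∀ i, IsUnit (h i).det := fun i => isUnit_iff_ne_zero.2 (hdet i)
    refine ⟨h, fun e => Pc (t e) * (h (t e) * repMat X e * (h (s e))⁻¹) * Ja (s e), hdet, fun e => ?_⟩
    obtain ⟨T, hT⟩ : ∃ T, T = h (t e) * repMat X e * (h (s e))⁻¹ := ⟨_, rfl⟩
    beta_reduce
    rw [← hT]
    have hTh : T * h (s e) = h (t e) * repMat X e := by
      rw [hT, Matrix.mul_assoc, Matrix.nonsing_inv_mul _ (hu _), Matrix.mul_one]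
    have e1 : Pa (t e) * T = repMat M e * Pa (s e) := by
      rw [hT, ← Matrix.mul_assoc, ← Matrix.mul_assoc, hPa, hπ, Matrix.mul_assoc, ← hPa,
        Matrix.mul_assoc, Matrix.mul_nonsing_inv _ (hu _), Matrix.mul_one]
    have e2 : T * Jc (s e) = Jc (t e) * repMat N e := by
      rw [← hι' (s e), ← Matrix.mul_assoc, hTh, Matrix.mul_assoc, ← hι e, ← Matrix.mul_assoc, hι']
    have e3 : T = Ja (t e) * repMat M e * Pa (s e) + Jc (t e) * (Pc (t e) * T * Ja (s e)) * Pa (s e)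
        + Jc (t e) * repMat N e * Pc (s e) := by
      calc T = (Ja (t e) * Pa (t e) + Jc (t e) * Pc (t e)) * T := by rw [h5, Matrix.one_mul]
        _ = Ja (t e) * (Pa (t e) * T) + Jc (t e) * (Pc (t e) * (T *
            (1 : Matrix (Fin (a (s e) + c (s e))) (Fin (a (s e) + c (s e))) K))) := by
          simp only [Matrix.add_mul, Matrix.mul_assoc, Matrix.mul_one]
        _ = Ja (t e) * (Pa (t e) * T) + Jc (t e) * (Pc (t e) * (T * (Ja (s e) * Pa (s e)
              + Jc (s e) * Pc (s e)))) := by rw [h5]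
        _ = Ja (t e) * (Pa (t e) * T) + (Jc (t e) * (Pc (t e) * T * Ja (s e)) * Pa (s e)
              + Jc (t e) * (Pc (t e) * (T * Jc (s e))) * Pc (s e)) := by
          simp only [Matrix.mul_add, Matrix.mul_assoc]
        _ = _ := by
          rw [e1, e2, ← Matrix.mul_assoc (Pc (t e)) (Jc (t e)), h2, Matrix.one_mul, ← add_assoc,
            ← Matrix.mul_assoc (Ja (t e))]
    rw [← e3, hTh]
  · rintro ⟨h, z, hdet, hX⟩
    have hu : ∀ i, IsUnit (h i).det := fun i => isUnit_iff_ne_zero.2 (hdet i)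
    have hι0 : ∀ i, Pc i * h i * ((h i)⁻¹ * Jc i) = 1 := by
      intro i
      rw [Matrix.mul_assoc, ← Matrix.mul_assoc (h i), Matrix.mul_nonsing_inv _ (hu _),
        Matrix.one_mul, h2]
    have hπ0 : ∀ i, Pa i * h i * ((h i)⁻¹ * Ja i) = 1 := by
      intro i
      rw [Matrix.mul_assoc, ← Matrix.mul_assoc (h i), Matrix.mul_nonsing_inv _ (hu _),
        Matrix.one_mul, h1]
    have hπι : ∀ i, Pa i * h i * ((h i)⁻¹ * Jc i) = 0 := by
      intro i
      rw [Matrix.mul_assoc, ← Matrix.mul_assoc (h i), Matrix.mul_nonsing_inv _ (hu _),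
        Matrix.one_mul, h3]
    refine ⟨fun i => (h i)⁻¹ * Jc i, fun i => Pa i * h i, fun e => ?_, fun e => ?_, fun i => ?_,
      fun i => ?_, fun i => ?_⟩
    · have e1 : h (t e) * (repMat X e * ((h (s e))⁻¹ * Jc (s e))) = Jc (t e) * repMat N e := by
        rw [← Matrix.mul_assoc, hX, Matrix.mul_assoc, ← Matrix.mul_assoc (h (s e)),
          Matrix.mul_nonsing_inv _ (hu _), Matrix.one_mul]
        simp only [Matrix.add_mul, Matrix.mul_assoc, h3, h2, Matrix.mul_zero, Matrix.mul_one, zero_add]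
      rw [Matrix.mul_assoc, ← e1, ← Matrix.mul_assoc, Matrix.nonsing_inv_mul _ (hu _), Matrix.one_mul]
    · rw [Matrix.mul_assoc, hX]
      simp only [Matrix.add_mul, Matrix.mul_add, ← Matrix.mul_assoc, h1, h3, Matrix.zero_mul,
        Matrix.one_mul, add_zero]
    · intro v w hvw
      have := congrArg (Pc i * h i).mulVec hvw
      simpa only [Matrix.mulVecLin_apply, Matrix.mulVec_mulVec, hι0, Matrix.one_mulVec] using this
    · intro v
      refine ⟨((h i)⁻¹ * Ja i).mulVec v, ?_⟩
      rw [Matrix.mulVecLin_apply, Matrix.mulVec_mulVec, hπ0, Matrix.one_mulVec]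
    · apply le_antisymm
      · rintro _ ⟨v, rfl⟩
        rw [LinearMap.mem_ker, Matrix.mulVecLin_apply, Matrix.mulVecLin_apply, Matrix.mulVec_mulVec,
          hπι, Matrix.zero_mulVec]
      · intro v hv
        rw [LinearMap.mem_ker, Matrix.mulVecLin_apply] at hv
        refine ⟨(Pc i * h i).mulVec v, ?_⟩
        rw [Matrix.mulVecLin_apply, Matrix.mulVec_mulVec]
        have e1 : (h i)⁻¹ * Jc i * (Pc i * h i) = 1 - (h i)⁻¹ * Ja i * (Pa i * h i) := by
          rw [eq_sub_iff_add_eq, add_comm ((h i)⁻¹ * Jc i * (Pc i * h i))]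
          calc _ = (h i)⁻¹ * (Ja i * Pa i + Jc i * Pc i) * h i := by
                simp only [Matrix.add_mul, Matrix.mul_add, Matrix.mul_assoc]
            _ = 1 := by rw [h5, Matrix.mul_one, Matrix.nonsing_inv_mul _ (hu _)]
        rw [e1, Matrix.sub_mulVec, Matrix.one_mulVec, ← Matrix.mulVec_mulVec, hv, Matrix.mulVec_zero,
          sub_zero]

lemma extSet_irreducible [Infinite K] (M : RepPt s t a K) (N : RepPt s t c K) :
    IsIrreducible (extSet M N) := by
  choose Ja Jc Pa Pc h1 h2 h3 h4 h5 using fun i => exists_split_matrices K (a i) (c i)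
  let b : Fin nv → ℕ := fun i => a i + c i
  let τ := ((i : Fin nv) × (Fin (b i) × Fin (b i))) ⊕ ((e : Fin ne) × (Fin (c (t e)) × Fin (a (s e))))
  let hm : (τ → K) → ∀ i, Matrix (Fin (b i)) (Fin (b i)) K :=
    fun x i => Matrix.of fun p q => x (Sum.inl ⟨i, (p, q)⟩)
  let zm : (τ → K) → ∀ e, Matrix (Fin (c (t e))) (Fin (a (s e))) K :=
    fun x e => Matrix.of fun p q => x (Sum.inr ⟨e, (p, q)⟩)
  let Tm : (τ → K) → ∀ e, Matrix (Fin (b (t e))) (Fin (b (s e))) K := fun x e =>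
    Ja (t e) * repMat M e * Pa (s e) + Jc (t e) * zm x e * Pa (s e)
        + Jc (t e) * repMat N e * Pc (s e)
  let d : (τ → K) → K := fun x => ∏ i, (hm x i).det
  have hhm : ∀ i p q, (fun x => hm x i p q) ∈ PolyFun τ K := fun i p q => polyFun_coord _
  have hzm : ∀ e p q, (fun x => zm x e p q) ∈ PolyFun τ K := fun i p q => polyFun_coord _
  have hTm : ∀ e p q, (fun x => Tm x e p q) ∈ PolyFun τ K := by
    intro e p q
    simp only [Tm, Matrix.add_apply]
    refine polyFun_add (polyFun_add (polyFun_const _) ?_) (polyFun_const _)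
    refine polyFun_mulMat (A := fun x => Jc (t e) * zm x e) (B := fun _ => Pa (s e)) ?_
      (fun _ _ => polyFun_const _) p q
    exact polyFun_mulMat (A := fun _ => Jc (t e)) (fun _ _ => polyFun_const _) (hzm e)
  have hd : d ∈ PolyFun τ K :=
    polyFun_prod _ (f := fun i x => (hm x i).det) fun i => polyFun_det (hhm i)
  let F : (τ → K) → (((e : Fin ne) × (Fin (b (t e)) × Fin (b (s e)))) → K) :=
    fun x j => ((hm x (t j.1))⁻¹ * (Tm x j.1 * hm x (s j.1))) j.2.1 j.2.2
  have hF : ∀ x e, repMat (s := s) (t := t) (b := b) (F x) e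
      = (hm x (t e))⁻¹ * (Tm x e * hm x (s e)) := fun x e => rfl
  have hirr := zariski_irreducible hd ?_ (F := F) ?_
  · suffices hEq : extSet M N = F '' {x | d x ≠ 0} by
      rw [hEq]; exact hirr
    ext X
    rw [extSet_param Ja Jc Pa Pc h1 h2 h3 h4 h5]
    constructor
    · rintro ⟨h, z, hdet, hX⟩
      let x : τ → K := Sum.elim (fun j => h j.1 j.2.1 j.2.2) (fun j => z j.1 j.2.1 j.2.2)
      refine ⟨x, Finset.prod_ne_zero_iff.2 fun i _ => hdet i, ?_⟩
      funext ⟨e, p, q⟩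
      have e1 : (hm x (t e))⁻¹ * (Tm x e * hm x (s e)) = repMat X e := by
        have e2 : Tm x e * hm x (s e) = hm x (t e) * repMat X e := (hX e).symm
        rw [e2, ← Matrix.mul_assoc,
          Matrix.nonsing_inv_mul (hm x (t e)) (isUnit_iff_ne_zero.2 (hdet (t e))), Matrix.one_mul]
      exact congrFun (congrFun e1 p) q
    · rintro ⟨x, hx, rfl⟩
      have hx' : ∀ i, (hm x i).det ≠ 0 := fun i => Finset.prod_ne_zero_iff.1 hx i (Finset.mem_univ _)
      refine ⟨hm x, zm x, hx', fun e => ?_⟩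
      have := hF x e
      calc hm x (t e) * repMat (s := s) (t := t) (b := b) (F x) e
          = hm x (t e) * ((hm x (t e))⁻¹ * (Tm x e * hm x (s e))) := by rw [this]
        _ = Tm x e * hm x (s e) := by
          rw [← Matrix.mul_assoc, Matrix.mul_nonsing_inv _ (isUnit_iff_ne_zero.2 (hx' (t e))),
            Matrix.one_mul]
  · let x : τ → K := Sum.elim (fun j => (1 : Matrix (Fin (b j.1)) (Fin (b j.1)) K) j.2.1 j.2.2)
      (fun j => 0)
    refine ⟨x, Finset.prod_ne_zero_iff.2 fun i _ => ?_⟩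
    have : hm x i = 1 := rfl
    rw [this]; simp
  · rintro ⟨e, p, q⟩
    refine ⟨1, fun x => (∏ i ∈ Finset.univ.erase (t e), (hm x i).det) *
      ((hm x (t e)).adjugate * (Tm x e * hm x (s e))) p q, ?_, fun x hx => ?_⟩
    · exact polyFun_mul (polyFun_prod _ (f := fun i x => (hm x i).det) fun i => polyFun_det (hhm i))
        (polyFun_mulMat (polyFun_adj (hhm _)) (polyFun_mulMat (hTm e) (hhm _)) p q)
    · have hx' : (hm x (t e)).det ≠ 0 := Finset.prod_ne_zero_iff.1 hx _ (Finset.mem_univ _)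
      have e1 : d x = (hm x (t e)).det * ∏ i ∈ Finset.univ.erase (t e), (hm x i).det :=
        (Finset.mul_prod_erase _ _ (Finset.mem_univ _)).symm
      have e2 : (hm x (t e)).adjugate = (hm x (t e)).det • (hm x (t e))⁻¹ := by
        rw [Matrix.inv_def, smul_smul, Ring.mul_inverse_cancel _ (isUnit_iff_ne_zero.2 hx'), one_smul]
      beta_reduce
      rw [e2, pow_one, e1, Matrix.smul_mul, Matrix.smul_apply, smul_eq_mul]
      simp only [F]
      ring

lemma extSet_iso {M : RepPt s t a K} {N : RepPt s t c K} {X Y : RepPt s t (fun i => a i + c i) K}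
    (hX : X ∈ extSet M N) (hY : Y ∈ isoClass X) : Y ∈ extSet M N := by
  choose Ja Jc Pa Pc h1 h2 h3 h4 h5 using fun i => exists_split_matrices K (a i) (c i)
  obtain ⟨φ, hφ, hb⟩ := isoClass_symm hY
  rw [extSet_param Ja Jc Pa Pc h1 h2 h3 h4 h5] at hX ⊢
  obtain ⟨h, z, hdet, hX⟩ := hX
  refine ⟨fun i => h i * φ i, z, fun i => ?_, fun e => ?_⟩
  · rw [Matrix.det_mul]
    exact mul_ne_zero (hdet i) ((bijective_iff_det _).1 (hb i))
  · rw [Matrix.mul_assoc, hφ, ← Matrix.mul_assoc, hX, Matrix.mul_assoc]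

end Extensions

theorem extSet_irreducible_unique_dense_open_orbit
    {K : Type*} [Field K] [IsAlgClosed K]
    {s t : Fin ne → Fin nv} (hQ : IsDynkinQuiver s t)
    {a c : Fin nv → ℕ} (M : RepPt s t a K) (N : RepPt s t c K) :
    IsIrreducible (extSet M N) ∧
      ∃! O : Set (RepPt s t (fun i => a i + c i) K),
        (∃ X ∈ extSet M N, O = isoClass X) ∧
        IsOpen (Subtype.val ⁻¹' O : Set (extSet M N)) ∧
        Dense (Subtype.val ⁻¹' O : Set (extSet M N)) := by
  
  have hinf : Infinite K := IsAlgClosed.instInfinite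
  have hirr := extSet_irreducible M N
  refine ⟨hirr, ?_⟩
  obtain ⟨S, hSf, hS⟩ := finite_orbits (K := K) hQ _ (fun i => a i + c i) rfl
  -- some orbit is dense
  obtain ⟨Y, hYS, hYd⟩ : ∃ Y ∈ S, extSet M N ⊆ closure (extSet M N ∩ isoClass Y) := by
    have hfin : ((fun Y => closure (extSet M N ∩ isoClass Y)) '' S).Finite := hSf.image _
    obtain ⟨Z, hZ, hsub⟩ := isIrreducible_iff_sUnion_isClosed.1 hirr hfin.toFinset
      (by
        intro Z hZ
        obtain ⟨Y, -, rfl⟩ := hfin.mem_toFinset.1 hZ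
        exact isClosed_closure)
      (by
        intro X hX
        obtain ⟨Y, hY, hXY⟩ := hS X
        exact ⟨_, hfin.mem_toFinset.2 ⟨Y, hY, rfl⟩, subset_closure ⟨hX, hXY⟩⟩)
    obtain ⟨Y, hY, rfl⟩ := hfin.mem_toFinset.1 hZ
    exact ⟨Y, hY, hsub⟩
  obtain ⟨X, hXE, hXY⟩ : (extSet M N ∩ isoClass Y).Nonempty := by
    obtain ⟨X, hX⟩ := hirr.nonempty
    exact closure_nonempty_iff.1 ⟨X, hYd hX⟩
  rw [← isoClass_eq hXY] at hYd
  refine ⟨isoClass X, ⟨⟨X, hXE, rfl⟩, ?_, ?_⟩, ?_⟩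
  · obtain ⟨Z, U, hZ, hU, hO, -⟩ := orbit_locallyClosed X
    have hEZ : extSet M N ⊆ Z :=
      hYd.trans (closure_minimal (Set.inter_subset_right.trans (hO ▸ Set.inter_subset_left)) hZ)
    have : (Subtype.val ⁻¹' isoClass X : Set (extSet M N)) = Subtype.val ⁻¹' U := by
      ext ⟨W, hW⟩
      rw [hO]
      exact ⟨fun h => h.2, fun h => ⟨hEZ hW, h⟩⟩
    rw [this]
    exact hU.preimage continuous_subtype_val
  · rw [Subtype.dense_iff, Subtype.image_preimage_coe]
    exact hYd
  · rintro O ⟨⟨X', hX', rfl⟩, hopen, hdense⟩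
    obtain ⟨V, hV, hVO⟩ := isOpen_induced_iff.1 hopen
    have hX'V : X' ∈ V := by
      have : (⟨X', hX'⟩ : extSet M N) ∈ (Subtype.val ⁻¹' V : Set (extSet M N)) := by
        rw [hVO]; exact isoClass_refl X'
      exact this
    obtain ⟨W, hWV, hWE, hWX⟩ := mem_closure_iff.1 (hYd hX') V hV hX'V
    have hWX' : W ∈ isoClass X' := by
      have : (⟨W, hWE⟩ : extSet M N) ∈ (Subtype.val ⁻¹' V : Set (extSet M N)) := hWV
      rw [hVO] at this
      exact this
    rw [← isoClass_eq hWX, isoClass_eq hWX']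
end

section
/- The generic extension operation M ∗ N, sending isomorphism classes M, N of finite-dimensional kQ-modules (Q a Dynkin quiver, k algebraically closed) to the isomorphism class of the generic points of ℰ(M, N), makes the set of isomorphism classes of finite-dimensional kQ-modules into a monoid with the zero module as unit; in particular ∗ is associative: (M ∗ N) ∗ L = M ∗ (N ∗ L). -/
variable {nv ne : ℕ}

/-- `X` is a generic point of `ℰ(M, N)`: it lies in `ℰ(M, N)` and its isomorphism class is
dense and open there. -/
def IsGenericExt {s t : Fin ne → Fin nv} {a c : Fin nv → ℕ} {K : Type*} [Field K]
    (X : RepPt s t (fun i => a i + c i) K) (M : RepPt s t a K) (N : RepPt s t c K) : Prop :=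
  X ∈ extSet M N ∧
    IsOpen (Subtype.val ⁻¹' isoClass X : Set (extSet M N)) ∧
    Dense (Subtype.val ⁻¹' isoClass X : Set (extSet M N))

/-- The zero representation. -/
def zeroRep (s t : Fin ne → Fin nv) (K : Type*) [Field K] :
    RepPt s t (fun _ => 0) K := fun _ => 0


section Unb
universe u
variable {K : Type u} [Field K] {s t : Fin ne → Fin nv}
variable {V : Fin nv → Type u} [∀ i, AddCommGroup (V i)] [∀ i, Module K (V i)]
variable {W : Fin nv → Type u} [∀ i, AddCommGroup (W i)] [∀ i, Module K (W i)]
variable {U : Fin nv → Type u} [∀ i, AddCommGroup (U i)] [∀ i, Module K (U i)]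
variable {V' : Fin nv → Type u} [∀ i, AddCommGroup (V' i)] [∀ i, Module K (V' i)]
variable {W' : Fin nv → Type u} [∀ i, AddCommGroup (W' i)] [∀ i, Module K (W' i)]

/-- Structure maps of a representation on the spaces `V i`. -/
abbrev RF (K : Type u) [Field K] (s t : Fin ne → Fin nv) (V : Fin nv → Type u)
    [∀ i, AddCommGroup (V i)] [∀ i, Module K (V i)] := ∀ e, V (s e) →ₗ[K] V (t e)

def IsH (f : RF K s t V) (g : RF K s t W) (φ : ∀ i, V i →ₗ[K] W i) : Prop :=
  ∀ e x, φ (t e) (f e x) = g e (φ (s e) x)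

def RIso (f : RF K s t V) (g : RF K s t W) : Prop :=
  ∃ φ : ∀ i, V i ≃ₗ[K] W i, ∀ e x, φ (t e) (f e x) = g e (φ (s e) x)

theorem RIso.refl (f : RF K s t V) : RIso f f := ⟨fun _ => LinearEquiv.refl _ _, fun _ _ => rfl⟩

theorem RIso.symm {f : RF K s t V} {g : RF K s t W} (h : RIso f g) : RIso g f := by
  obtain ⟨φ, h⟩ := h
  refine ⟨fun i => (φ i).symm, fun e x => ?_⟩
  rw [LinearEquiv.symm_apply_eq, h]; simp

theorem RIso.trans {f : RF K s t V} {g : RF K s t W} {k : RF K s t U}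
    (h : RIso f g) (h' : RIso g k) : RIso f k := by
  obtain ⟨φ, h⟩ := h
  obtain ⟨ψ, h'⟩ := h'
  exact ⟨fun i => (φ i).trans (ψ i), fun e x => by simp [h, h']⟩

/-- the block triangular representation -/
def blk (g : RF K s t W) (ξ : ∀ e, V (s e) →ₗ[K] W (t e)) (f : RF K s t V) :
    RF K s t (fun i => W i × V i) :=
  fun e => LinearMap.prod (g e ∘ₗ LinearMap.fst K _ _ + ξ e ∘ₗ LinearMap.snd K _ _)
    (f e ∘ₗ LinearMap.snd K _ _)

@[simp] theorem blk_apply (g : RF K s t W) (ξ : ∀ e, V (s e) →ₗ[K] W (t e)) (f : RF K s t V)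
    (e) (x : W (s e) × V (s e)) : blk g ξ f e x = (g e x.1 + ξ e x.2, f e x.2) := rfl

theorem blk_congr {g : RF K s t W} {g' : RF K s t W'} {f : RF K s t V} {f' : RF K s t V'}
    (hg : RIso g g') (hf : RIso f f') (ξ : ∀ e, V (s e) →ₗ[K] W (t e)) :
    ∃ ξ', RIso (blk g ξ f) (blk g' ξ' f') := by
  obtain ⟨φ, h⟩ := hg
  obtain ⟨ψ, h'⟩ := hf
  refine ⟨fun e => (φ (t e)).toLinearMap ∘ₗ ξ e ∘ₗ (ψ (s e)).symm.toLinearMap,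
    fun i => (φ i).prodCongr (ψ i), fun e x => ?_⟩
  simp [h, h']

theorem blk_congr_zero {g : RF K s t W} {g' : RF K s t W'} {f : RF K s t V} {f' : RF K s t V'}
    (hg : RIso g g') (hf : RIso f f') :
    RIso (blk g (fun _ => 0) f) (blk g' (fun _ => 0) f') := by
  obtain ⟨φ, h⟩ := hg
  obtain ⟨ψ, h'⟩ := hf
  refine ⟨fun i => (φ i).prodCongr (ψ i), fun e x => ?_⟩
  simp [h, h']

theorem blk_assoc (g : RF K s t W) (η : ∀ e, V (s e) →ₗ[K] W (t e)) (f : RF K s t V)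
    (k : RF K s t U) (ζ : ∀ e, (W (s e) × V (s e)) →ₗ[K] U (t e)) :
    ∃ η' ζ', RIso (blk k ζ (blk g η f)) (blk (blk k η' g) ζ' f) := by
  refine ⟨fun e => ζ e ∘ₗ LinearMap.inl K _ _,
    fun e => LinearMap.prod (ζ e ∘ₗ LinearMap.inr K _ _) (η e),
    RIso.symm ⟨fun i => (LinearEquiv.prodAssoc K (U i) (W i) (V i)), fun e x => ?_⟩⟩
  obtain ⟨⟨x, y⟩, z⟩ := x
  have : ζ e (y, z) = ζ e (y, 0) + ζ e (0, z) := by rw [← map_add]; simp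
  simp [this, add_assoc]

theorem blk_assoc' (g : RF K s t W) (k : RF K s t U) (η' : ∀ e, W (s e) →ₗ[K] U (t e))
    (f : RF K s t V)
    (ζ' : ∀ e, V (s e) →ₗ[K] (U (t e) × W (t e))) :
    ∃ η ζ, RIso (blk (blk k η' g) ζ' f) (blk k ζ (blk g η f)) := by
  refine ⟨fun e => LinearMap.snd K _ _ ∘ₗ ζ' e,
    fun e => η' e ∘ₗ LinearMap.fst K _ _ + LinearMap.fst K _ _ ∘ₗ ζ' e ∘ₗ LinearMap.snd K _ _,
    fun i => (LinearEquiv.prodAssoc K (U i) (W i) (V i)), fun e x => ?_⟩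
  obtain ⟨⟨x, y⟩, z⟩ := x
  simp [add_assoc]

/-- extension in the block sense equals extension in the exact-sequence sense -/
theorem blk_of_exact {f : RF K s t U} {g : RF K s t W} {h : RF K s t V}
    (ι : ∀ i, W i →ₗ[K] U i) (π : ∀ i, U i →ₗ[K] V i) (hι : IsH g f ι) (hπ : IsH f h π)
    (hi : ∀ i, Function.Injective (ι i)) (hs : ∀ i, Function.Surjective (π i))
    (hex : ∀ i, LinearMap.range (ι i) = LinearMap.ker (π i)) :
    ∃ ξ, RIso f (blk g ξ h) := by
  have h1 : ∀ i, ∃ σ : V i →ₗ[K] U i, π i ∘ₗ σ = LinearMap.id := fun i =>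
    (π i).exists_rightInverse_of_surjective (LinearMap.range_eq_top.2 (hs i))
  choose σ hσ using h1
  have hσ' : ∀ i x, π i (σ i x) = x := fun i x => by
    simpa using LinearMap.congr_fun (hσ i) x
  have hπι : ∀ i x, π i (ι i x) = 0 := fun i x => by
    rw [← LinearMap.mem_ker, ← hex]; exact ⟨x, rfl⟩
  have h2 : ∀ i, Function.Bijective ((ι i).coprod (σ i)) := by
    intro i
    constructor
    · rw [injective_iff_map_eq_zero]
      rintro ⟨x, y⟩ hxy
      simp only [LinearMap.coprod_apply] at hxy
      have := congrArg (π i) hxy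
      simp only [map_add, hπι, hσ', zero_add, map_zero] at this
      subst this
      simp only [map_zero, add_zero] at hxy
      rw [(injective_iff_map_eq_zero _).1 (hi i) x hxy]; rfl
    · intro u
      have : u - σ i (π i u) ∈ LinearMap.range (ι i) := by
        rw [hex, LinearMap.mem_ker, map_sub, hσ', sub_self]
      obtain ⟨x, hx⟩ := this
      exact ⟨(x, π i u), by simp [hx]⟩
  let φ := fun i => LinearEquiv.ofBijective _ (h2 i)
  have hφ : ∀ i x y, φ i (x, y) = ι i x + σ i y := fun i x y => rfl
  have h3 : ∀ e (y : V (s e)), ∃ x, ι (t e) x = f e (σ (s e) y) - σ (t e) (h e y) := by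
    intro e y
    have : f e (σ (s e) y) - σ (t e) (h e y) ∈ LinearMap.range (ι (t e)) := by
      rw [hex, LinearMap.mem_ker, map_sub, hσ', hπ, hσ', sub_self]
    exact this
  have h4 : ∀ e, ∃ ξ : V (s e) →ₗ[K] W (t e), ∀ y,
      ι (t e) (ξ y) = f e (σ (s e) y) - σ (t e) (h e y) := by
    intro e
    choose ξ hξ using h3 e
    refine ⟨⟨⟨ξ, fun a b => hi _ ?_⟩, fun c a => hi _ ?_⟩, hξ⟩
    · rw [map_add, hξ, hξ, hξ]; simp only [map_add]; abel
    · dsimp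
      rw [map_smul, hξ, hξ]; simp only [map_smul, smul_sub]
  choose ξ hξ using h4
  refine ⟨ξ, RIso.symm ⟨φ, fun e x => ?_⟩⟩
  obtain ⟨x, y⟩ := x
  rw [blk_apply, hφ, hφ, map_add, map_add, hι, hξ]
  simp only []
  abel

theorem exact_of_blk {f : RF K s t U} {g : RF K s t W} {h : RF K s t V}
    {ξ} (H : RIso f (blk g ξ h)) :
    ∃ (ι : ∀ i, W i →ₗ[K] U i) (π : ∀ i, U i →ₗ[K] V i), IsH g f ι ∧ IsH f h π ∧
    (∀ i, Function.Injective (ι i)) ∧ (∀ i, Function.Surjective (π i)) ∧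
    (∀ i, LinearMap.range (ι i) = LinearMap.ker (π i)) := by
  obtain ⟨φ, hφ⟩ := H
  refine ⟨fun i => (φ i).symm.toLinearMap ∘ₗ LinearMap.inl K _ _,
    fun i => LinearMap.snd K _ _ ∘ₗ (φ i).toLinearMap, ?_, ?_, ?_, ?_, ?_⟩
  · intro e x
    simp only [LinearMap.comp_apply, LinearEquiv.coe_coe]
    rw [LinearEquiv.symm_apply_eq, hφ]
    simp
  · intro e x
    simp [hφ]
  · intro i
    exact (φ i).symm.injective.comp (LinearMap.inl_injective (R := K))
  · intro i
    exact (LinearMap.snd_surjective (R := K)).comp (φ i).surjective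
  · intro i
    ext u
    simp only [LinearMap.mem_range, LinearMap.mem_ker, LinearMap.comp_apply, LinearEquiv.coe_coe,
      LinearMap.snd_apply, LinearMap.inl_apply]
    constructor
    · rintro ⟨y, rfl⟩; simp
    · intro h
      exact ⟨(φ i u).1, by rw [LinearEquiv.symm_apply_eq, ← h]⟩

/-- the complex computing Hom and Ext -/
def Dm (f : RF K s t V) (g : RF K s t W) :
    (∀ i, V i →ₗ[K] W i) →ₗ[K] (∀ e, V (s e) →ₗ[K] W (t e)) where
  toFun φ e := φ (t e) ∘ₗ f e - g e ∘ₗ φ (s e)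
  map_add' φ ψ := by
    funext e; ext x; simp; abel
  map_smul' c φ := by
    funext e; ext x; simp [smul_sub]

@[simp] theorem Dm_apply (f : RF K s t V) (g : RF K s t W) (φ) (e) (x) :
    Dm f g φ e x = φ (t e) (f e x) - g e (φ (s e) x) := rfl

theorem mem_ker_Dm (f : RF K s t V) (g : RF K s t W) (φ) :
    φ ∈ LinearMap.ker (Dm f g) ↔ IsH f g φ := by
  rw [LinearMap.mem_ker]
  constructor
  · intro h e x
    have := LinearMap.congr_fun (congrFun h e) x
    simpa [sub_eq_zero] using this
  · intro h
    funext e; ext x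
    simp [h e x]

theorem Dm_surj_of_inj {f : RF K s t V} {g : RF K s t W} (ι : ∀ i, V i →ₗ[K] W i)
    (hι : IsH f g ι) (hi : ∀ i, Function.Injective (ι i))
    (hs : Function.Surjective (Dm g g)) : Function.Surjective (Dm f g) := by
  intro ψ
  have : ∀ e, ∃ ψ' : W (s e) →ₗ[K] W (t e), ψ' ∘ₗ ι (s e) = ψ e := by
    intro e
    obtain ⟨r, hr⟩ := (ι (s e)).exists_leftInverse_of_injective (LinearMap.ker_eq_bot.2 (hi _))
    exact ⟨ψ e ∘ₗ r, by rw [LinearMap.comp_assoc, hr, LinearMap.comp_id]⟩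
  choose ψ' hψ' using this
  obtain ⟨φ, hφ⟩ := hs ψ'
  refine ⟨fun i => φ i ∘ₗ ι i, ?_⟩
  funext e; ext x
  rw [← hψ' e, ← hφ]
  simp [hι e x]

theorem Dm_surj_of_brick [∀ i, FiniteDimensional K (V i)] (hQ : IsDynkinQuiver s t)
    (f : RF K s t V) (hne : ∃ i, Nontrivial (V i))
    (hb : ∀ φ, IsH f f φ → ∃ c : K, φ = fun _ => c • LinearMap.id) :
    Function.Surjective (Dm f f) := by
  have h1 : Module.finrank K (LinearMap.ker (Dm f f)) ≤ 1 := by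
    refine finrank_le_one (⟨fun i => LinearMap.id, (mem_ker_Dm _ _ _).2 (fun e x => rfl)⟩ :
      LinearMap.ker (Dm f f)) ?_
    rintro ⟨φ, hφ⟩
    obtain ⟨c, rfl⟩ := hb φ ((mem_ker_Dm _ _ _).1 hφ)
    exact ⟨c, rfl⟩
  have h2 := LinearMap.finrank_range_add_finrank_ker (Dm f f)
  have h3 := hQ (fun i => (Module.finrank K (V i) : ℤ)) (by
    obtain ⟨i, hi⟩ := hne
    intro h
    have := congrFun h i
    have h' : 0 < Module.finrank K (V i) := Module.finrank_pos
    simp at this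
    omega)
  rw [← LinearMap.range_eq_top]
  apply Submodule.eq_top_of_finrank_eq
  apply le_antisymm (Submodule.finrank_le _)
  have h4 : Module.finrank K (∀ i, V i →ₗ[K] V i) = ∑ i, Module.finrank K (V i) ^ 2 := by
    rw [Module.finrank_pi_fintype]
    simp [Module.finrank_linearMap, sq]
  have h5 : Module.finrank K (∀ e, V (s e) →ₗ[K] V (t e)) =
      ∑ e, Module.finrank K (V (s e)) * Module.finrank K (V (t e)) := by
    rw [Module.finrank_pi_fintype]
    simp [Module.finrank_linearMap]
  rw [h4] at h2
  rw [h5]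
  have : ((∑ e, Module.finrank K (V (s e)) * Module.finrank K (V (t e)) : ℕ) : ℤ) <
    (∑ i, Module.finrank K (V i) ^ 2 : ℕ) := by push_cast; linarith
  have : (∑ e, Module.finrank K (V (s e)) * Module.finrank K (V (t e)) : ℕ) <
    (∑ i, Module.finrank K (V i) ^ 2 : ℕ) := by exact_mod_cast this
  omega

end Unb

section Gabriel
universe u
variable {K : Type u} [Field K] {s t : Fin ne → Fin nv}
variable {V : Fin nv → Type u} [∀ i, AddCommGroup (V i)] [∀ i, Module K (V i)]
variable {W : Fin nv → Type u} [∀ i, AddCommGroup (W i)] [∀ i, Module K (W i)]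

/-- indecomposable representation -/
def Indec (f : RF K s t V) : Prop :=
  (∃ i, Nontrivial (V i)) ∧ ∀ p : ∀ i, V i →ₗ[K] V i, IsH f f p →
    (∀ i x, p i (p i x) = p i x) → (∀ i x, p i x = 0) ∨ (∀ i x, p i x = x)

/-- restriction to a stable family of subspaces -/
def resR (f : RF K s t V) (A : ∀ i, Submodule K (V i))
    (hA : ∀ e, ∀ x ∈ A (s e), f e x ∈ A (t e)) : RF K s t (fun i => A i) :=
  fun e => (f e).restrict (hA e)

@[simp] theorem resR_coe (f : RF K s t V) (A : ∀ i, Submodule K (V i)) (hA) (e) (x) :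
    ((resR f A hA e x : A (t e)) : V (t e)) = f e x := rfl

theorem sub_eq_of_sum_le [∀ i, FiniteDimensional K (V i)] (A B : ∀ i, Submodule K (V i))
    (h : ∀ i, A i ≤ B i)
    (hs : ∑ i, Module.finrank K (B i) ≤ ∑ i, Module.finrank K (A i)) (i) : A i = B i := by
  have h1 : ∀ i ∈ Finset.univ, Module.finrank K (A i) ≤ Module.finrank K (B i) :=
    fun i _ => Submodule.finrank_mono (h i)
  have h2 := (Finset.sum_eq_sum_iff_of_le h1).1 (le_antisymm (Finset.sum_le_sum h1) hs) i
    (Finset.mem_univ i)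
  exact Submodule.eq_of_le_of_finrank_eq (h i) h2

theorem exists_indec_summand [∀ i, FiniteDimensional K (V i)] (f : RF K s t V)
    (I : ∀ i, Submodule K (V i)) (hI : ∃ i, ∃ x ∈ I i, x ≠ 0) :
    ∃ p : ∀ i, V i →ₗ[K] V i, ∃ hp : IsH f f p, (∀ i x, p i (p i x) = p i x) ∧
      (∃ i, ∃ x ∈ I i, p i x ≠ 0) ∧
      Indec (resR f (fun i => LinearMap.range (p i)) (by
        rintro e _ ⟨x, rfl⟩; exact ⟨f e x, hp e x⟩)) := by
  classical
  let P : (∀ i, V i →ₗ[K] V i) → Prop := fun p => IsH f f p ∧ (∀ i x, p i (p i x) = p i x) ∧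
      (∃ i, ∃ x ∈ I i, p i x ≠ 0)
  have hne : ∃ n : ℕ, ∃ p, P p ∧ ∑ i, Module.finrank K (LinearMap.range (p i)) = n :=
    ⟨_, fun i => LinearMap.id, ⟨fun e x => rfl, fun i x => rfl, by simpa using hI⟩, rfl⟩
  obtain ⟨p, ⟨hp, hpp, hpI⟩, hn⟩ := Nat.find_spec hne
  have hmin : ∀ q, P q → ∑ i, Module.finrank K (LinearMap.range (p i)) ≤
      ∑ i, Module.finrank K (LinearMap.range (q i)) := by
    intro q hq
    rw [hn]
    exact Nat.find_min' hne ⟨q, hq, rfl⟩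
  refine ⟨p, hp, hpp, hpI, ?_, ?_⟩
  · obtain ⟨i, x, -, hx⟩ := hpI
    refine ⟨i, ⟨⟨⟨p i x, ⟨x, rfl⟩⟩, 0, ?_⟩⟩⟩
    intro h; exact hx (congrArg Subtype.val h)
  · intro q hq hqq
    -- the extension of q
    let q' : ∀ i, V i →ₗ[K] V i := fun i =>
      (LinearMap.range (p i)).subtype ∘ₗ q i ∘ₗ (p i).rangeRestrict
    have hpr : ∀ i (y : LinearMap.range (p i)), p i y = y := by
      rintro i ⟨_, x, rfl⟩; exact hpp i x
    have hpr' : ∀ i (y : LinearMap.range (p i)), (p i).rangeRestrict y = y := by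
      intro i y; exact Subtype.ext (hpr i y)
    have hq'v : ∀ i x, q' i x = q i ((p i).rangeRestrict x) := fun i x => rfl
    have hq'r : ∀ i (y : LinearMap.range (p i)), q' i y = q i y := by
      intro i y; rw [hq'v, hpr']
    have hpq' : ∀ i x, p i (q' i x) = q' i x := fun i x => hpr i _
    have hq'p : ∀ i x, q' i (p i x) = q' i x := fun i x => by
      rw [hq'v, hq'v]; congr 2; exact Subtype.ext (hpp i x)
    have hq'h : IsH f f q' := by
      intro e x
      rw [hq'v, hq'v]
      have h1 := hq e ((p (s e)).rangeRestrict x)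
      have h2 := congrArg Subtype.val h1
      rw [resR_coe] at h2
      rw [← h2]
      congr 2
      exact Subtype.ext (hp e x)
    have hq'q' : ∀ i x, q' i (q' i x) = q' i x := by
      intro i x
      rw [hq'v i x, hq'r, hqq]
    by_cases hc : ∃ i, ∃ x ∈ I i, q' i x ≠ 0
    · right
      have h3 := sub_eq_of_sum_le (fun i => LinearMap.range (q' i)) (fun i => LinearMap.range (p i))
        (by rintro i _ ⟨x, rfl⟩; exact ⟨q' i x, hpq' i x⟩) (hmin q' ⟨hq'h, hq'q', hc⟩)
      intro i y
      have : (y : V i) ∈ LinearMap.range (q' i) := by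
        have := h3 i; rw [this]; exact y.2
      obtain ⟨x, hx⟩ := this
      apply Subtype.ext
      rw [← hq'r, ← hx, hq'q']
    · left
      push Not at hc
      have h3 := sub_eq_of_sum_le (fun i => LinearMap.range (p i - q' i))
        (fun i => LinearMap.range (p i))
        (by rintro i _ ⟨x, rfl⟩; exact ⟨p i x - q' i x, by simp [hpq', hpp]⟩)
        (hmin (fun i => p i - q' i) ⟨fun e x => by simp [hp e x, hq'h e x],
          fun i x => by simp [hpp, hpq', hq'p, hq'q'], by
          obtain ⟨i, x, hx, h⟩ := hpI
          exact ⟨i, x, hx, by simpa [hc i x hx] using h⟩⟩)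
      intro i y
      have : (y : V i) ∈ LinearMap.range (p i - q' i) := by
        have := h3 i; rw [this]; exact y.2
      obtain ⟨x, hx⟩ := this
      apply Subtype.ext
      rw [← hq'r, ← hx]
      simp [hq'p, hq'q']

theorem indec_brick [IsAlgClosed K] (hQ : IsDynkinQuiver s t) (n : ℕ) :
    ∀ (V : Fin nv → Type u) [∀ i, AddCommGroup (V i)] [∀ i, Module K (V i)]
    [∀ i, FiniteDimensional K (V i)] (f : RF K s t V), ∑ i, Module.finrank K (V i) = n →
    Indec f → ∀ φ, IsH f f φ → ∃ c : K, φ = fun _ => c • LinearMap.id := by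
  classical
  induction n using Nat.strong_induction_on with
  | _ n IH =>
  intro V _ _ _ f hn hf φ hφ
  by_contra hcon
  push Not at hcon
  let P : (∀ i, V i →ₗ[K] V i) → Prop := fun θ => IsH f f θ ∧ (∃ i x, θ i x ≠ 0) ∧
      (∃ i x, θ i x = 0 ∧ x ≠ 0)
  have hP : ∃ θ, P θ := by
    obtain ⟨i, hi⟩ := hf.1
    obtain ⟨c, hc⟩ := Module.End.exists_eigenvalue (φ i)
    obtain ⟨x, hx⟩ := hc.exists_hasEigenvector
    refine ⟨fun i => φ i - c • LinearMap.id, fun e x => by simp [hφ e x], ?_, i, x, ?_, hx.2⟩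
    · by_contra h
      push Not at h
      exact hcon c (funext fun i => by
        ext x
        have := h i x
        rw [LinearMap.sub_apply, sub_eq_zero] at this
        exact this)
    · simp [hx.apply_eq_smul]
  have hne : ∃ n : ℕ, ∃ p, P p ∧ ∑ i, Module.finrank K (LinearMap.range (p i)) = n := by
    obtain ⟨θ, h⟩ := hP
    exact ⟨_, θ, h, rfl⟩
  obtain ⟨θ, ⟨hθ, hθ0, hθi⟩, hm⟩ := Nat.find_spec hne
  have hmin : ∀ q, P q → ∑ i, Module.finrank K (LinearMap.range (θ i)) ≤
      ∑ i, Module.finrank K (LinearMap.range (q i)) := by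
    intro q hq
    rw [hm]
    exact Nat.find_min' hne ⟨q, hq, rfl⟩
  clear hm hne hP hcon hφ φ
  -- θ² = 0
  have hsq : ∀ i x, θ i (θ i x) = 0 := by
    by_contra h
    push Not at h
    have h3 := sub_eq_of_sum_le (fun i => LinearMap.range (θ i ∘ₗ θ i))
        (fun i => LinearMap.range (θ i))
        (by rintro i _ ⟨x, rfl⟩; exact ⟨θ i x, rfl⟩)
        (hmin (fun i => θ i ∘ₗ θ i) ⟨fun e x => by simp [hθ e], h, by
          obtain ⟨i, x, h, hx⟩ := hθi
          exact ⟨i, x, by simp [h], hx⟩⟩)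
    -- every x is y in range + kernel
    have hdec : ∀ i x, ∃ y, θ i (θ i y) = θ i x := by
      intro i x
      have : θ i x ∈ LinearMap.range (θ i ∘ₗ θ i) := by rw [h3]; exact ⟨x, rfl⟩
      obtain ⟨y, hy⟩ := this
      exact ⟨y, hy⟩
    have hcompl : ∀ i, IsCompl (LinearMap.range (θ i)) (LinearMap.ker (θ i)) := by
      intro i
      have hcod : Codisjoint (LinearMap.range (θ i)) (LinearMap.ker (θ i)) := by
        rw [codisjoint_iff, eq_top_iff]
        intro x _
        obtain ⟨y, hy⟩ := hdec i x
        rw [Submodule.mem_sup]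
        exact ⟨θ i y, ⟨y, rfl⟩, x - θ i y, by simp [hy], by abel⟩
      refine ⟨?_, hcod⟩
      have h4 := Submodule.finrank_sup_add_finrank_inf_eq (LinearMap.range (θ i))
        (LinearMap.ker (θ i))
      rw [hcod.eq_top, LinearMap.finrank_range_add_finrank_ker, finrank_top] at h4
      rw [disjoint_iff, ← Submodule.finrank_eq_zero (R := K)]
      omega
    have hpj := hf.2 (fun i => (LinearMap.range (θ i)).projection _ (hcompl i)) (by
      intro e x
      obtain ⟨y, hy⟩ := hdec _ x
      have hx : x = θ _ y + (x - θ _ y) := by abel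
      have hk : x - θ _ y ∈ LinearMap.ker (θ (s e)) := by simp [hy]
      have hk' : f e (x - θ _ y) ∈ LinearMap.ker (θ (t e)) := by
        rw [LinearMap.mem_ker, hθ, LinearMap.mem_ker.1 hk, map_zero]
      have hr' : f e (θ _ y) ∈ LinearMap.range (θ (t e)) := ⟨f e y, hθ e y⟩
      rw [hx]
      simp only [map_add]
      rw [Submodule.projection_apply_of_mem_left _ hr',
        Submodule.projection_apply_of_mem_left _ (LinearMap.mem_range_self (θ (s e)) y),
        (Submodule.projection_apply_eq_zero_iff _).2 hk',
        (Submodule.projection_apply_eq_zero_iff _).2 hk, map_zero]) (by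
      intro i x
      exact Submodule.projection_apply_left _ ⟨_, Submodule.projection_apply_mem _ _⟩)
    rcases hpj with h0 | h1
    · obtain ⟨i, x, hx⟩ := hθ0
      apply hx
      rw [← h0 i (θ i x)]
      exact (Submodule.projection_apply_of_mem_left (hcompl i) ⟨x, rfl⟩).symm
    · obtain ⟨i, x, h, hx⟩ := hθi
      apply hx
      rw [← h1 i x]
      exact (Submodule.projection_apply_eq_zero_iff _).2 h
  -- the kernel Z
  have hZst : ∀ e, ∀ x ∈ LinearMap.ker (θ (s e)), f e x ∈ LinearMap.ker (θ (t e)) := by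
    intro e x hx
    rw [LinearMap.mem_ker, hθ, LinearMap.mem_ker.1 hx, map_zero]
  have hIst : ∀ e, ∀ x ∈ LinearMap.range (θ (s e)), f e x ∈ LinearMap.range (θ (t e)) := by
    rintro e _ ⟨x, rfl⟩
    exact ⟨f e x, hθ e x⟩
  obtain ⟨p, hp, hpp, hpI, hK⟩ := exists_indec_summand
    (resR f (fun i => LinearMap.ker (θ i)) hZst)
    (fun i => (LinearMap.range (θ i)).comap (LinearMap.ker (θ i)).subtype) (by
      obtain ⟨i, x, hx⟩ := hθ0
      exact ⟨i, ⟨θ i x, hsq i x⟩, ⟨x, rfl⟩, fun h => hx (congrArg Subtype.val h)⟩)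
  -- θ as a map to the kernel
  let θ' : ∀ i, V i →ₗ[K] LinearMap.ker (θ i) := fun i => (θ i).codRestrict _ (hsq i)
  have hθ'v : ∀ i x, ((θ' i x : LinearMap.ker (θ i)) : V i) = θ i x := fun i x => rfl
  have hθ'h : IsH f (resR f (fun i => LinearMap.ker (θ i)) hZst) θ' :=
    fun e x => Subtype.ext (hθ e x)
  -- p is injective on the image of θ
  have hinj : ∀ i x, p i (θ' i x) = 0 → θ i x = 0 := by
    have hker := sub_eq_of_sum_le (fun i => LinearMap.ker (θ i))
      (fun i => LinearMap.ker ((LinearMap.ker (θ i)).subtype ∘ₗ p i ∘ₗ θ' i))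
      (by
        intro i x hx
        have : θ' i x = 0 := Subtype.ext hx
        simp [this])
      (by
        have hm := hmin (fun i => (LinearMap.ker (θ i)).subtype ∘ₗ p i ∘ₗ θ' i) ⟨by
          intro e x
          have h1 := congrArg Subtype.val (hp e (θ' (s e) x))
          rw [← hθ'h] at h1
          exact h1, by
          obtain ⟨i, x, ⟨y, hy⟩, hx⟩ := hpI
          have : x = θ' i y := Subtype.ext hy.symm
          subst this
          exact ⟨i, y, fun h => hx (Subtype.ext h)⟩, by
          obtain ⟨i, x, h, hx⟩ := hθi
          have : θ' i x = 0 := Subtype.ext h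
          exact ⟨i, x, by simp [this], hx⟩⟩
        have e1 : ∑ i, Module.finrank K (LinearMap.range (θ i)) +
            ∑ i, Module.finrank K (LinearMap.ker (θ i)) = ∑ i, Module.finrank K (V i) := by
          rw [← Finset.sum_add_distrib]
          exact Finset.sum_congr rfl fun i _ => LinearMap.finrank_range_add_finrank_ker _
        have e2 : ∑ i, Module.finrank K (LinearMap.range
              ((LinearMap.ker (θ i)).subtype ∘ₗ p i ∘ₗ θ' i)) +
            ∑ i, Module.finrank K (LinearMap.ker
              ((LinearMap.ker (θ i)).subtype ∘ₗ p i ∘ₗ θ' i)) = ∑ i, Module.finrank K (V i) := by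
          rw [← Finset.sum_add_distrib]
          exact Finset.sum_congr rfl fun i _ => LinearMap.finrank_range_add_finrank_ker _
        omega)
    intro i x hx
    have h4 : x ∈ LinearMap.ker ((LinearMap.ker (θ i)).subtype ∘ₗ p i ∘ₗ θ' i) := by
      simp [hx]
    have h5 := hker i
    rw [← h5] at h4
    exact h4
  -- the summand is rigid
  have hlt : ∑ i, Module.finrank K (LinearMap.range (p i)) < n := by
    rw [← hn]
    apply Finset.sum_lt_sum
    · intro i _
      exact (Submodule.finrank_le _).trans (Submodule.finrank_le _)
    · obtain ⟨i, x, hx⟩ := hθ0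
      refine ⟨i, Finset.mem_univ _, (Submodule.finrank_le _).trans_lt (Submodule.finrank_lt ?_)⟩
      intro h
      apply hx
      have : x ∈ LinearMap.ker (θ i) := by rw [h]; trivial
      exact this
  have hbr := Dm_surj_of_brick hQ _ hK.1 (IH _ hlt _ _ rfl hK)
  have hpr : ∀ i (y : LinearMap.range (p i)), p i y = y := by
    rintro i ⟨_, x, rfl⟩; exact hpp i x
  have hsurj := Dm_surj_of_inj (f := resR f (fun i => LinearMap.range (θ i)) hIst)
    (fun i => (p i).rangeRestrict ∘ₗ ((LinearMap.range (θ i)).subtype.codRestrict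
      (LinearMap.ker (θ i)) (by rintro ⟨_, x, rfl⟩; exact hsq i x)))
    (by
      intro e x
      apply Subtype.ext
      exact hp e ⟨x.1, by obtain ⟨_, x, rfl⟩ := x; exact hsq _ x⟩) (by
      intro i
      rw [injective_iff_map_eq_zero]
      rintro ⟨_, x, rfl⟩ h
      apply Subtype.ext
      exact hinj i x (congrArg Subtype.val h)) hbr
  -- extend p to V linearly
  have hr : ∀ i, ∃ r : V i →ₗ[K] LinearMap.range (p i),
      r ∘ₗ (LinearMap.ker (θ i)).subtype = (p i).rangeRestrict :=
    fun i => LinearMap.exists_extend _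
  choose r hr using hr
  have hr' : ∀ i x (hx : θ i x = 0), r i x = (p i).rangeRestrict ⟨x, hx⟩ :=
    fun i x hx => LinearMap.congr_fun (hr i) ⟨x, hx⟩
  let kk : RF K s t (fun i => LinearMap.range (p i)) :=
    resR (resR f (fun i => LinearMap.ker (θ i)) hZst) (fun i => LinearMap.range (p i)) (by
      rintro e _ ⟨x, rfl⟩; exact ⟨_, hp e x⟩)
  have hkk : ∀ e x, (((kk e x : LinearMap.range (p (t e))) : LinearMap.ker (θ (t e))) : V (t e)) =
    f e x := fun e x => rfl
  -- factor the defect through θ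
  have hψ : ∀ e, ∃ ψ : LinearMap.range (θ (s e)) →ₗ[K] LinearMap.range (p (t e)),
      ∀ x, ψ ⟨θ (s e) x, x, rfl⟩ = Dm f kk r e x := by
    intro e
    obtain ⟨σ, hσ⟩ := (θ (s e)).rangeRestrict.exists_rightInverse_of_surjective
      (LinearMap.range_rangeRestrict _)
    refine ⟨Dm f kk r e ∘ₗ σ, fun x => ?_⟩
    rw [LinearMap.comp_apply, ← sub_eq_zero, ← map_sub]
    have hk : θ (s e) (σ ⟨θ (s e) x, x, rfl⟩ - x) = 0 := by
      rw [map_sub, sub_eq_zero]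
      exact congrArg Subtype.val (LinearMap.congr_fun hσ ⟨θ (s e) x, x, rfl⟩)
    generalize σ ⟨θ (s e) x, x, rfl⟩ - x = z at hk
    rw [Dm_apply, hr' _ z hk, hr' _ (f e z) (hZst e z hk), sub_eq_zero]
    exact Subtype.ext (hp e ⟨z, hk⟩)
  choose ψ hψ using hψ
  obtain ⟨φ, hφ⟩ := hsurj ψ
  have hφ' : ∀ e x, φ (t e) ⟨θ (t e) (f e x), f e x, rfl⟩ -
      kk e (φ (s e) ⟨θ (s e) x, x, rfl⟩) =
        r (t e) (f e x) - kk e (r (s e) x) := by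
    intro e x
    have h6 := LinearMap.congr_fun (congrFun hφ e) ⟨θ (s e) x, x, rfl⟩
    rw [hψ, Dm_apply, Dm_apply] at h6
    rw [← h6]
    have h9 : (⟨θ (t e) (f e x), f e x, rfl⟩ : LinearMap.range (θ (t e))) =
        resR f (fun i => LinearMap.range (θ i)) hIst e ⟨θ (s e) x, x, rfl⟩ :=
      Subtype.ext (hθ e x)
    rw [h9]
  let ρ : ∀ i, V i →ₗ[K] V i := fun i => (LinearMap.ker (θ i)).subtype ∘ₗ
    (LinearMap.range (p i)).subtype ∘ₗ (r i - φ i ∘ₗ (θ i).rangeRestrict)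
  have hρk : ∀ i x (hx : θ i x = 0), ρ i x = p i ⟨x, hx⟩ := by
    intro i x hx
    have : (θ i).rangeRestrict x = 0 := Subtype.ext hx
    simp only [ρ, LinearMap.comp_apply, LinearMap.sub_apply, this, map_zero, sub_zero, hr' i x hx]
    rfl
  have hρθ : ∀ i x, θ i (ρ i x) = 0 := by
    intro i x
    exact (((r i - φ i ∘ₗ (θ i).rangeRestrict) x : LinearMap.range (p i)) :
      LinearMap.ker (θ i)).2
  have hfin := hf.2 ρ (by
    intro e x
    have h7 := hφ' e x
    rw [sub_eq_sub_iff_sub_eq_sub] at h7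
    have h8 := congrArg (fun z : LinearMap.range (p (t e)) => ((z : LinearMap.ker (θ (t e))) : V (t e))) h7
    simp only [Submodule.coe_sub, hkk] at h8
    have hv : ∀ i x, ρ i x = ((r i x : LinearMap.ker (θ i)) : V i) -
      ((φ i ⟨θ i x, x, rfl⟩ : LinearMap.ker (θ i)) : V i) := fun i x => rfl
    rw [hv, hv, map_sub, ← neg_sub, h8, neg_sub]) (by
    intro i x
    rw [hρk i (ρ i x) (hρθ i x)]
    exact congrArg Subtype.val (hpr i ((r i - φ i ∘ₗ (θ i).rangeRestrict) x)))
  rcases hfin with h0 | h1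
  · obtain ⟨i, x, -, hx⟩ := hpI
    apply hx
    apply Subtype.ext
    rw [← hρk i x x.2, h0]; rfl
  · obtain ⟨i, x, hx⟩ := hθ0
    apply hx
    rw [← h1 i x, hρθ]

end Gabriel

section PolySection
set_option linter.unusedSectionVars false
universe u
variable {K : Type u} [Field K]

theorem lin_sum {σ : Type*} [Fintype σ] [DecidableEq σ] (l : (σ → K) →ₗ[K] K) (x : σ → K) :
    l x = ∑ i, l (Pi.single i 1) * x i := by
  rw [LinearMap.pi_apply_eq_sum_univ l x]
  refine Finset.sum_congr rfl fun i _ => ?_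
  rw [smul_eq_mul, mul_comm]
  have : (fun j => if i = j then (1 : K) else 0) = Pi.single i 1 := by
    funext j; simp [Pi.single_apply, eq_comm]
  rw [this]

theorem sub_det_mem {T : Type*} (A : Subalgebra K (T → K)) {n : ℕ}
    (M : T → Matrix (Fin n) (Fin n) K) (hM : ∀ i j, (fun z => M z i j) ∈ A) :
    (fun z => (M z).det) ∈ A := by
  have : (fun z => (M z).det) = ∑ σ : Equiv.Perm (Fin n), Equiv.Perm.sign σ •
      ∏ i, (fun z => M z (σ i) i) := by
    funext z
    rw [Matrix.det_apply]
    simp [Finset.sum_apply, Finset.prod_apply]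
  rw [this]
  refine Subalgebra.sum_mem _ fun σ _ => ?_
  rw [Units.smul_def]
  exact zsmul_mem (Subalgebra.prod_mem _ fun i _ => hM _ _) _

theorem sub_adj_mem {T : Type*} (A : Subalgebra K (T → K)) {n : ℕ}
    (M : T → Matrix (Fin n) (Fin n) K) (hM : ∀ i j, (fun z => M z i j) ∈ A) (i j) :
    (fun z => (M z).adjugate i j) ∈ A := by
  simp only [Matrix.adjugate_apply]
  apply sub_det_mem
  intro k l
  by_cases h : k = j
  · subst h
    simp only [Matrix.updateRow_self]
    exact A.algebraMap_mem ((Pi.single i 1 : Fin n → K) l)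
  · simp only [Matrix.updateRow_ne h]
    exact hM k l

variable {V W : Type u} [AddCommGroup V] [Module K V] [FiniteDimensional K V]
  [AddCommGroup W] [Module K W] [FiniteDimensional K W]

theorem exists_PS (D : V →ₗ[K] W) : ∃ (S : (Fin (Module.finrank K (LinearMap.range D)) → K) →ₗ[K] V)
    (P : W →ₗ[K] (Fin (Module.finrank K (LinearMap.range D)) → K)),
    P ∘ₗ D ∘ₗ S = LinearMap.id := by
  let e : LinearMap.range D ≃ₗ[K] (Fin (Module.finrank K (LinearMap.range D)) → K) :=
    LinearEquiv.ofFinrankEq _ _ (by simp)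
  obtain ⟨S, hS⟩ := D.rangeRestrict.exists_rightInverse_of_surjective
      (LinearMap.range_rangeRestrict _)
  obtain ⟨P, hP⟩ := (LinearMap.range D).subtype.exists_leftInverse_of_injective
    (Submodule.ker_subtype _)
  refine ⟨S ∘ₗ e.symm.toLinearMap, e.toLinearMap ∘ₗ P, ?_⟩
  ext1 i
  ext1
  have h1 : ∀ y, D (S y) = y := fun y => congrArg Subtype.val (LinearMap.congr_fun hS y)
  have h2 : ∀ y : LinearMap.range D, P y = y := fun y => LinearMap.congr_fun hP y
  simp [h1, h2]

theorem det_ne_surj {n : ℕ} (D : V →ₗ[K] W) (S : (Fin n → K) →ₗ[K] V) (P : W →ₗ[K] (Fin n → K))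
    (h : (LinearMap.toMatrix' (P ∘ₗ D ∘ₗ S)).det ≠ 0) :
    Function.Surjective (P.domRestrict (LinearMap.range D)) := by
  rw [LinearMap.det_toMatrix'] at h
  intro y
  obtain ⟨x, hx⟩ := (LinearEquiv.ofIsUnitDet (f := P ∘ₗ D ∘ₗ S) (v := Pi.basisFun K (Fin n))
    (v' := Pi.basisFun K (Fin n)) (by
      rw [LinearMap.det_toMatrix]; exact isUnit_iff_ne_zero.2 h)).surjective y
  exact ⟨⟨D (S x), S x, rfl⟩, hx⟩

theorem det_ne_rank {n : ℕ} (D : V →ₗ[K] W) (S : (Fin n → K) →ₗ[K] V) (P : W →ₗ[K] (Fin n → K))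
    (h : (LinearMap.toMatrix' (P ∘ₗ D ∘ₗ S)).det ≠ 0) :
    n ≤ Module.finrank K (LinearMap.range D) := by
  have := LinearMap.finrank_le_finrank_of_surjective (det_ne_surj D S P h)
  simpa using this

theorem rank_section {T : Type*} (A : Subalgebra K (T → K)) (D : T → V →ₗ[K] W)
    (hD : ∀ v (l : W →ₗ[K] K), (fun z => l (D z v)) ∈ A) (z0 : T) :
    ∃ δ ∈ A, δ z0 ≠ 0 ∧ ∀ z, δ z ≠ 0 →
      Module.finrank K (LinearMap.range (D z0)) ≤ Module.finrank K (LinearMap.range (D z)) := by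
  obtain ⟨S, P, h⟩ := exists_PS (D z0)
  refine ⟨fun z => (LinearMap.toMatrix' (P ∘ₗ D z ∘ₗ S)).det, ?_, ?_, ?_⟩
  · apply sub_det_mem
    intro i j
    simp only [LinearMap.toMatrix'_apply, LinearMap.comp_apply]
    exact hD _ (LinearMap.proj i ∘ₗ P)
  · simp [h]
  · intro z hz
    exact det_ne_rank _ _ _ hz

theorem ker_section {T : Type*} (A : Subalgebra K (T → K)) (D : T → V →ₗ[K] W)
    (hD : ∀ v (l : W →ₗ[K] K), (fun z => l (D z v)) ∈ A) (z0 : T) (v : V) (hv : D z0 v = 0) :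
    ∃ δ ∈ A, δ z0 ≠ 0 ∧ ∃ w : T → V, (∀ l : V →ₗ[K] K, (fun z => l (w z)) ∈ A) ∧ w z0 = v ∧
      ∀ z, δ z ≠ 0 → Module.finrank K (LinearMap.range (D z)) ≤
        Module.finrank K (LinearMap.range (D z0)) → D z (w z) = 0 := by
  obtain ⟨S, P, h⟩ := exists_PS (D z0)
  let E := fun z => LinearMap.toMatrix' (P ∘ₗ D z ∘ₗ S)
  have hE : ∀ i j, (fun z => E z i j) ∈ A := by
    intro i j
    simp only [E, LinearMap.toMatrix'_apply, LinearMap.comp_apply]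
    exact hD _ (LinearMap.proj i ∘ₗ P)
  have hdet : (fun z => (E z).det) ∈ A := sub_det_mem A E hE
  have hE0 : (E z0).det ≠ 0 := by simp [E, h]
  refine ⟨fun z => (E z).det, hdet, hE0,
    fun z => (E z).det • v - S ((E z).adjugate.mulVec (P (D z v))), ?_, ?_, ?_⟩
  · intro l
    have : (fun z => l ((E z).det • v - S ((E z).adjugate.mulVec (P (D z v))))) =
        (fun z => (E z).det) * algebraMap K (T → K) (l v) - ∑ i, ∑ j,
          algebraMap K (T → K) (l (S (Pi.single i 1))) * ((fun z => (E z).adjugate i j) *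
            fun z => (LinearMap.proj j ∘ₗ P) (D z v)) := by
      funext z
      have h1 := lin_sum (l ∘ₗ S) ((E z).adjugate.mulVec (P (D z v)))
      simp only [LinearMap.comp_apply] at h1
      rw [map_sub, h1]
      simp only [map_smul, smul_eq_mul, Pi.sub_apply, Pi.mul_apply,
        Finset.sum_apply, Pi.algebraMap_apply, Matrix.mulVec, dotProduct, Finset.mul_sum]
      rfl
    rw [this]
    refine sub_mem (mul_mem hdet (A.algebraMap_mem _)) (Subalgebra.sum_mem _ fun i _ =>
      Subalgebra.sum_mem _ fun j _ => mul_mem (A.algebraMap_mem _)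
        (mul_mem (sub_adj_mem A E hE i j) (hD _ _)))
  · simp [hv, E, h]
  · intro z hz hr
    have hs := det_ne_surj _ _ _ hz
    have h2 := LinearMap.finrank_range_add_finrank_ker (P.domRestrict (LinearMap.range (D z)))
    rw [LinearMap.range_eq_top.2 hs, finrank_top, Module.finrank_fin_fun] at h2
    have h3 : LinearMap.ker (P.domRestrict (LinearMap.range (D z))) = ⊥ := by
      rw [← Submodule.finrank_eq_zero (R := K)]
      omega
    have h4 : P (D z ((E z).det • v - S ((E z).adjugate.mulVec (P (D z v))))) = 0 := by
      have h5 : ∀ y, P (D z (S y)) = (E z).mulVec y := by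
        intro y
        simp only [E, LinearMap.toMatrix'_mulVec]; rfl
      rw [map_sub, map_sub, h5, Matrix.mulVec_mulVec, Matrix.mul_adjugate]
      simp [Matrix.smul_mulVec]
    have h6 := LinearMap.ker_eq_bot.1 h3
    have h7 := (injective_iff_map_eq_zero _).1 h6 ⟨_, _, rfl⟩ h4
    exact congrArg Subtype.val h7

/-- polynomial functions on affine space -/
noncomputable def polyFun (σ : Type*) (K : Type u) [Field K] : Subalgebra K ((σ → K) → K) :=
  (MvPolynomial.aeval (fun i (x : σ → K) => x i) :
    MvPolynomial σ K →ₐ[K] ((σ → K) → K)).range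

theorem mem_polyFun_s5 {σ : Type*} (h : (σ → K) → K) (hh : h ∈ polyFun σ K) :
    ∃ P : MvPolynomial σ K, ∀ x, MvPolynomial.eval x P = h x := by
  obtain ⟨P, rfl⟩ := hh
  refine ⟨P, fun x => ?_⟩
  have : (Pi.evalAlgHom K (fun _ : σ → K => K) x).comp (MvPolynomial.aeval
      (fun i (x : σ → K) => x i)) = MvPolynomial.aeval x := by
    ext i; simp
  have h2 := DFunLike.congr_fun this P
  exact (h2.symm)

theorem linear_mem_polyFun {σ : Type*} [Fintype σ] (l : (σ → K) →ₗ[K] K) :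
    (fun x => l x) ∈ polyFun σ K := by
  classical
  have : (fun x => l x) = ∑ i, algebraMap K ((σ → K) → K) (l (Pi.single i 1)) *
      (fun x : σ → K => x i) := by
    funext x
    rw [lin_sum]
    simp
  rw [this]
  refine Subalgebra.sum_mem _ fun i _ => mul_mem (Subalgebra.algebraMap_mem _ _) ?_
  exact ⟨MvPolynomial.X i, by simp⟩

end PolySection

section Glue
universe u
variable {K : Type u} [Field K] {s t : Fin ne → Fin nv} {b : Fin nv → ℕ}
variable {V : Fin nv → Type u} [∀ i, AddCommGroup (V i)] [∀ i, Module K (V i)]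
variable {W : Fin nv → Type u} [∀ i, AddCommGroup (W i)] [∀ i, Module K (W i)]
variable {W' : Fin nv → Type u} [∀ i, AddCommGroup (W' i)] [∀ i, Module K (W' i)]

/-- index set of matrix entries -/
abbrev Idx (s t : Fin ne → Fin nv) (b : Fin nv → ℕ) : Type :=
  (e : Fin ne) × (Fin (b (t e)) × Fin (b (s e)))

/-- evaluation of a polynomial at a point of the representation variety -/
noncomputable def pev (P : MvPolynomial (Idx s t b) K) (X : RepPt s t b K) : K :=
  MvPolynomial.eval (X : Idx s t b → K) P

/-- the coordinate spaces -/
def Sp (b : Fin nv → ℕ) (K : Type u) (i : Fin nv) : Type u := Fin (b i) → K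

instance (b : Fin nv → ℕ) (i : Fin nv) : AddCommGroup (Sp b K i) :=
  inferInstanceAs (AddCommGroup (Fin (b i) → K))
instance (b : Fin nv → ℕ) (i : Fin nv) : Module K (Sp b K i) :=
  inferInstanceAs (Module K (Fin (b i) → K))
instance (b : Fin nv → ℕ) (i : Fin nv) : FiniteDimensional K (Sp b K i) :=
  inferInstanceAs (FiniteDimensional K (Fin (b i) → K))

theorem finrank_Sp (b : Fin nv → ℕ) (i : Fin nv) : Module.finrank K (Sp b K i) = b i :=
  (Module.finrank_pi K).trans (Fintype.card_fin _)

/-- the linear representation of a point -/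
def repOf (X : RepPt s t b K) : RF K s t (Sp b K) :=
  fun e => (repMat X e).mulVecLin

/-- the point of a linear representation -/
def ptOf (f : RF K s t (Sp b K)) : RepPt s t b K :=
  fun x => f x.1 (Pi.single x.2.2 1) x.2.1

theorem repOf_ptOf (f : RF K s t (Sp b K)) : repOf (ptOf f) = f := by
  funext e
  rw [repOf, ← Matrix.toLin'_apply', ← LinearMap.toMatrix'.symm_apply_apply (f e)]
  rw [LinearMap.toMatrix'_symm]
  congr 1

theorem ptOf_repOf (X : RepPt s t b K) : ptOf (repOf X) = X := by
  funext ⟨e, p, q⟩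
  change ((repMat X e).mulVec (Pi.single q 1)) p = X ⟨e, p, q⟩
  rw [Matrix.mulVec_single_one]
  rfl

/-- transport of structure to a point -/
def ptConj (α : ∀ i, Sp b K i ≃ₗ[K] V i) (f : RF K s t V) : RepPt s t b K :=
  ptOf (fun e => (α (t e)).symm.toLinearMap ∘ₗ f e ∘ₗ (α (s e)).toLinearMap)

theorem ptConj_iso (α : ∀ i, Sp b K i ≃ₗ[K] V i) (f : RF K s t V) :
    RIso (repOf (ptConj α f)) f := by
  rw [ptConj, repOf_ptOf]
  exact ⟨α, fun e x => by simp⟩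

theorem ptConj_eq (α : ∀ i, Sp b K i ≃ₗ[K] V i) (f : RF K s t V) (X : RepPt s t b K)
    (h : ∀ e x, α (t e) (repOf X e x) = f e (α (s e) x)) : ptConj α f = X := by
  rw [ptConj, ← ptOf_repOf X]
  congr 1
  funext e
  apply LinearMap.ext
  intro x
  simp [← h]

theorem exists_pt [∀ i, FiniteDimensional K (V i)] (f : RF K s t V)
    (hb : ∀ i, Module.finrank K (V i) = b i) :
    ∃ X : RepPt s t b K, RIso (repOf X) f := by
  have : ∀ i, Nonempty ((Fin (b i) → K) ≃ₗ[K] V i) := fun i =>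
    FiniteDimensional.nonempty_linearEquiv_of_finrank_eq (by simp [hb])
  exact ⟨ptConj (fun i => (this i).some) f, ptConj_iso _ _⟩

theorem RIso.finrank_eq {f : RF K s t V} {g : RF K s t W} (h : RIso f g) (i) :
    Module.finrank K (V i) = Module.finrank K (W i) := by
  obtain ⟨φ, -⟩ := h
  exact (φ i).finrank_eq

/-- matrices as maps of coordinate spaces -/
def mL {c : Fin nv → ℕ} {i j : Fin nv} (A : Matrix (Fin (c j)) (Fin (b i)) K) :
    Sp b K i →ₗ[K] Sp c K j := A.mulVecLin

/-- the matrix of a map of coordinate spaces -/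
def mM {c : Fin nv → ℕ} {i j : Fin nv} (φ : Sp b K i →ₗ[K] Sp c K j) :
    Matrix (Fin (c j)) (Fin (b i)) K :=
  LinearMap.toMatrix' (m := Fin (c j)) (n := Fin (b i)) φ

theorem mL_mM {c : Fin nv → ℕ} {i j : Fin nv} (φ : Sp b K i →ₗ[K] Sp c K j) :
    mL (mM φ) = φ :=
  Matrix.toLin'_toMatrix' (R := K) (m := Fin (c j)) (n := Fin (b i)) φ

theorem det_mM {i : Fin nv} (φ : Sp b K i →ₗ[K] Sp b K i) : (mM φ).det = LinearMap.det φ :=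
  LinearMap.det_toMatrix' (ι := Fin (b i)) φ

theorem isRepHom_iff {c : Fin nv → ℕ} (X : RepPt s t b K) (Y : RepPt s t c K)
    (φ : ∀ i, Matrix (Fin (c i)) (Fin (b i)) K) :
    IsRepHom X Y φ ↔ IsH (repOf X) (repOf Y) (fun i => mL (φ i)) := by
  refine forall_congr' fun e => ?_
  constructor
  · intro h x
    exact (Matrix.mulVec_mulVec (m := Fin (c (t e))) (n := Fin (b (t e))) (o := Fin (b (s e)))
      x (φ (t e)) (repMat X e)).trans
      ((congrArg (fun Z : Matrix (Fin (c (t e))) (Fin (b (s e))) K => Z.mulVec x) h).trans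
      (Matrix.mulVec_mulVec (m := Fin (c (t e))) (n := Fin (c (s e))) (o := Fin (b (s e)))
      x (repMat Y e) (φ (s e))).symm)
  · intro h
    apply Matrix.toLin'.injective
    apply LinearMap.ext
    intro x
    have := h x
    change (φ (t e)).mulVec ((repMat X e).mulVec x) =
      (repMat Y e).mulVec ((φ (s e)).mulVec x) at this
    rw [Matrix.mulVec_mulVec, Matrix.mulVec_mulVec] at this
    exact this

theorem exists_isRepIso_iff {c : Fin nv → ℕ} (X : RepPt s t b K) (Y : RepPt s t c K) :
    (∃ φ, IsRepIso X Y φ) ↔ RIso (repOf X) (repOf Y) := by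
  constructor
  · rintro ⟨φ, h1, h2⟩
    exact ⟨fun i => LinearEquiv.ofBijective (mL (φ i)) (h2 i), (isRepHom_iff X Y φ).1 h1⟩
  · rintro ⟨φ, h⟩
    refine ⟨fun i => mM (φ i).toLinearMap, ?_, ?_⟩
    · rw [isRepHom_iff]
      simp only [mL_mM]
      exact h
    · intro i
      change Function.Bijective (mL (mM (φ i).toLinearMap))
      rw [mL_mM]; exact (φ i).bijective

theorem isExtensionOf_iff {a c : Fin nv → ℕ} (X : RepPt s t b K) (M : RepPt s t a K)
    (N : RepPt s t c K) :
    IsExtensionOf X M N ↔ ∃ ξ, RIso (repOf X) (blk (repOf N) ξ (repOf M)) := by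
  constructor
  · rintro ⟨ι, π, h1, h2, h3, h4, h5⟩
    exact blk_of_exact (fun i => mL (ι i)) (fun i => mL (π i))
      ((isRepHom_iff _ _ _).1 h1) ((isRepHom_iff _ _ _).1 h2) h3 h4 h5
  · rintro ⟨ξ, h⟩
    obtain ⟨ι, π, h1, h2, h3, h4, h5⟩ := exact_of_blk h
    refine ⟨fun i => mM (ι i), fun i => mM (π i), ?_, ?_, ?_, ?_, ?_⟩
    · rw [isRepHom_iff]; simp only [mL_mM]; exact h1
    · rw [isRepHom_iff]; simp only [mL_mM]; exact h2
    · intro i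
      change Function.Injective (mL (mM (ι i)))
      rw [mL_mM]; exact h3 i
    · intro i
      change Function.Surjective (mL (mM (π i)))
      rw [mL_mM]; exact h4 i
    · intro i
      change LinearMap.range (mL (mM (ι i))) = LinearMap.ker (mL (mM (π i)))
      rw [mL_mM, mL_mM]; exact h5 i

theorem Dm_rank_le [∀ i, FiniteDimensional K (V i)] [∀ i, FiniteDimensional K (W i)]
    [∀ i, FiniteDimensional K (W' i)] (f : RF K s t V) {g : RF K s t W} {g' : RF K s t W'}
    (h : RIso g g') :
    Module.finrank K (LinearMap.range (Dm f g')) ≤ Module.finrank K (LinearMap.range (Dm f g)) := by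
  obtain ⟨φ, hφ⟩ := h
  let Ψ : (∀ e, V (s e) →ₗ[K] W (t e)) →ₗ[K] (∀ e, V (s e) →ₗ[K] W' (t e)) :=
    { toFun := fun ψ e => (φ (t e)).toLinearMap ∘ₗ ψ e
      map_add' := by intro x y; funext e; ext z; simp
      map_smul' := by intro x y; funext e; ext z; simp }
  have : LinearMap.range (Dm f g') ≤ (LinearMap.range (Dm f g)).map Ψ := by
    rintro _ ⟨ψ, rfl⟩
    refine ⟨_, ⟨fun i => (φ i).symm.toLinearMap ∘ₗ ψ i, rfl⟩, ?_⟩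
    funext e; ext z
    simp [Ψ, hφ]
  exact (Submodule.finrank_mono this).trans (Submodule.finrank_map_le _ _)

theorem Dm_poly (X : RepPt s t b K)
    (v : ∀ i, Sp b K i →ₗ[K] Sp b K i)
    (l : (∀ e, Sp b K (s e) →ₗ[K] Sp b K (t e)) →ₗ[K] K) :
    (fun z : Idx s t b → K => l (Dm (repOf X) (repOf (z : RepPt s t b K)) v)) ∈
      polyFun (Idx s t b) K := by
  let L : (Idx s t b → K) →ₗ[K] (∀ e, Sp b K (s e) →ₗ[K] Sp b K (t e)) :=
    { toFun := fun z e => repOf (z : RepPt s t b K) e ∘ₗ v (s e)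
      map_add' := by
        intro x y; funext e
        apply LinearMap.ext; intro z
        exact Matrix.add_mulVec (m := Fin (b (t e))) (n := Fin (b (s e)))
          (repMat (x : RepPt s t b K) e) (repMat (y : RepPt s t b K) e) (v (s e) z)
      map_smul' := by
        intro c x; funext e
        apply LinearMap.ext; intro z
        exact Matrix.smul_mulVec (m := Fin (b (t e))) (n := Fin (b (s e))) c
          (repMat (x : RepPt s t b K) e) (v (s e) z) }
  have : (fun z : Idx s t b → K => l (Dm (repOf X) (repOf (z : RepPt s t b K)) v)) =
    algebraMap K _ (l (fun e => v (t e) ∘ₗ repOf X e)) - fun z => (l ∘ₗ L) z := by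
    funext z
    have : Dm (repOf X) (repOf (z : RepPt s t b K)) v = (fun e => v (t e) ∘ₗ repOf X e) - L z := rfl
    rw [this, map_sub]
    rfl
  rw [this]
  exact sub_mem (Subalgebra.algebraMap_mem _ _) (linear_mem_polyFun _)

theorem exists_pev (h : (Idx s t b → K) → K) (hh : h ∈ polyFun (Idx s t b) K) :
    ∃ P : MvPolynomial (Idx s t b) K, ∀ X : RepPt s t b K, pev P X = h X := mem_polyFun_s5 h hh

theorem rank_lemma (X Z : RepPt s t b K) : ∃ P : MvPolynomial (Idx s t b) K, pev P Z ≠ 0 ∧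
    ∀ Z' : RepPt s t b K, pev P Z' ≠ 0 →
      Module.finrank K (LinearMap.range (Dm (repOf X) (repOf Z))) ≤
      Module.finrank K (LinearMap.range (Dm (repOf X) (repOf Z'))) := by
  obtain ⟨δ, hδ, h0, h⟩ := rank_section (polyFun (Idx s t b) K)
    (fun z : Idx s t b → K => Dm (repOf X) (repOf (z : RepPt s t b K))) (Dm_poly X) Z
  obtain ⟨P, hP⟩ := exists_pev δ hδ
  refine ⟨P, ?_, fun Z' hZ' => h Z' ?_⟩
  · rw [hP]; exact h0
  · rw [hP] at hZ'; exact hZ'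

theorem open_lemma (X : RepPt s t b K) : ∃ P : MvPolynomial (Idx s t b) K, pev P X ≠ 0 ∧
    ∀ Z : RepPt s t b K, pev P Z ≠ 0 →
      Module.finrank K (LinearMap.range (Dm (repOf X) (repOf Z))) ≤
      Module.finrank K (LinearMap.range (Dm (repOf X) (repOf X))) →
      RIso (repOf X) (repOf Z) := by
  obtain ⟨δ, hδ, h0, w, hw, hw0, h⟩ := ker_section (polyFun (Idx s t b) K)
    (fun z : Idx s t b → K => Dm (repOf X) (repOf (z : RepPt s t b K))) (Dm_poly X) X
    (fun i => LinearMap.id) (by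
      have := (mem_ker_Dm (repOf X) (repOf X) (fun i => LinearMap.id)).2 (fun e x => rfl)
      exact this)
  have hmem : δ * ∏ i, (fun z : Idx s t b → K => (mM (w z i)).det) ∈
      polyFun (Idx s t b) K := by
    refine mul_mem hδ (Subalgebra.prod_mem _ fun i _ => sub_det_mem _ _ fun p q => ?_)
    have h1 : ∀ φ : Sp b K i →ₗ[K] Sp b K i, mM φ p q =
        (φ (Pi.single (M := fun _ : Fin (b i) => K) q (1 : K) : Fin (b i) → K) : Fin (b i) → K) p :=
      fun φ => LinearMap.toMatrix'_apply (m := Fin (b i)) (n := Fin (b i)) φ p q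
    let ev : (Sp b K i →ₗ[K] Sp b K i) →ₗ[K] K :=
      { toFun := fun φ => mM φ p q
        map_add' := fun x y => by rw [h1, h1, h1]; rfl
        map_smul' := fun x y => by rw [h1, h1]; rfl }
    exact hw (ev ∘ₗ LinearMap.proj i)
  obtain ⟨P, hP⟩ := exists_pev _ hmem
  have hval : ∀ z : Idx s t b → K, (δ * ∏ i, (fun z : Idx s t b → K => (mM (w z i)).det)) z =
      δ z * ∏ i, LinearMap.det (w z i) := by
    intro z
    simp only [Pi.mul_apply, Finset.prod_apply, det_mM]
  refine ⟨P, ?_, fun Z hZ hr => ?_⟩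
  · refine ne_of_eq_of_ne ((hP X).trans (hval X)) (mul_ne_zero h0 ?_)
    refine Finset.prod_ne_zero_iff.2 fun i _ => ?_
    rw [show w X i = LinearMap.id from congrFun hw0 i]
    simp
  · replace hZ := ne_of_eq_of_ne ((hP Z).trans (hval Z)).symm hZ
    have h1 := left_ne_zero_of_mul hZ
    have h2 := Finset.prod_ne_zero_iff.1 (right_ne_zero_of_mul hZ)
    have h3 : IsH (repOf X) (repOf Z) (w Z) := (mem_ker_Dm _ _ _).1 (h Z h1 hr)
    have h4 : ∀ i, LinearMap.det (w Z i) ≠ 0 := fun i => by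
      exact h2 i (Finset.mem_univ i)
    exact ⟨fun i => LinearMap.equivOfDetNeZero (w Z i) (h4 i), h3⟩

/-- line-open sets -/
def LO {T : Type*} [AddCommGroup T] [Module K T] (U : Set T) : Prop :=
  ∀ x ∈ U, ∀ y, {c : K | x + c • y ∉ U}.Finite

theorem LO_inter [Infinite K] {T : Type*} [AddCommGroup T] [Module K T] {U U' : Set T}
    (h : LO (K := K) U) (h' : LO (K := K) U') (hn : U.Nonempty) (hn' : U'.Nonempty) :
    LO (K := K) (U ∩ U') ∧ (U ∩ U').Nonempty := by
  constructor
  · intro x hx y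
    refine ((h x hx.1 y).union (h' x hx.2 y)).subset ?_
    intro c hc
    by_contra hcc
    simp only [Set.mem_union, Set.mem_ofPred_eq, not_or, not_not] at hcc
    exact hc hcc
  · obtain ⟨x, hx⟩ := hn
    obtain ⟨y, hy⟩ := hn'
    have h1 := h x hx (y - x)
    have h2 := (h' y hy (x - y)).preimage (f := fun c : K => 1 - c)
      (by intro a _ b _ hab; simpa using hab)
    obtain ⟨c, hc⟩ := (h1.union h2).infinite_compl.nonempty
    simp only [Set.mem_compl_iff, Set.mem_union, Set.mem_preimage, Set.mem_ofPred_eq, not_or,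
      not_not] at hc
    refine ⟨x + c • (y - x), hc.1, ?_⟩
    convert hc.2 using 1
    module

theorem LO_finite [Infinite K] {T : Type*} [AddCommGroup T] [Module K T] {ι : Type*}
    (S : Finset ι) (U : ι → Set T) (h : ∀ i ∈ S, LO (K := K) (U i) ∧ (U i).Nonempty) :
    ∃ x, ∀ i ∈ S, x ∈ U i := by
  classical
  suffices H : LO (K := K) {x | ∀ i ∈ S, x ∈ U i} ∧ {x | ∀ i ∈ S, x ∈ U i}.Nonempty from H.2
  induction S using Finset.induction_on with
  | empty =>
    refine ⟨fun x _ y => by simp, 0, by simp⟩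
  | insert a S ha ih =>
    have h1 := ih (fun i hi => h i (Finset.mem_insert_of_mem hi))
    have h2 := h a (Finset.mem_insert_self a S)
    have h3 := LO_inter h2.1 h1.1 h2.2 h1.2
    have : {x | ∀ i ∈ insert a S, x ∈ U i} = U a ∩ {x | ∀ i ∈ S, x ∈ U i} := by
      ext x; simp
    rw [this]; exact h3

theorem pev_line (P : MvPolynomial (Idx s t b) K) (X Y : Idx s t b → K) :
    ∃ p : Polynomial K, ∀ c : K, pev P (X + c • Y : Idx s t b → K) = p.eval c := by
  refine ⟨MvPolynomial.aeval (fun i => Polynomial.C (X i) + Polynomial.X * Polynomial.C (Y i)) P,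
    fun c => ?_⟩
  have : (Polynomial.aeval c).comp (MvPolynomial.aeval
      (fun i => Polynomial.C (X i) + Polynomial.X * Polynomial.C (Y i))) =
      MvPolynomial.aeval (X + c • Y) := by
    apply MvPolynomial.algHom_ext
    intro i
    simp; ring
  have h2 := DFunLike.congr_fun this P
  rw [← Polynomial.coe_aeval_eq_eval]
  exact h2.symm

theorem LO_pev {T : Type*} [AddCommGroup T] [Module K T] (F : T → (Idx s t b → K))
    (hF : ∀ x y, ∃ d : Idx s t b → K, ∀ c : K, F (x + c • y) = F x + c • d)
    (P : MvPolynomial (Idx s t b) K) : LO (K := K) {x | pev P (F x : RepPt s t b K) ≠ 0} := by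
  intro x hx y
  obtain ⟨d, hd⟩ := hF x y
  obtain ⟨p, hp⟩ := pev_line P (F x) d
  have hp0 : p ≠ 0 := by
    rintro rfl
    have := hp 0
    simp only [zero_smul, add_zero, Polynomial.eval_zero] at this
    exact hx this
  refine (Polynomial.finite_setOfPred_isRoot hp0).subset ?_
  intro c hc
  simp only [Set.mem_ofPred_eq, not_not] at hc
  rw [hd, hp] at hc
  exact hc

theorem LO_conj {T : Type*} [AddCommGroup T] [Module K T]
    (α : ∀ i, Sp b K i ≃ₗ[K] V i) (F : T → RF K s t V)
    (hF : ∀ x y, ∃ d : RF K s t V, ∀ c : K, F (x + c • y) = F x + c • d)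
    (P : MvPolynomial (Idx s t b) K) : LO (K := K) {x | pev P (ptConj α (F x)) ≠ 0} := by
  refine LO_pev (fun x => (ptConj α (F x) : Idx s t b → K)) ?_ P
  intro x y
  obtain ⟨d, hd⟩ := hF x y
  refine ⟨ptConj α d, fun c => ?_⟩
  funext z
  rw [hd]
  change _ = ptConj α (F x) z + c • ptConj α d z
  have : ∀ y : Sp b K (s z.1), (α (t z.1)).symm ((F x + c • d) z.1 (α (s z.1) y)) =
    (α (t z.1)).symm (F x z.1 (α (s z.1) y)) + c • (α (t z.1)).symm (d z.1 (α (s z.1) y)) := by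
    intro y
    simp
  exact congrFun (this _) _

/-- two rigid points are isomorphic -/
theorem rigid_unique [Infinite K] (X Y : RepPt s t b K)
    (hX : Function.Surjective (Dm (repOf X) (repOf X)))
    (hY : Function.Surjective (Dm (repOf Y) (repOf Y))) : RIso (repOf X) (repOf Y) := by
  obtain ⟨P, hP, hP'⟩ := open_lemma X
  obtain ⟨Q, hQ, hQ'⟩ := open_lemma Y
  have hT : ∀ P : MvPolynomial (Idx s t b) K,
      LO (K := K) {x : Idx s t b → K | pev P (x : RepPt s t b K) ≠ 0} := fun P =>
    LO_pev (fun x => x) (fun x y => ⟨y, fun c => rfl⟩) P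
  obtain ⟨Z, hZ, hZ'⟩ := (LO_inter (hT P) (hT Q) ⟨X, hP⟩ ⟨Y, hQ⟩).2
  have h1 := hP' Z hZ (by
    rw [LinearMap.range_eq_top.2 hX, finrank_top]; exact Submodule.finrank_le _)
  have h2 := hQ' Z hZ' (by
    rw [LinearMap.range_eq_top.2 hY, finrank_top]; exact Submodule.finrank_le _)
  exact h1.trans h2.symm

end Glue

section Finiteness
universe u
variable {K : Type u} [Field K] {s t : Fin ne → Fin nv} {b : Fin nv → ℕ}
variable {V : Fin nv → Type u} [∀ i, AddCommGroup (V i)] [∀ i, Module K (V i)]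

theorem split_idem (f : RF K s t V) (p : ∀ i, V i →ₗ[K] V i) (hp : IsH f f p)
    (hpp : ∀ i x, p i (p i x) = p i x) :
    ∃ (h1 : ∀ e x, x ∈ LinearMap.range (p (s e)) → f e x ∈ LinearMap.range (p (t e)))
      (h2 : ∀ e x, x ∈ LinearMap.ker (p (s e)) → f e x ∈ LinearMap.ker (p (t e))),
      RIso (blk (resR f (fun i => LinearMap.range (p i)) h1) (fun _ => 0)
        (resR f (fun i => LinearMap.ker (p i)) h2)) f := by
  refine ⟨?_, ?_, ?_⟩
  · rintro e _ ⟨x, rfl⟩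
    exact ⟨f e x, hp e x⟩
  · intro e x hx
    rw [LinearMap.mem_ker] at hx ⊢
    rw [hp, hx, map_zero]
  · refine ⟨fun i => LinearEquiv.ofBijective
      (LinearMap.coprod (LinearMap.range (p i)).subtype (LinearMap.ker (p i)).subtype) ⟨?_, ?_⟩, ?_⟩
    · rw [← LinearMap.ker_eq_bot, LinearMap.ker_eq_bot']
      rintro ⟨⟨_, x, rfl⟩, ⟨y, hy⟩⟩ h
      simp only [LinearMap.coprod_apply, Submodule.coe_subtype] at h
      have h3 := congrArg (p i) h
      rw [map_add, hpp, LinearMap.mem_ker.1 hy, add_zero, map_zero] at h3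
      rw [h3, zero_add] at h
      ext
      · exact h3
      · exact h
    · intro x
      refine ⟨(⟨p i x, x, rfl⟩, ⟨x - p i x, ?_⟩), ?_⟩
      · rw [LinearMap.mem_ker, map_sub, hpp, sub_self]
      · simp
    · intro e x
      exact ((f e).map_add x.1.1 x.2.1).symm ▸ (by
        change f e x.1.1 + (0 : V (t e)) + f e x.2.1 = f e x.1.1 + f e x.2.1
        rw [add_zero])

theorem finite_classes [IsAlgClosed K] (hQ : IsDynkinQuiver s t) (n : ℕ) :
    ∀ (b : Fin nv → ℕ), ∑ i, b i = n → ∃ S : Set (RepPt s t b K), S.Finite ∧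
      ∀ ρ : RepPt s t b K, ∃ ρ' ∈ S, RIso (repOf ρ) (repOf ρ') := by
  haveI : Infinite K := IsAlgClosed.instInfinite
  induction n using Nat.strong_induction_on with
  | _ n ih =>
  intro b hb
  have ih' : ∀ b' : Fin nv → ℕ, ∃ S : Set (RepPt s t b' K), S.Finite ∧
      (∑ i, b' i < n → ∀ ρ : RepPt s t b' K, ∃ ρ' ∈ S, RIso (repOf ρ) (repOf ρ')) := by
    intro b'
    by_cases h : ∑ i, b' i < n
    · obtain ⟨S, h1, h2⟩ := ih _ h b' rfl
      exact ⟨S, h1, fun _ => h2⟩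
    · exact ⟨∅, Set.finite_empty, fun h' => absurd h' h⟩
  choose S hS hS' using ih'
  have hc : ∀ (b1 b2 : Fin nv → ℕ) (A : RepPt s t b1 K) (B : RepPt s t b2 K),
      ∃ X : RepPt s t b K, (∃ Y : RepPt s t b K, RIso (repOf Y)
        (blk (repOf A) (fun _ => 0) (repOf B))) →
        RIso (repOf X) (blk (repOf A) (fun _ => 0) (repOf B)) := by
    intro b1 b2 A B
    by_cases h : ∃ Y : RepPt s t b K, RIso (repOf Y) (blk (repOf A) (fun _ => 0) (repOf B))
    · exact ⟨h.choose, fun _ => h.choose_spec⟩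
    · exact ⟨fun _ => 0, fun h' => absurd h' h⟩
  choose ch hch using hc
  have hr : ∃ R : RepPt s t b K, ∀ ρ : RepPt s t b K,
      Function.Surjective (Dm (repOf ρ) (repOf ρ)) → RIso (repOf ρ) (repOf R) := by
    by_cases h : ∃ R : RepPt s t b K, Function.Surjective (Dm (repOf R) (repOf R))
    · obtain ⟨R, hR⟩ := h
      exact ⟨R, fun ρ hρ => rigid_unique ρ R hρ hR⟩
    · exact ⟨fun _ => 0, fun ρ hρ => absurd ⟨ρ, hρ⟩ h⟩
  obtain ⟨R, hR⟩ := hr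
  refine ⟨{R} ∪ ⋃ b1 ∈ Set.Iic b, ⋃ b2 ∈ Set.Iic b, Set.image2 (ch b1 b2) (S b1) (S b2),
    ?_, fun ρ => ?_⟩
  · refine (Set.finite_singleton R).union ?_
    refine (Set.finite_Iic b).biUnion fun b1 _ => ?_
    refine (Set.finite_Iic b).biUnion fun b2 _ => ?_
    exact (hS b1).image2 _ (hS b2)
  by_cases hrig : Function.Surjective (Dm (repOf ρ) (repOf ρ))
  · exact ⟨R, Or.inl rfl, hR ρ hrig⟩
  have hnI : ¬ Indec (repOf ρ) := fun hI =>
    hrig (Dm_surj_of_brick hQ (repOf ρ) hI.1 (indec_brick hQ _ (Sp b K) (repOf ρ) rfl hI))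
  have hnt : ∃ i, Nontrivial (Sp b K i) := by
    by_contra hcon
    simp only [not_exists, not_nontrivial_iff_subsingleton] at hcon
    apply hrig
    intro y
    refine ⟨0, ?_⟩
    funext e
    apply LinearMap.ext
    intro x
    exact @Subsingleton.elim _ (hcon (t e)) _ _
  have hex : ∃ p : ∀ i, Sp b K i →ₗ[K] Sp b K i, IsH (repOf ρ) (repOf ρ) p ∧
      (∀ i x, p i (p i x) = p i x) ∧ ¬ (∀ i x, p i x = 0) ∧ ¬ (∀ i x, p i x = x) := by
    by_contra hcon
    refine hnI ⟨hnt, fun p h1 h2 => ?_⟩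
    by_contra h3
    rw [not_or] at h3
    exact hcon ⟨p, h1, h2, h3.1, h3.2⟩
  obtain ⟨p, hp, hpp, hp0, hp1⟩ := hex
  obtain ⟨h1, h2, hiso⟩ := split_idem (repOf ρ) p hp hpp
  obtain ⟨A, hA⟩ := exists_pt (b := fun i => Module.finrank K (LinearMap.range (p i)))
    (resR (repOf ρ) (fun i => LinearMap.range (p i)) h1) (fun _ => rfl)
  obtain ⟨B, hB⟩ := exists_pt (b := fun i => Module.finrank K (LinearMap.ker (p i)))
    (resR (repOf ρ) (fun i => LinearMap.ker (p i)) h2) (fun _ => rfl)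
  have hsum : ∀ i, Module.finrank K (LinearMap.range (p i)) +
      Module.finrank K (LinearMap.ker (p i)) = b i := fun i => by
    rw [LinearMap.finrank_range_add_finrank_ker, finrank_Sp]
  have hsum' : ∑ i, Module.finrank K (LinearMap.range (p i)) +
      ∑ i, Module.finrank K (LinearMap.ker (p i)) = n := by
    rw [← Finset.sum_add_distrib, ← hb]
    exact Finset.sum_congr rfl fun i _ => hsum i
  have hpos1 : 0 < ∑ i, Module.finrank K (LinearMap.range (p i)) := by
    simp only [not_forall] at hp0
    obtain ⟨i, x, hx⟩ := hp0
    refine Finset.sum_pos' (fun _ _ => Nat.zero_le _) ⟨i, Finset.mem_univ i, ?_⟩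
    haveI : Nontrivial (LinearMap.range (p i)) :=
      ⟨⟨⟨p i x, x, rfl⟩, 0, fun h => hx (congrArg Subtype.val h)⟩⟩
    exact Module.finrank_pos
  have hpos2 : 0 < ∑ i, Module.finrank K (LinearMap.ker (p i)) := by
    simp only [not_forall] at hp1
    obtain ⟨i, x, hx⟩ := hp1
    refine Finset.sum_pos' (fun _ _ => Nat.zero_le _) ⟨i, Finset.mem_univ i, ?_⟩
    haveI : Nontrivial (LinearMap.ker (p i)) :=
      ⟨⟨⟨x - p i x, by rw [LinearMap.mem_ker, map_sub, hpp, sub_self]⟩, 0,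
        fun h => hx (sub_eq_zero.1 (congrArg Subtype.val h)).symm⟩⟩
    exact Module.finrank_pos
  obtain ⟨A', hA', hAA'⟩ := hS' (fun i => Module.finrank K (LinearMap.range (p i))) (by omega) A
  obtain ⟨B', hB', hBB'⟩ := hS' (fun i => Module.finrank K (LinearMap.ker (p i))) (by omega) B
  have hfin : RIso (repOf ρ) (blk (repOf A') (fun _ => 0) (repOf B')) :=
    hiso.symm.trans (blk_congr_zero (hA.symm.trans hAA') (hB.symm.trans hBB'))
  refine ⟨ch _ _ A' B', Or.inr ?_, hfin.trans (hch _ _ A' B' ⟨ρ, hfin⟩).symm⟩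
  simp only [Set.mem_iUnion]
  exact ⟨_, fun i => (Nat.le_add_right _ _).trans (hsum i).le, _,
    fun i => (Nat.le_add_left _ _).trans (hsum i).le, Set.mem_image2_of_mem hA' hB'⟩

end Finiteness

section GenericExt
universe u
variable {K : Type u} [Field K] {s t : Fin ne → Fin nv} {b : Fin nv → ℕ}
variable {V : Fin nv → Type u} [∀ i, AddCommGroup (V i)] [∀ i, Module K (V i)]
variable {W : Fin nv → Type u} [∀ i, AddCommGroup (W i)] [∀ i, Module K (W i)]
variable {U : Fin nv → Type u} [∀ i, AddCommGroup (U i)] [∀ i, Module K (U i)]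

/-- the isomorphism class of `X` is dense in `S`, in terms of polynomials -/
def PDense (S : Set (RepPt s t b K)) (X : RepPt s t b K) : Prop :=
  ∀ P, (∃ Z ∈ S, pev P Z ≠ 0) → ∃ Z' ∈ S, RIso (repOf X) (repOf Z') ∧ pev P Z' ≠ 0

/-- the isomorphism class of `X` is open in `S`, in terms of polynomials -/
def POpen (S : Set (RepPt s t b K)) (X : RepPt s t b K) : Prop :=
  ∃ P, pev P X ≠ 0 ∧ ∀ Z ∈ S, pev P Z ≠ 0 → RIso (repOf X) (repOf Z)

theorem PDense.pOpen {S : Set (RepPt s t b K)} {X : RepPt s t b K} (h : PDense S X) :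
    POpen S X := by
  obtain ⟨P, hP, hP'⟩ := open_lemma X
  refine ⟨P, hP, fun Z hZ hPZ => hP' Z hPZ ?_⟩
  obtain ⟨Q, hQ, hQ'⟩ := rank_lemma X Z
  obtain ⟨Z', -, h1, h2⟩ := h Q ⟨Z, hZ, hQ⟩
  exact (hQ' Z' h2).trans (Dm_rank_le (repOf X) h1)

theorem PDense.unique {S : Set (RepPt s t b K)} {X X' : RepPt s t b K} (h : PDense S X)
    (hX : X ∈ S) (h' : PDense S X') : RIso (repOf X) (repOf X') := by
  obtain ⟨P, hP, hP'⟩ := h.pOpen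
  obtain ⟨Z, hZ, h1, h2⟩ := h' P ⟨X, hX, hP⟩
  exact (hP' Z hZ h2).trans h1.symm

theorem PDense.of_iso {S : Set (RepPt s t b K)} {X X' : RepPt s t b K} (h : PDense S X)
    (hX : RIso (repOf X) (repOf X')) : PDense S X' := by
  intro P hP
  obtain ⟨Z, hZ, h1, h2⟩ := h P hP
  exact ⟨Z, hZ, hX.symm.trans h1, h2⟩

theorem isOpen_pev (P : MvPolynomial (Idx s t b) K) : IsOpen {X : RepPt s t b K | pev P X ≠ 0} :=
  ⟨_, (PrimeSpectrum.basicOpen P).isOpen, by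
    ext X
    change P ∉ RingHom.ker (MvPolynomial.eval _) ↔ _
    rw [RingHom.mem_ker]
    rfl⟩

theorem exists_pev_of_isOpen {O : Set (RepPt s t b K)} (hO : IsOpen O) {X : RepPt s t b K}
    (hX : X ∈ O) : ∃ P, pev P X ≠ 0 ∧ ∀ Z, pev P Z ≠ 0 → Z ∈ O := by
  obtain ⟨O', hO', rfl⟩ := hO
  obtain ⟨_, ⟨P, rfl⟩, hP, hP'⟩ :=
    PrimeSpectrum.isTopologicalBasis_basic_opens.exists_subset_of_mem_open hX hO'
  refine ⟨P, ?_, fun Z hZ => hP' ?_⟩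
  · intro h
    exact hP ((RingHom.mem_ker).2 h)
  · intro h
    exact hZ ((RingHom.mem_ker).1 h)

/-- extensions, at an arbitrary dimension vector -/
def ExtS (b : Fin nv → ℕ) {a c : Fin nv → ℕ} (M : RepPt s t a K) (N : RepPt s t c K) :
    Set (RepPt s t b K) :=
  {X | ∃ ξ, RIso (repOf X) (blk (repOf N) ξ (repOf M))}

theorem extSet_eq {a c : Fin nv → ℕ} (M : RepPt s t a K) (N : RepPt s t c K) :
    extSet M N = ExtS (fun i => a i + c i) M N := by
  ext X
  exact isExtensionOf_iff X M N

theorem isGenericExt_iff {a c : Fin nv → ℕ} (X : RepPt s t (fun i => a i + c i) K)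
    (M : RepPt s t a K) (N : RepPt s t c K) :
    IsGenericExt X M N ↔ X ∈ ExtS _ M N ∧ PDense (ExtS _ M N) X := by
  unfold IsGenericExt
  rw [extSet_eq]
  have hcl : ∀ Z, Z ∈ isoClass X ↔ RIso (repOf X) (repOf Z) := fun Z => exists_isRepIso_iff X Z
  constructor
  · rintro ⟨h1, -, h3⟩
    refine ⟨h1, fun P ⟨Z, hZ, hPZ⟩ => ?_⟩
    obtain ⟨Z', h4, h5⟩ := h3.inter_open_nonempty (Subtype.val ⁻¹' {X | pev P X ≠ 0})
      ((isOpen_pev P).preimage continuous_subtype_val) ⟨⟨Z, hZ⟩, hPZ⟩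
    exact ⟨Z'.1, Z'.2, (hcl _).1 h5, h4⟩
  · rintro ⟨h1, h2⟩
    refine ⟨h1, ?_, ?_⟩
    · rw [isOpen_iff_forall_mem_open]
      rintro ⟨Z, hZ⟩ hZX
      obtain ⟨P, hP, hP'⟩ := (h2.of_iso ((hcl _).1 hZX)).pOpen
      refine ⟨Subtype.val ⁻¹' {X | pev P X ≠ 0}, ?_,
        (isOpen_pev P).preimage continuous_subtype_val, hP⟩
      rintro ⟨Z', hZ'⟩ h
      exact (hcl _).2 (((hcl _).1 hZX).trans (hP' Z' hZ' h))
    · rw [dense_iff_inter_open]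
      rintro O ⟨O', hO', rfl⟩ ⟨Z, hZ⟩
      obtain ⟨P, hP, hP'⟩ := exists_pev_of_isOpen hO' hZ
      obtain ⟨Z', h3, h4, h5⟩ := h2 P ⟨Z.1, Z.2, hP⟩
      exact ⟨⟨Z', h3⟩, hP' _ h5, (hcl _).2 h4⟩

theorem blk_line (g : RF K s t W) (f : RF K s t V) (x y : ∀ e, V (s e) →ₗ[K] W (t e)) :
    ∃ d : RF K s t (fun i => W i × V i), ∀ c : K, blk g (x + c • y) f = blk g x f + c • d := by
  refine ⟨blk (fun _ => 0) y (fun _ => 0), fun c => ?_⟩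
  funext e
  apply LinearMap.ext
  intro z
  simp [add_assoc]

theorem blk_line_right (k : RF K s t U) (g : RF K s t W) (f : RF K s t V)
    (ζ : ∀ e, (W (s e) × V (s e)) →ₗ[K] U (t e))
    (x y : ∀ e, V (s e) →ₗ[K] W (t e)) :
    ∃ d : RF K s t (fun i => U i × (W i × V i)), ∀ c : K,
      blk k ζ (blk g (x + c • y) f) = blk k ζ (blk g x f) + c • d := by
  obtain ⟨d, hd⟩ := blk_line g f x y
  refine ⟨blk (fun _ => 0) (fun _ => 0) d, fun c => ?_⟩
  rw [hd]
  funext e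
  apply LinearMap.ext
  intro z
  apply Prod.ext
  · simp
  · simp

theorem blk_line_left (k : RF K s t U) (g : RF K s t W) (f : RF K s t V)
    (ζ : ∀ e, V (s e) →ₗ[K] (U (t e) × W (t e)))
    (x y : ∀ e, W (s e) →ₗ[K] U (t e)) :
    ∃ d : RF K s t (fun i => (U i × W i) × V i), ∀ c : K,
      blk (blk k (x + c • y) g) ζ f = blk (blk k x g) ζ f + c • d := by
  obtain ⟨d, hd⟩ := blk_line k g x y
  refine ⟨blk d (fun _ => 0) (fun _ => 0), fun c => ?_⟩
  rw [hd]
  funext e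
  apply LinearMap.ext
  intro z
  apply Prod.ext
  · simp; abel
  · simp

theorem exists_dense [IsAlgClosed K] (hQ : IsDynkinQuiver s t) {a c : Fin nv → ℕ}
    (M : RepPt s t a K) (N : RepPt s t c K) (hb : ∀ i, b i = c i + a i) :
    ∃ X ∈ ExtS b M N, PDense (ExtS b M N) X := by
  have : Infinite K := IsAlgClosed.instInfinite
  have hpt : ∀ ξ, ∃ Z : RepPt s t b K, RIso (repOf Z) (blk (repOf N) ξ (repOf M)) := fun ξ =>
    exists_pt _ (fun i => by rw [Module.finrank_prod, finrank_Sp, finrank_Sp, hb])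
  obtain ⟨S, hS, hS'⟩ := finite_classes (K := K) hQ _ b rfl
  by_cases hex : ∃ ρ ∈ S, PDense (ExtS b M N) ρ
  · obtain ⟨ρ, -, hd⟩ := hex
    obtain ⟨Z, hZ⟩ := hpt (fun _ => 0)
    obtain ⟨Z', h1, h2, -⟩ := hd 1 ⟨Z, ⟨_, hZ⟩, by simp [pev]⟩
    exact ⟨Z', h1, hd.of_iso h2⟩
  exfalso
  have key : ∀ ρ : RepPt s t b K, ∃ O : Set (∀ e, Sp a K (s e) →ₗ[K] Sp c K (t e)), ρ ∈ S →
      (LO (K := K) O ∧ O.Nonempty) ∧ ∀ ξ ∈ O, ¬ RIso (repOf ρ) (blk (repOf N) ξ (repOf M)) := by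
    intro ρ
    by_cases hρ : ρ ∈ S
    · have hnd : ¬ PDense (ExtS b M N) ρ := fun h => hex ⟨ρ, hρ, h⟩
      unfold PDense at hnd
      push Not at hnd
      obtain ⟨P, ⟨Z, ⟨ξ, α, hα⟩, hPZ⟩, hP⟩ := hnd
      have hZ := ptConj_eq α _ Z hα
      refine ⟨{ξ | pev P (ptConj α (blk (repOf N) ξ (repOf M))) ≠ 0}, fun _ =>
        ⟨⟨LO_conj α _ (fun x y => blk_line _ _ x y) P, ⟨ξ, ?_⟩⟩, fun ξ' hξ' hiso => ?_⟩⟩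
      · change pev P (ptConj α (blk (repOf N) ξ (repOf M))) ≠ 0
        rw [hZ]; exact hPZ
      · exact hξ' (hP _ ⟨ξ', ptConj_iso α _⟩ (hiso.trans (ptConj_iso α _).symm))
    · exact ⟨∅, fun h => absurd h hρ⟩
  choose O hO using key
  obtain ⟨ξ, hξ⟩ := LO_finite (K := K) hS.toFinset O
    (fun ρ hρ => (hO ρ (hS.mem_toFinset.1 hρ)).1)
  obtain ⟨Z, hZ⟩ := hpt ξ
  obtain ⟨ρ, hρ, hiso⟩ := hS' Z
  exact (hO ρ hρ).2 ξ (hξ ρ (hS.mem_toFinset.2 hρ)) (hiso.symm.trans hZ)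

theorem ExtS_congr {a c : Fin nv → ℕ} {M M' : RepPt s t a K} {N N' : RepPt s t c K}
    (hM : RIso (repOf M) (repOf M')) (hN : RIso (repOf N) (repOf N')) :
    ExtS b M N = ExtS b M' N' := by
  ext X
  constructor
  · rintro ⟨ξ, h⟩
    obtain ⟨ξ', h'⟩ := blk_congr hN hM ξ
    exact ⟨ξ', h.trans h'⟩
  · rintro ⟨ξ, h⟩
    obtain ⟨ξ', h'⟩ := blk_congr hN.symm hM.symm ξ
    exact ⟨ξ', h.trans h'⟩

/-- triple extensions -/
def Ext3 (b : Fin nv → ℕ) {a c l : Fin nv → ℕ} (M : RepPt s t a K) (N : RepPt s t c K)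
    (L : RepPt s t l K) : Set (RepPt s t b K) :=
  {X | ∃ ζ η, RIso (repOf X) (blk (repOf L) ζ (blk (repOf N) η (repOf M)))}

theorem Ext3_left {a c l d : Fin nv → ℕ} {M : RepPt s t a K} {N : RepPt s t c K}
    {L : RepPt s t l K} {G : RepPt s t d K} (hG : G ∈ ExtS d M N) :
    ExtS b G L ⊆ Ext3 b M N L := by
  obtain ⟨η, hη⟩ := hG
  rintro X ⟨ζ, hζ⟩
  obtain ⟨ζ', h⟩ := blk_congr (RIso.refl (repOf L)) hη ζ
  exact ⟨ζ', η, hζ.trans h⟩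

theorem Ext3_right {a c l d : Fin nv → ℕ} {M : RepPt s t a K} {N : RepPt s t c K}
    {L : RepPt s t l K} {G : RepPt s t d K} (hG : G ∈ ExtS d N L) :
    ExtS b M G ⊆ Ext3 b M N L := by
  obtain ⟨η, hη⟩ := hG
  rintro X ⟨ζ, hζ⟩
  obtain ⟨ζ', h⟩ := blk_congr hη (RIso.refl (repOf M)) ζ
  obtain ⟨η'', ζ'', h'⟩ := blk_assoc' (repOf N) (repOf L) η (repOf M) ζ'
  exact ⟨ζ'', η'', hζ.trans (h.trans h')⟩

theorem dense_left [Infinite K] {a c l d : Fin nv → ℕ} {M : RepPt s t a K} {N : RepPt s t c K}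
    {L : RepPt s t l K} {G : RepPt s t d K} (hG : G ∈ ExtS d M N) (hG' : PDense (ExtS d M N) G)
    {H : RepPt s t b K} (hH : PDense (ExtS b G L) H) : PDense (Ext3 b M N L) H := by
  rintro P ⟨Z, ⟨ζ, η, α, hα⟩, hPZ⟩
  have hZ := ptConj_eq α _ Z hα
  obtain ⟨Q, hQ, hQ'⟩ := hG'.pOpen
  have hsub := Ext3_left (b := b) (L := L) hG
  obtain ⟨ξ₁, α₁, hα₁⟩ := hG
  have hG1 := ptConj_eq α₁ _ G hα₁
  obtain ⟨ξ, h1, h2⟩ := (LO_inter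
    (LO_conj α₁ (fun x => blk (repOf N) x (repOf M)) (fun x y => blk_line (repOf N) (repOf M) x y) Q)
    (LO_conj α (fun x => blk (repOf L) ζ (blk (repOf N) x (repOf M)))
      (fun x y => blk_line_right (repOf L) (repOf N) (repOf M) ζ x y) P)
    ⟨ξ₁, by change pev _ _ ≠ 0; rw [hG1]; exact hQ⟩
    ⟨η, by change pev _ _ ≠ 0; rw [hZ]; exact hPZ⟩).2
  have h3 := (hQ' _ ⟨ξ, ptConj_iso α₁ _⟩ h1).trans (ptConj_iso α₁ _)
  obtain ⟨ζ', h4⟩ := blk_congr (RIso.refl (repOf L)) h3.symm ζ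
  obtain ⟨Z', h5, h6, h7⟩ := hH P ⟨_, ⟨ζ', (ptConj_iso α _).trans h4⟩, h2⟩
  exact ⟨Z', hsub h5, h6, h7⟩

theorem dense_right [Infinite K] {a c l d : Fin nv → ℕ} {M : RepPt s t a K} {N : RepPt s t c K}
    {L : RepPt s t l K} {G : RepPt s t d K} (hG : G ∈ ExtS d N L) (hG' : PDense (ExtS d N L) G)
    {H : RepPt s t b K} (hH : PDense (ExtS b M G) H) : PDense (Ext3 b M N L) H := by
  rintro P ⟨Z, ⟨ζ₀, η₀, hZ₀⟩, hPZ⟩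
  obtain ⟨η, ζ, hass⟩ := blk_assoc (repOf N) η₀ (repOf M) (repOf L) ζ₀
  obtain ⟨α, hα⟩ := hZ₀.trans hass
  have hZ := ptConj_eq α _ Z hα
  obtain ⟨Q, hQ, hQ'⟩ := hG'.pOpen
  have hsub := Ext3_right (b := b) (M := M) hG
  obtain ⟨ξ₁, α₁, hα₁⟩ := hG
  have hG1 := ptConj_eq α₁ _ G hα₁
  obtain ⟨ξ, h1, h2⟩ := (LO_inter
    (LO_conj α₁ (fun x => blk (repOf L) x (repOf N)) (fun x y => blk_line (repOf L) (repOf N) x y) Q)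
    (LO_conj α (fun x => blk (blk (repOf L) x (repOf N)) ζ (repOf M))
      (fun x y => blk_line_left (repOf L) (repOf N) (repOf M) ζ x y) P)
    ⟨ξ₁, by change pev _ _ ≠ 0; rw [hG1]; exact hQ⟩
    ⟨η, by change pev _ _ ≠ 0; rw [hZ]; exact hPZ⟩).2
  have h3 := (hQ' _ ⟨ξ, ptConj_iso α₁ _⟩ h1).trans (ptConj_iso α₁ _)
  obtain ⟨ζ', h4⟩ := blk_congr h3.symm (RIso.refl (repOf M)) ζ
  obtain ⟨Z', h5, h6, h7⟩ := hH P ⟨_, ⟨ζ', (ptConj_iso α _).trans h4⟩, h2⟩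
  exact ⟨Z', hsub h5, h6, h7⟩

theorem dense_cast {b b' : Fin nv → ℕ} (h : b = b') {a c : Fin nv → ℕ} {M : RepPt s t a K}
    {N : RepPt s t c K} {X : RepPt s t b K} (hX : PDense (ExtS b M N) X) :
    ∃ X' : RepPt s t b' K, RIso (repOf X) (repOf X') ∧ PDense (ExtS b' M N) X' := by
  subst h
  exact ⟨X, RIso.refl _, hX⟩

theorem blk_snd (g : RF K s t W) (ξ : ∀ e, V (s e) →ₗ[K] W (t e)) (f : RF K s t V)
    (hW : ∀ i, Subsingleton (W i)) : RIso (blk g ξ f) f := by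
  refine ⟨fun i => LinearEquiv.ofBijective (LinearMap.snd K (W i) (V i)) ⟨?_, ?_⟩, fun e x => rfl⟩
  · rintro ⟨x, y⟩ ⟨x', y'⟩ h
    exact Prod.ext (Subsingleton.elim _ _) h
  · exact LinearMap.snd_surjective

theorem blk_fst (g : RF K s t W) (ξ : ∀ e, V (s e) →ₗ[K] W (t e)) (f : RF K s t V)
    (hV : ∀ i, Subsingleton (V i)) : RIso (blk g ξ f) g := by
  refine ⟨fun i => LinearEquiv.ofBijective (LinearMap.fst K (W i) (V i)) ⟨?_, ?_⟩, fun e x => ?_⟩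
  · rintro ⟨x, y⟩ ⟨x', y'⟩ h
    exact Prod.ext h (Subsingleton.elim _ _)
  · exact LinearMap.fst_surjective
  · change g e x.1 + ξ e x.2 = g e x.1
    rw [Subsingleton.elim x.2 0, map_zero, add_zero]

theorem subsingleton_Sp (i : Fin nv) : Subsingleton (Sp (fun _ : Fin nv => 0) K i) :=
  inferInstanceAs (Subsingleton (Fin 0 → K))

end GenericExt

theorem genericExt_monoid
    {K : Type*} [Field K] [IsAlgClosed K]
    {s t : Fin ne → Fin nv} (hQ : IsDynkinQuiver s t) :
    -- `∗` is total: generic extensions always exist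
    (∀ {a c : Fin nv → ℕ} (M : RepPt s t a K) (N : RepPt s t c K),
      ∃ X, IsGenericExt X M N) ∧
    -- `∗` is well defined on isomorphism classes
    (∀ {a c : Fin nv → ℕ} (M M' : RepPt s t a K) (N N' : RepPt s t c K)
        (G G' : RepPt s t (fun i => a i + c i) K),
      (∃ φ, IsRepIso M M' φ) → (∃ ψ, IsRepIso N N' ψ) →
      IsGenericExt G M N → IsGenericExt G' M' N' → ∃ χ, IsRepIso G G' χ) ∧
    -- associativity: `(M ∗ N) ∗ L = M ∗ (N ∗ L)`
    (∀ {a c l : Fin nv → ℕ} (M : RepPt s t a K) (N : RepPt s t c K) (L : RepPt s t l K)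
        (G₁ : RepPt s t (fun i => a i + c i) K)
        (H₁ : RepPt s t (fun i => (a i + c i) + l i) K)
        (G₂ : RepPt s t (fun i => c i + l i) K)
        (H₂ : RepPt s t (fun i => a i + (c i + l i)) K),
      IsGenericExt G₁ M N → IsGenericExt H₁ G₁ L →
      IsGenericExt G₂ N L → IsGenericExt H₂ M G₂ →
      ∃ χ, IsRepIso H₁ H₂ χ) ∧
    -- the zero module is a two-sided unit: `M ∗ 0 = M = 0 ∗ M`
    (∀ {a : Fin nv → ℕ} (M : RepPt s t a K) (G : RepPt s t (fun i => a i + 0) K),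
      IsGenericExt G M (zeroRep s t K) → ∃ χ, IsRepIso G M χ) ∧
    (∀ {a : Fin nv → ℕ} (M : RepPt s t a K) (G : RepPt s t (fun i => 0 + a i) K),
      IsGenericExt G (zeroRep s t K) M → ∃ χ, IsRepIso G M χ) := by
  have : Infinite K := IsAlgClosed.instInfinite
  simp only [isGenericExt_iff, exists_isRepIso_iff]
  refine ⟨?_, ?_, ?_, ?_, ?_⟩
  · intro a c M N
    exact exists_dense hQ M N (fun i => add_comm _ _)
  · intro a c M M' N N' G G' hM hN hG hG'
    rw [← ExtS_congr hM hN] at hG'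
    exact hG.2.unique hG.1 hG'.2
  · intro a c l M N L G₁ H₁ G₂ H₂ hG₁ hH₁ hG₂ hH₂
    obtain ⟨H, hH, hH'⟩ := dense_cast (b' := fun i => (a i + c i) + l i)
      (funext fun i => (add_assoc _ _ _).symm) hH₂.2
    exact ((dense_left hG₁.1 hG₁.2 hH₁.2).unique (Ext3_left hG₁.1 hH₁.1)
      (dense_right hG₂.1 hG₂.2 hH')).trans hH.symm
  · rintro a M G ⟨⟨ξ, h⟩, -⟩
    exact h.trans (blk_snd _ ξ _ subsingleton_Sp)
  · rintro a M G ⟨⟨ξ, h⟩, -⟩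
    exact h.trans (blk_fst _ ξ _ subsingleton_Sp)
end
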